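/- Let (S, 𝔪) be a regular local ring containing a field, I an ideal of S with d = dim(S/I). If S/I satisfies Serre's condition S₂, then the highest Lyubeznik number λ_{d,d}(S/I) equals 1. -/

import Mathlib

set_option synthInstance.maxHeartbeats 1000000
set_option maxHeartbeats 1000000

open CategoryTheory Opposite IsLocalRing

set_option linter.all false

section
namespace HL

section OldExt

variable {R : Type} [CommRing R] {X Y : ModuleCat.{0} R}

/-- The module of cocycles. -/
def cocyc (P : ProjectiveResolution X) (Y : ModuleCat.{0} R) (n : ℕ) :
    Submodule R (P.complex.X n ⟶ Y) where
  carrier := {f | P.complex.d (n+1) n ≫ f = 0}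
  add_mem' := by intro a b ha hb; simp only [Set.mem_ofPred_eq] at *; simp [ha, hb]
  zero_mem' := by simp
  smul_mem' := by intro c a ha; simp only [Set.mem_ofPred_eq] at *; simp [ha]

def bdry (P : ProjectiveResolution X) (Y : ModuleCat.{0} R) (n : ℕ)
  (f : P.complex.X n ⟶ Y) : Prop := match n with
  | 0 => f = 0
  | m+1 => ∃ g : P.complex.X m ⟶ Y, P.complex.d (m+1) m ≫ g = f

lemma extMk_smul (P : ProjectiveResolution X) (n : ℕ) (r : R) (f : P.complex.X n ⟶ Y)
    (hf : P.complex.d (n+1) n ≫ f = 0) :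
    P.extMk (r • f) (n+1) rfl (by simp [hf]) = r • P.extMk f (n+1) rfl hf := by
  have := P.extMk_comp_mk₀ f (n+1) rfl hf (r • 𝟙 Y)
  rw [Abelian.Ext.mk₀_smul, Abelian.Ext.comp_smul, Abelian.Ext.comp_mk₀_id] at this
  rw [this]; congr 1

/-- cocycles to `Ext`. -/
noncomputable def toExt (P : ProjectiveResolution X) (Y : ModuleCat.{0} R) (n : ℕ) :
    cocyc P Y n →ₗ[R] Abelian.Ext.{0} X Y n where
  toFun f := P.extMk f.1 (n+1) rfl f.2
  map_add' f g := (P.add_extMk f.1 g.1 (n+1) rfl f.2 g.2).symm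
  map_smul' r f := extMk_smul P n r f.1 f.2

lemma toExt_surj (P : ProjectiveResolution X) (n : ℕ) : Function.Surjective (toExt P Y n) := by
  intro a
  obtain ⟨f, hf, rfl⟩ := P.extMk_surjective a (n+1) rfl
  exact ⟨⟨f, hf⟩, rfl⟩

lemma toExt_ker (P : ProjectiveResolution X) (n : ℕ) (f : cocyc P Y n) :
    toExt P Y n f = 0 ↔ bdry P Y n f.1 := by
  cases n with
  | succ m => exact P.extMk_eq_zero_iff f.1 (m+2) rfl f.2 m rfl
  | zero =>
    constructor
    · intro h
      obtain ⟨f, hf'⟩ := f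
      have hf : P.complex.d 1 0 ≫ f = 0 := hf'
      have h' : P.extMk f 1 rfl hf = 0 := h
      simp only [← P.extEquivCohomologyClass.apply_eq_iff_eq,
        ProjectiveResolution.extEquivCohomologyClass_extMk,
        ProjectiveResolution.extEquivCohomologyClass_zero,
        CochainComplex.HomComplex.CohomologyClass.mk_eq_zero_iff] at h'
      rw [CochainComplex.HomComplex.Cocycle.toSingleMk_mem_coboundaries_iff _ _ _ _ _ 1 (by simp)] at h'
      obtain ⟨g, hg⟩ := h'
      have hz : Limits.IsZero (P.cochainComplex.X 1) :=
        CochainComplex.isZero_of_isStrictlyLE _ 0 1 (by norm_num)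
      rw [hz.eq_of_src g 0, Limits.comp_zero] at hg
      change f = 0
      rw [← cancel_epi (P.cochainComplexXIso (-(0:ℕ):ℤ) 0 rfl).hom]
      rw [← hg]; simp
    · intro h
      have : f = 0 := Subtype.ext h
      simp [this]


/-- functoriality of the complex -/
noncomputable def yonMap {X X' : ModuleCat.{0} R} {P : ProjectiveResolution X} {P' : ProjectiveResolution X'}
    (Y : ModuleCat.{0} R) (φ : P'.complex ⟶ P.complex) :
    P.complex.linearYonedaObj R Y ⟶ P'.complex.linearYonedaObj R Y :=
  (HomologicalComplex.unopFunctor (ModuleCat R) _).map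
    ((((linearYoneda R (ModuleCat R)).obj Y).rightOp.mapHomologicalComplex _).map φ).op

lemma abs_nat {D : Type*} [Category D] {A A' B B' E E' : D} (hop' : B' ≅ A') (hop : B ≅ A)
    (m : B' ⟶ B) (ψ : A' ⟶ A) (h2 : m ≫ hop.hom = hop'.hom ≫ ψ) (l' : B' ⟶ E') (l : B ⟶ E)
    (g : E' ⟶ E) (h1 : l' ≫ g = m ≫ l) :
    (hop'.inv ≫ l') ≫ g = ψ ≫ (hop.inv ≫ l) := by
  have : ψ = hop'.inv ≫ m ≫ hop.hom := by rw [h2]; simp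
  subst this; simp [h1]

lemma isoExt_nat {X X' : ModuleCat.{0} R} {P : ProjectiveResolution X} {P' : ProjectiveResolution X'}
    (Y : ModuleCat.{0} R) (g : X' ⟶ X) (φ : P'.complex ⟶ P.complex)
    (w : φ.f 0 ≫ P.π.f 0 = P'.π.f 0 ≫ g) (n : ℕ) :
    ((Ext R (ModuleCat R) n).map g.op).app Y ≫ (P'.isoExt n Y).hom =
      (P.isoExt n Y).hom ≫ HomologicalComplex.homologyMap (yonMap Y φ) n := by
  have h1 := ProjectiveResolution.isoLeftDerivedObj_inv_naturality g P' P φ w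
    ((linearYoneda R (ModuleCat R)).obj Y).rightOp n
  have h2 := HomologicalComplex.homologyOp_hom_naturality (yonMap Y φ) n
  apply Quiver.Hom.op_inj
  exact abs_nat ((P'.complex.linearYonedaObj R Y).homologyOp n) ((P.complex.linearYonedaObj R Y).homologyOp n) _ _ h2 _ _ _ h1

section
variable (K L : CochainComplex (ModuleCat.{0} R) ℕ) (n : ℕ)

noncomputable def zcyc : ModuleCat.of R (LinearMap.ker (K.d n (n+1)).hom) ⟶ K.cycles n :=
  HomologicalComplex.liftCycles K (ModuleCat.ofHom (LinearMap.ker (K.d n (n+1)).hom).subtype)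
    (n+1) (by simp) (by ext f : 2; exact f.2)

noncomputable def zhom : ModuleCat.of R (LinearMap.ker (K.d n (n+1)).hom) ⟶ K.homology n :=
  zcyc K n ≫ K.homologyπ n

lemma zcyc_i (f : LinearMap.ker (K.d n (n+1)).hom) : K.iCycles n (zcyc K n f) = f.1 := by
  rw [← ModuleCat.comp_apply, zcyc, HomologicalComplex.liftCycles_i]; rfl

lemma iCyc_inj : Function.Injective (K.iCycles n) :=
  (ModuleCat.mono_iff_injective _).1 inferInstance

lemma zcyc_surj : Function.Surjective (zcyc K n) := by
  intro b
  refine ⟨⟨K.iCycles n b, ?_⟩, iCyc_inj K n (zcyc_i ..)⟩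
  exact congrArg (fun k => k.hom b) (K.iCycles_d n (n+1))

lemma zhom_surj : Function.Surjective (zhom K n) := by
  have := (ModuleCat.epi_iff_surjective (K.homologyπ n)).1 inferInstance
  exact this.comp (zcyc_surj K n)

lemma zhom_nat (φ : K ⟶ L) (f : LinearMap.ker (K.d n (n+1)).hom)
    (f' : LinearMap.ker (L.d n (n+1)).hom) (h : f'.1 = φ.f n f.1) :
    HomologicalComplex.homologyMap φ n (zhom K n f) = zhom L n f' := by
  unfold zhom
  rw [ModuleCat.comp_apply, ModuleCat.comp_apply, ← ModuleCat.comp_apply,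
    HomologicalComplex.homologyπ_naturality, ModuleCat.comp_apply]
  congr 1
  apply iCyc_inj
  rw [zcyc_i, ← ModuleCat.comp_apply, HomologicalComplex.cyclesMap_i, ModuleCat.comp_apply, zcyc_i, h]

lemma zhom_ker_aux (i : ℕ) (hi : (ComplexShape.up ℕ).prev n = i)
    (f : LinearMap.ker (K.d n (n+1)).hom) :
    zhom K n f = 0 ↔ ∃ g, K.d i n g = f.1 := by
  have key := (ShortComplex.ShortExact.moduleCat_exact_iff_function_exact _).1
     ((ShortComplex.exact_of_g_is_cokernel (ShortComplex.mk (K.toCycles i n) (K.homologyπ n) (by simp)))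
      (HomologicalComplex.homologyIsCokernel _ i n hi))
  unfold zhom
  rw [ModuleCat.comp_apply]
  refine (key _).trans ⟨fun ⟨g, hg⟩ => ⟨g, ?_⟩, fun ⟨g, hg⟩ => ⟨g, ?_⟩⟩
  · rw [← zcyc_i, ← hg]
    change _ = K.iCycles n (K.toCycles i n g)
    rw [← ModuleCat.comp_apply, HomologicalComplex.toCycles_i]
  · apply iCyc_inj
    rw [zcyc_i]
    change K.iCycles n (K.toCycles i n g) = _
    rw [← ModuleCat.comp_apply, HomologicalComplex.toCycles_i, hg]

end

/-- cocycles to old ext -/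
noncomputable def toOld (P : ProjectiveResolution X) (Y : ModuleCat.{0} R) (n : ℕ) :
    cocyc P Y n →ₗ[R] ((Ext R (ModuleCat R) n).obj (op X)).obj Y :=
  (P.isoExt n Y).inv.hom ∘ₗ (zhom (P.complex.linearYonedaObj R Y) n).hom

lemma toOld_surj (P : ProjectiveResolution X) (Y : ModuleCat.{0} R) (n : ℕ) :
    Function.Surjective (toOld P Y n) :=
  (P.isoExt n Y).toLinearEquiv.symm.surjective.comp (zhom_surj (P.complex.linearYonedaObj R Y) n)

lemma toOld_ker (P : ProjectiveResolution X) (Y : ModuleCat.{0} R) (n : ℕ) (f : cocyc P Y n) :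
    toOld P Y n f = 0 ↔ bdry P Y n f.1 := by
  have h0 : toOld P Y n f = 0 ↔ zhom (P.complex.linearYonedaObj R Y) n f = 0 := by
    have := (P.isoExt n Y).toLinearEquiv.symm.map_eq_zero_iff
      (x := zhom (P.complex.linearYonedaObj R Y) n f)
    exact this
  rw [h0]
  cases n with
  | zero =>
    refine (zhom_ker_aux (P.complex.linearYonedaObj R Y) 0 0 (by simp) f).trans ?_
    rw [HomologicalComplex.shape _ _ _ (by simp)]
    exact ⟨fun ⟨g, hg⟩ => hg.symm, fun h => ⟨0, h.symm⟩⟩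
  | succ m => exact zhom_ker_aux (P.complex.linearYonedaObj R Y) (m+1) m (by simp) f

lemma toOld_nat {X X' : ModuleCat.{0} R} {P : ProjectiveResolution X} {P' : ProjectiveResolution X'}
    (Y : ModuleCat.{0} R) (g : X' ⟶ X) (φ : P'.complex ⟶ P.complex)
    (w : φ.f 0 ≫ P.π.f 0 = P'.π.f 0 ≫ g) (n : ℕ) (f : cocyc P Y n) (f' : cocyc P' Y n)
    (h : f'.1 = φ.f n ≫ f.1) :
    ((Ext R (ModuleCat R) n).map g.op).app Y (toOld P Y n f) = toOld P' Y n f' := by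
  have h1 := isoExt_nat Y g φ w n
  have h2 := zhom_nat _ _ n (yonMap Y φ) f f' h
  have h3 : ((Ext R (ModuleCat R) n).map g.op).app Y = (P.isoExt n Y).hom ≫
    HomologicalComplex.homologyMap (yonMap Y φ) n ≫ (P'.isoExt n Y).inv := by
    rw [← Category.assoc, ← h1, Category.assoc, Iso.hom_inv_id, Category.comp_id]
  rw [h3]
  change (P'.isoExt n Y).inv (HomologicalComplex.homologyMap (yonMap Y φ) n
    ((P.isoExt n Y).hom ((P.isoExt n Y).inv (zhom (P.complex.linearYonedaObj R Y) n f)))) = _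
  rw [← ModuleCat.comp_apply (P.isoExt n Y).inv, Iso.inv_hom_id, ModuleCat.id_apply, h2]
  rfl

noncomputable def quotEquiv {Z A B : Type*} [AddCommGroup Z] [AddCommGroup A] [AddCommGroup B]
    [Module R Z] [Module R A] [Module R B] (p : Z →ₗ[R] A) (q : Z →ₗ[R] B)
    (hp : Function.Surjective p) (hq : Function.Surjective q) (h : LinearMap.ker p = LinearMap.ker q) :
    A ≃ₗ[R] B :=
  (p.quotKerEquivOfSurjective hp).symm ≪≫ₗ (Submodule.quotEquivOfEq _ _ h) ≪≫ₗ
    (q.quotKerEquivOfSurjective hq)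

lemma quotEquiv_apply {Z A B : Type*} [AddCommGroup Z] [AddCommGroup A] [AddCommGroup B]
    [Module R Z] [Module R A] [Module R B] (p : Z →ₗ[R] A) (q : Z →ₗ[R] B)
    (hp : Function.Surjective p) (hq : Function.Surjective q) (h : LinearMap.ker p = LinearMap.ker q)
    (z : Z) : quotEquiv p q hp hq h (p z) = q z := by
  have : (p.quotKerEquivOfSurjective hp).symm (p z) = (LinearMap.ker p).mkQ z := by
    rw [LinearEquiv.symm_apply_eq]; rfl
  simp [quotEquiv, this]

/-- Comparison of the two `Ext`s. -/
noncomputable def oldEquiv (X Y : ModuleCat.{0} R) (n : ℕ) :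
    ((Ext R (ModuleCat R) n).obj (op X)).obj Y ≃ₗ[R] Abelian.Ext.{0} X Y n :=
  quotEquiv (toOld (projectiveResolution X) Y n) (toExt (projectiveResolution X) Y n)
    (toOld_surj _ Y n) (toExt_surj _ n) (by
      ext f; rw [LinearMap.mem_ker, LinearMap.mem_ker, toOld_ker, toExt_ker])

lemma oldEquiv_nat {X X' : ModuleCat.{0} R} (Y : ModuleCat.{0} R) (g : X' ⟶ X) (n : ℕ)
    (a : ((Ext R (ModuleCat R) n).obj (op X)).obj Y) :
    oldEquiv X' Y n (((Ext R (ModuleCat R) n).map g.op).app Y a) =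
      (Abelian.Ext.mk₀ g).comp (oldEquiv X Y n a) (zero_add _) := by
  obtain ⟨f, rfl⟩ := toOld_surj (projectiveResolution X) Y n a
  let φ := ProjectiveResolution.lift g (projectiveResolution X') (projectiveResolution X)
  have w : φ.f 0 ≫ (projectiveResolution X).π.f 0 = (projectiveResolution X').π.f 0 ≫ g := by
    have := congrArg (fun k => k.f 0)
      (ProjectiveResolution.lift_commutes g (projectiveResolution X') (projectiveResolution X))
    exact this
  have hf : (projectiveResolution X).complex.d (n+1) n ≫ f.1 = 0 := f.2
  let f' : cocyc (projectiveResolution X') Y n := ⟨φ.f n ≫ f.1, by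
    change (projectiveResolution X').complex.d (n+1) n ≫ φ.f n ≫ f.1 = 0
    rw [← φ.comm_assoc, hf, Limits.comp_zero]⟩
  rw [toOld_nat Y g φ w n f f' rfl]
  simp only [oldEquiv, quotEquiv_apply]
  exact (ProjectiveResolution.mk₀_comp_extMk f.1 (n+1) rfl hf
    (ProjectiveResolution.Hom.mk φ (by exact w))).symm

end OldExt
end HL
end

section
namespace HL
section EE

/-- unbundled Ext -/
def EE (R : Type) [CommRing R] (X N : Type) [AddCommGroup X] [Module R X] [AddCommGroup N]
    [Module R N] (i : ℕ) : Type := Abelian.Ext.{0} (ModuleCat.of R X) (ModuleCat.of R N) i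

variable {R : Type} [CommRing R] {X X' X'' N N' N'' A B C : Type}
  [AddCommGroup X] [AddCommGroup X'] [AddCommGroup X'']
  [AddCommGroup N] [AddCommGroup N'] [AddCommGroup N'']
  [AddCommGroup A] [AddCommGroup B] [AddCommGroup C]
  [Module R X] [Module R X'] [Module R X''] [Module R N] [Module R N'] [Module R N'']
  [Module R A] [Module R B] [Module R C]

noncomputable instance (i : ℕ) : AddCommGroup (EE R X N i) :=
  inferInstanceAs (AddCommGroup (Abelian.Ext.{0} (ModuleCat.of R X) (ModuleCat.of R N) i))
noncomputable instance (i : ℕ) : Module R (EE R X N i) :=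
  inferInstanceAs (Module R (Abelian.Ext.{0} (ModuleCat.of R X) (ModuleCat.of R N) i))

/-- short exact sequences -/
structure SES (f : A →ₗ[R] B) (g : B →ₗ[R] C) : Prop where
  inj : Function.Injective f
  ex : Function.Exact f g
  surj : Function.Surjective g

lemma SES.mk' {f : A →ₗ[R] B} {g : B →ₗ[R] C} (h : SES f g) :
    (ModuleCat.shortComplexOfCompEqZero f g h.ex.linearMap_comp_eq_zero).ShortExact :=
  ModuleCat.shortComplex_shortExact _ h.ex h.inj h.surj

lemma SES.quot (K : Submodule R A) : SES K.subtype K.mkQ :=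
  ⟨K.injective_subtype, fun x => by simp, K.mkQ_surjective⟩

section aux
open Abelian
variable {X Y Z T : ModuleCat.{0} R} {i : ℕ}
lemma aux1 {Y Z T : ModuleCat.{0} R} (f : Y ⟶ Z) (g : Z ⟶ T) (e : Abelian.Ext.{0} X Y i) :
    (e.comp (Abelian.Ext.mk₀ f) (add_zero i)).comp (Abelian.Ext.mk₀ g) (add_zero i) =
      e.comp (Abelian.Ext.mk₀ (f ≫ g)) (add_zero i) := by simp
lemma aux2 (f : T ⟶ Z) (g : Z ⟶ X) (e : Abelian.Ext.{0} X Y i) :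
    (Abelian.Ext.mk₀ f).comp ((Abelian.Ext.mk₀ g).comp e (zero_add i)) (zero_add i) =
      (Abelian.Ext.mk₀ (f ≫ g)).comp e (zero_add i) := by simp
lemma aux3 (r : R) (e : Abelian.Ext.{0} X Y i) :
    r • e = e.comp (Abelian.Ext.mk₀ (r • 𝟙 Y)) (add_zero i) := by
  rw [Abelian.Ext.mk₀_smul]; simp
lemma aux4 (r : R) (e : Abelian.Ext.{0} X Y i) :
    r • e = (Abelian.Ext.mk₀ (r • 𝟙 X)).comp e (zero_add i) := by
  rw [Abelian.Ext.mk₀_smul]; simp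
lemma aux5 (f g : Y ⟶ Z) (e : Abelian.Ext.{0} X Y i) :
    e.comp (Abelian.Ext.mk₀ (f + g)) (add_zero i) = e.comp (Abelian.Ext.mk₀ f) (add_zero i) +
      e.comp (Abelian.Ext.mk₀ g) (add_zero i) := by simp [Abelian.Ext.mk₀_add]
lemma aux6 (f g : Z ⟶ X) (e : Abelian.Ext.{0} X Y i) :
    (Abelian.Ext.mk₀ (f + g)).comp e (zero_add i) = (Abelian.Ext.mk₀ f).comp e (zero_add i) +
      (Abelian.Ext.mk₀ g).comp e (zero_add i) := by simp [Abelian.Ext.mk₀_add]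
variable {S : ShortComplex (ModuleCat.{0} R)} (hS : S.ShortExact)
lemma aux7 (e : Abelian.Ext.{0} X S.X₂ i) :
    (e.comp (Abelian.Ext.mk₀ S.g) (add_zero i)).comp hS.extClass rfl = 0 := by
  simp only [Abelian.Ext.comp_assoc_of_second_deg_zero, ShortComplex.ShortExact.comp_extClass,
          Abelian.Ext.comp_zero]
lemma aux8 (e : Abelian.Ext.{0} X S.X₃ i) :
    (e.comp hS.extClass rfl).comp (Abelian.Ext.mk₀ S.f) (add_zero (i+1)) = 0 := by
  simp only [Abelian.Ext.comp_assoc_of_third_deg_zero, ShortComplex.ShortExact.extClass_comp,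
          Abelian.Ext.comp_zero]
lemma aux9 (e : Abelian.Ext.{0} S.X₂ X i) :
    hS.extClass.comp ((Abelian.Ext.mk₀ S.f).comp e (zero_add i)) (add_comm 1 i) = 0 := by
  rw [← Abelian.Ext.comp_assoc_of_second_deg_zero, ShortComplex.ShortExact.extClass_comp,
          Abelian.Ext.zero_comp]
lemma aux10 (e : Abelian.Ext.{0} S.X₁ X i) :
    (Abelian.Ext.mk₀ S.g).comp (hS.extClass.comp e (add_comm 1 i)) (zero_add (i+1)) = 0 := by
  rw [← Abelian.Ext.comp_assoc _ _ _ (zero_add 1) (add_comm 1 i) (by omega),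
    ShortComplex.ShortExact.comp_extClass, Abelian.Ext.zero_comp]
end aux

namespace EE

noncomputable def post (f : N →ₗ[R] N') (i : ℕ) : EE R X N i →ₗ[R] EE R X N' i :=
  (Abelian.Ext.mk₀ (ModuleCat.ofHom f)).postcompOfLinear R (ModuleCat.of R X) (add_zero i)

noncomputable def pre (g : X' →ₗ[R] X) (i : ℕ) : EE R X N i →ₗ[R] EE R X' N i :=
  (Abelian.Ext.mk₀ (ModuleCat.ofHom g)).precompOfLinear R (ModuleCat.of R N) (zero_add i)

noncomputable def dR {f : A →ₗ[R] B} {g : B →ₗ[R] C} (h : SES f g) (i : ℕ) :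
    EE R X C i →ₗ[R] EE R X A (i+1) :=
  h.mk'.extClass.postcompOfLinear R (ModuleCat.of R X) rfl

noncomputable def dL {f : A →ₗ[R] B} {g : B →ₗ[R] C} (h : SES f g) (i : ℕ) :
    EE R A N i →ₗ[R] EE R C N (i+1) :=
  h.mk'.extClass.precompOfLinear R (ModuleCat.of R N) (add_comm 1 i)

lemma post_def (f : N →ₗ[R] N') (i : ℕ) (e : EE R X N i) : post f i e =
  Abelian.Ext.comp (X := ModuleCat.of R X) e (Abelian.Ext.mk₀ (ModuleCat.ofHom f)) (add_zero i) := rfl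
lemma pre_def (g : X' →ₗ[R] X) (i : ℕ) (e : EE R X N i) : pre g i e =
  Abelian.Ext.comp (Z := ModuleCat.of R N) (Abelian.Ext.mk₀ (ModuleCat.ofHom g)) e (zero_add i) := rfl

noncomputable def hom0 : EE R X N 0 ≃ₗ[R] (X →ₗ[R] N) :=
  (Abelian.Ext.linearEquiv₀ (R := R) (X := ModuleCat.of R X) (Y := ModuleCat.of R N)).trans
    ModuleCat.homLinearEquiv

noncomputable def old (i : ℕ) : ((Ext R (ModuleCat R) i).obj (op (ModuleCat.of R X))).obj
    (ModuleCat.of R N) ≃ₗ[R] EE R X N i := oldEquiv _ _ i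

lemma old_nat (g : X' →ₗ[R] X) (i : ℕ) (a : ((Ext R (ModuleCat R) i).obj (op (ModuleCat.of R X))).obj
    (ModuleCat.of R N)) :
    old i (((Ext R (ModuleCat R) i).map (ModuleCat.ofHom g).op).app (ModuleCat.of R N) a) = pre g i (old i a) :=
  oldEquiv_nat _ _ _ _

lemma post_id (i : ℕ) (e : EE R X N i) : post LinearMap.id i e = e :=
  Abelian.Ext.comp_mk₀_id _
lemma pre_id (i : ℕ) (e : EE R X N i) : pre LinearMap.id i e = e :=
  Abelian.Ext.mk₀_id_comp _
lemma post_post (f : N →ₗ[R] N') (g : N' →ₗ[R] N'') (i : ℕ) (e : EE R X N i) :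
    post g i (post f i e) = post (g ∘ₗ f) i e := aux1 (X := ModuleCat.of R X) _ _ e
lemma pre_pre (f : X'' →ₗ[R] X') (g : X' →ₗ[R] X) (i : ℕ) (e : EE R X N i) :
    pre f i (pre g i e) = pre (g ∘ₗ f) i e := aux2 (Y := ModuleCat.of R N) _ _ e
lemma pre_post (g : X' →ₗ[R] X) (f : N →ₗ[R] N') (i : ℕ) (e : EE R X N i) :
    pre g i (post f i e) = post f i (pre g i e) :=
  (Abelian.Ext.comp_assoc (X := ModuleCat.of R X') _ _ _ (zero_add i) (add_zero i) (by simp)).symm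
lemma pre_dR {f : A →ₗ[R] B} {g : B →ₗ[R] C} (h : SES f g) (k : X' →ₗ[R] X) (i : ℕ)
    (e : EE R X C i) : pre k (i+1) (dR h i e) = dR h i (pre k i e) :=
  (Abelian.Ext.comp_assoc (X := ModuleCat.of R X') _ _ _ (zero_add i) rfl (by simp)).symm
lemma post_dL {f : A →ₗ[R] B} {g : B →ₗ[R] C} (h : SES f g) (k : N →ₗ[R] N') (i : ℕ)
    (e : EE R A N i) : post k (i+1) (dL h i e) = dL h i (post k i e) :=
  (Abelian.Ext.comp_assoc (T := ModuleCat.of R N') _ _ _ (add_comm 1 i) (add_zero i) (by omega))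

lemma smul_post (r : R) (i : ℕ) (e : EE R X N i) : r • e = post (r • LinearMap.id) i e :=
  aux3 (X := ModuleCat.of R X) (Y := ModuleCat.of R N) r e
lemma smul_pre (r : R) (i : ℕ) (e : EE R X N i) : r • e = pre (r • LinearMap.id) i e :=
  aux4 (X := ModuleCat.of R X) (Y := ModuleCat.of R N) r e
lemma post_add (f g : N →ₗ[R] N') (i : ℕ) (e : EE R X N i) :
    post (f + g) i e = post f i e + post g i e :=
  aux5 (X := ModuleCat.of R X) (ModuleCat.ofHom f) (ModuleCat.ofHom g) e
lemma post_zero (i : ℕ) (e : EE R X N i) : post (0 : N →ₗ[R] N') i e = 0 := by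
  have := post_add (0 : N →ₗ[R] N') 0 i e
  simpa using this
lemma pre_add (f g : X' →ₗ[R] X) (i : ℕ) (e : EE R X N i) :
    pre (f + g) i e = pre f i e + pre g i e :=
  aux6 (Y := ModuleCat.of R N) (ModuleCat.ofHom f) (ModuleCat.ofHom g) e
lemma pre_zero (i : ℕ) (e : EE R X N i) : pre (0 : X' →ₗ[R] X) i e = 0 := by
  have := pre_add (0 : X' →ₗ[R] X) 0 i e
  simpa using this

section
variable {f : A →ₗ[R] B} {g : B →ₗ[R] C}
lemma exR2 (h : SES f g) (i : ℕ) : Function.Exact (post (X := X) f i) (post (X := X) g i) := by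
  intro e
  refine ⟨fun he => Abelian.Ext.covariant_sequence_exact₂ _ h.mk' e he, ?_⟩
  rintro ⟨a, rfl⟩
  rw [post_post, h.ex.linearMap_comp_eq_zero, post_zero]
lemma exR3 (h : SES f g) (i : ℕ) : Function.Exact (post (X := X) g i) (dR (X := X) h i) := by
  intro e
  refine ⟨fun he => Abelian.Ext.covariant_sequence_exact₃ _ h.mk' e rfl he, ?_⟩
  rintro ⟨a, rfl⟩
  exact aux7 (X := ModuleCat.of R X) h.mk' a
lemma exR1 (h : SES f g) (i : ℕ) : Function.Exact (dR (X := X) h i) (post (X := X) f (i+1)) := by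
  intro e
  refine ⟨fun he => Abelian.Ext.covariant_sequence_exact₁ _ h.mk' e he rfl, ?_⟩
  rintro ⟨a, rfl⟩
  exact aux8 (X := ModuleCat.of R X) h.mk' a
lemma exL1 (h : SES f g) (i : ℕ) : Function.Exact (pre (N := N) f i) (dL (N := N) h i) := by
  intro e
  refine ⟨fun he => Abelian.Ext.contravariant_sequence_exact₁ h.mk' _ e (add_comm 1 i) he, ?_⟩
  rintro ⟨a, rfl⟩
  exact aux9 (X := ModuleCat.of R N) h.mk' a
lemma exL3 (h : SES f g) (i : ℕ) : Function.Exact (dL (N := N) h i) (pre (N := N) g (i+1)) := by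
  intro e
  refine ⟨fun he => Abelian.Ext.contravariant_sequence_exact₃ h.mk' _ e he (add_comm 1 i), ?_⟩
  rintro ⟨a, rfl⟩
  exact aux10 (X := ModuleCat.of R N) h.mk' a
lemma exL2 (h : SES f g) (i : ℕ) : Function.Exact (pre (N := N) g i) (pre (N := N) f i) := by
  intro e
  refine ⟨fun he => Abelian.Ext.contravariant_sequence_exact₂ h.mk' _ e he, ?_⟩
  rintro ⟨a, rfl⟩
  rw [pre_pre, h.ex.linearMap_comp_eq_zero, pre_zero]
end

lemma proj [Module.Projective R X] (i : ℕ) (e : EE R X N (i+1)) : e = 0 :=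
  Abelian.Ext.eq_zero_of_projective (P := ModuleCat.of R X) e

instance [IsNoetherianRing R] [Module.Finite R X] [Module.Finite R N] (i : ℕ) :
    Module.Finite R (EE R X N i) :=
  ModuleCat.finite_ext R (ModuleCat.of R X) (ModuleCat.of R N) i

lemma hom0_post (f : N →ₗ[R] N') (e : EE R X N 0) : hom0 (post f 0 e) = f ∘ₗ hom0 e := by
  obtain ⟨e, rfl⟩ := hom0.symm.surjective e
  rw [LinearEquiv.apply_symm_apply, ← LinearEquiv.eq_symm_apply]
  exact Abelian.Ext.mk₀_comp_mk₀ (ModuleCat.ofHom e) (ModuleCat.ofHom f)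
lemma hom0_pre (f : X' →ₗ[R] X) (e : EE R X N 0) : hom0 (pre f 0 e) = hom0 e ∘ₗ f := by
  obtain ⟨e, rfl⟩ := hom0.symm.surjective e
  rw [LinearEquiv.apply_symm_apply, ← LinearEquiv.eq_symm_apply]
  exact Abelian.Ext.mk₀_comp_mk₀ (ModuleCat.ofHom f) (ModuleCat.ofHom e)
lemma post_inj0 (f : N →ₗ[R] N') (hf : Function.Injective f) :
    Function.Injective (post (X := X) f 0) := by
  rw [injective_iff_map_eq_zero]
  intro e he
  rw [← hom0.map_eq_zero_iff, hom0_post] at he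
  rw [← hom0.map_eq_zero_iff]
  ext x
  apply hf
  simpa using congrArg (fun k => k x) he
lemma pre_inj0 (f : X' →ₗ[R] X) (hf : Function.Surjective f) :
    Function.Injective (pre (N := N) f 0) := by
  rw [injective_iff_map_eq_zero]
  intro e he
  rw [← hom0.map_eq_zero_iff, hom0_pre] at he
  rw [← hom0.map_eq_zero_iff]
  ext x
  obtain ⟨x, rfl⟩ := hf x
  simpa using congrArg (fun k => k x) he

noncomputable def postE (f : N ≃ₗ[R] N') (i : ℕ) : EE R X N i ≃ₗ[R] EE R X N' i :=
  LinearEquiv.ofLinearMap (post f.toLinearMap i) (post f.symm.toLinearMap i)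
    (by ext e; simp [post_post, post_id]) (by ext e; simp [post_post, post_id])
noncomputable def preE (f : X' ≃ₗ[R] X) (i : ℕ) : EE R X N i ≃ₗ[R] EE R X' N i :=
  LinearEquiv.ofLinearMap (pre f.toLinearMap i) (pre f.symm.toLinearMap i)
    (by ext e; simp [pre_pre, pre_id]) (by ext e; simp [pre_pre, pre_id])

lemma smul_eq_zero_left (r : R) (hr : ∀ x : X, r • x = 0) (i : ℕ) (e : EE R X N i) : r • e = 0 := by
  rw [smul_pre, show r • (LinearMap.id : X →ₗ[R] X) = 0 from LinearMap.ext hr, pre_zero]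
lemma smul_eq_zero_right (r : R) (hr : ∀ x : N, r • x = 0) (i : ℕ) (e : EE R X N i) : r • e = 0 := by
  rw [smul_post, show r • (LinearMap.id : N →ₗ[R] N) = 0 from LinearMap.ext hr, post_zero]

end EE
end EE
end HL
end

section
namespace HL
section H1
variable {R : Type} [CommRing R]

/-- The localization `N_a`. -/
abbrev Loc (a : R) (N : Type) [AddCommGroup N] [Module R N] : Type :=
  LocalizedModule (Submonoid.powers a) N

/-- `N → N_a`. -/
noncomputable abbrev toLoc (a : R) (N : Type) [AddCommGroup N] [Module R N] : N →ₗ[R] Loc a N :=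
  LocalizedModule.mkLinearMap (Submonoid.powers a) N

/-- `H¹_a(N) = N_a / N`. -/
def H1 (a : R) (N : Type) [AddCommGroup N] [Module R N] : Type :=
  Loc a N ⧸ LinearMap.range (toLoc a N)

variable (a : R) (N : Type) [AddCommGroup N] [Module R N] (N' : Type) [AddCommGroup N'] [Module R N']
noncomputable instance : AddCommGroup (H1 a N) :=
  inferInstanceAs (AddCommGroup (Loc a N ⧸ LinearMap.range (toLoc a N)))
noncomputable instance : Module R (H1 a N) :=
  inferInstanceAs (Module R (Loc a N ⧸ LinearMap.range (toLoc a N)))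

noncomputable def qH1 : Loc a N →ₗ[R] H1 a N := (LinearMap.range (toLoc a N)).mkQ

variable {N N'}

lemma qH1_surj : Function.Surjective (qH1 a N) := Submodule.mkQ_surjective _

lemma qH1_eq_zero {x : Loc a N} : qH1 a N x = 0 ↔ ∃ v, toLoc a N v = x :=
  Submodule.Quotient.mk_eq_zero _

/-- `v / a^j` in `N_a`. -/
noncomputable def fr (j : ℕ) : N →ₗ[R] Loc a N where
  toFun v := LocalizedModule.mk v ⟨a^j, j, rfl⟩
  map_add' u v := by
    rw [LocalizedModule.mk_add_mk, LocalizedModule.mk_eq]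
    exact ⟨1, by simp [Submonoid.smul_def, smul_smul]⟩
  map_smul' r v := by simp [LocalizedModule.smul'_mk]

lemma fr_zero (v : N) : fr a 0 v = toLoc a N v := by
  have : (⟨a^0, 0, rfl⟩ : Submonoid.powers a) = 1 := Subtype.ext (pow_zero a)
  change LocalizedModule.mk v _ = LocalizedModule.mk v 1
  rw [this]

lemma fr_eq {i j : ℕ} {u v : N} : fr a i u = fr a j v ↔ ∃ k, a^(k+j) • u = a^(k+i) • v := by
  simp only [fr, LinearMap.coe_mk, AddHom.coe_mk, LocalizedModule.mk_eq]
  constructor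
  · rintro ⟨⟨_, k, rfl⟩, h⟩
    refine ⟨k, ?_⟩
    simpa [Submonoid.smul_def, smul_smul, pow_add] using h
  · rintro ⟨k, h⟩
    refine ⟨⟨_, k, rfl⟩, ?_⟩
    simpa [Submonoid.smul_def, smul_smul, pow_add] using h

lemma fr_add (i j : ℕ) (v : N) : a^i • fr a (i+j) v = fr a j v := by
  rw [← map_smul, fr_eq]; exact ⟨0, by rw [smul_smul, ← pow_add]; congr 2; omega⟩

lemma fr_succ (j : ℕ) (v : N) : a • fr a (j+1) v = fr a j v := by
  have := fr_add a 1 j v; rwa [pow_one, add_comm] at this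

lemma fr_pow (i j : ℕ) (v : N) : fr a (i+j) (a^i • v) = fr a j v := by
  rw [map_smul, fr_add]

lemma fr_surj (x : Loc a N) : ∃ j v, fr a j v = x := by
  induction x using LocalizedModule.induction_on with
  | h m s => obtain ⟨_, j, rfl⟩ := s; exact ⟨j, m, rfl⟩

lemma fr_eq_zero {j : ℕ} {v : N} : fr a j v = 0 ↔ ∃ k, a^k • v = 0 := by
  rw [← map_zero (fr a 0), fr_eq]; simp

/-- `[v / a^j]` in `H¹_a`. -/
noncomputable def ej (j : ℕ) : N →ₗ[R] H1 a N := qH1 a N ∘ₗ fr a j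

lemma ej_zero (v : N) : ej a 0 v = 0 := (qH1_eq_zero a).2 ⟨v, (fr_zero a v).symm⟩

lemma ej_add (i j : ℕ) (v : N) : a^i • ej a (i+j) v = ej a j v := by
  simp only [ej, LinearMap.comp_apply]; rw [← map_smul, fr_add]

lemma ej_succ (j : ℕ) (v : N) : a • ej a (j+1) v = ej a j v := by
  have := ej_add a 1 j v; rwa [pow_one, add_comm] at this

lemma ej_pow (i j : ℕ) (v : N) : ej a (i+j) (a^i • v) = ej a j v := by
  rw [map_smul, ej_add]

lemma pow_smul_ej (j : ℕ) (v : N) : a^j • ej a j v = 0 := by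
  have := ej_add a j 0 v; rwa [ej_zero] at this

lemma ej_surj (x : H1 a N) : ∃ j v, ej a j v = x := by
  obtain ⟨x, rfl⟩ := qH1_surj a x
  obtain ⟨j, v, rfl⟩ := fr_surj a x
  exact ⟨j, v, rfl⟩

lemma ej_surj' (x : H1 a N) (j₀ : ℕ) : ∃ j v, j₀ ≤ j ∧ ej a j v = x := by
  obtain ⟨j, v, rfl⟩ := ej_surj a x
  exact ⟨j₀ + j, a^j₀ • v, by omega, ej_pow ..⟩

lemma ej_eq_zero {j : ℕ} {v : N} : ej a j v = 0 ↔ ∃ k u, a^k • v = a^(k+j) • u := by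
  rw [ej, LinearMap.comp_apply, qH1_eq_zero]
  simp only [← fr_zero, fr_eq]
  constructor
  · rintro ⟨u, k, h⟩; exact ⟨k, u, by simpa using h.symm⟩
  · rintro ⟨k, u, h⟩; exact ⟨u, k, by simpa using h.symm⟩

/-- `a` is a nonzerodivisor on `N`. -/
abbrev NZD (a : R) (N : Type) [AddCommGroup N] [Module R N] : Prop := ∀ v : N, a • v = 0 → v = 0

variable {a}
lemma NZD.pow (h : NZD a N) (k : ℕ) {v : N} (hv : a^k • v = 0) : v = 0 := by
  induction k with
  | zero => simpa using hv
  | succ k ih => exact ih (h _ (by rwa [smul_smul, ← pow_succ']))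

lemma NZD.cancel (h : NZD a N) (k : ℕ) {u v : N} (hv : a^k • u = a^k • v) : u = v := by
  rw [← sub_eq_zero]; apply h.pow k; rw [smul_sub, hv, sub_self]

lemma ej_eq_zero' (h : NZD a N) {j : ℕ} {v : N} : ej a j v = 0 ↔ ∃ u, v = a^j • u := by
  rw [ej_eq_zero]
  constructor
  · rintro ⟨k, u, hk⟩
    refine ⟨u, h.cancel k ?_⟩
    rw [hk, smul_smul, pow_add]
  · rintro ⟨u, rfl⟩; exact ⟨0, u, by simp⟩

lemma toLoc_inj (h : NZD a N) : Function.Injective (toLoc a N) := by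
  rw [injective_iff_map_eq_zero]
  intro v hv
  rw [← fr_zero, fr_eq_zero] at hv
  obtain ⟨k, hk⟩ := hv
  exact h.pow k hk

lemma SES_H1 (h : NZD a N) : SES (toLoc a N) (qH1 a N) :=
  ⟨toLoc_inj h, fun x => by rw [qH1_eq_zero]; rfl, qH1_surj a⟩

variable (a) (N) in
lemma smul_loc_bij (k : ℕ) : Function.Bijective (a^k • LinearMap.id : Loc a N →ₗ[R] Loc a N) := by
  constructor
  · rw [injective_iff_map_eq_zero]
    intro x hx
    obtain ⟨j, v, rfl⟩ := fr_surj a x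
    simp only [LinearMap.smul_apply, LinearMap.id_apply] at hx
    rw [← map_smul, fr_eq_zero] at hx
    obtain ⟨l, hl⟩ := hx
    rw [fr_eq_zero]
    exact ⟨l + k, by rwa [pow_add, ← smul_smul]⟩
  · intro x
    obtain ⟨j, v, rfl⟩ := fr_surj a x
    exact ⟨fr a (k+j) v, by simpa using fr_add a k j v⟩

lemma EE_eq_zero_of_bij {X L : Type} [AddCommGroup X] [Module R X] [AddCommGroup L] [Module R L]
    (r : R) (hr : ∀ x : X, r • x = 0) (hb : Function.Bijective (r • LinearMap.id : L →ₗ[R] L))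
    (i : ℕ) (e : EE R X L i) : e = 0 := by
  have h1 := EE.smul_eq_zero_left (N := L) r hr i e
  rw [EE.smul_post] at h1
  let φ := LinearEquiv.ofBijective _ hb
  have h2 : EE.post (φ.symm.toLinearMap) i (EE.post (r • LinearMap.id : L →ₗ[R] L) i e) = e := by
    rw [EE.post_post]
    convert EE.post_id i e
    ext x; exact φ.symm_apply_apply x
  rw [← h2, h1, map_zero]

lemma EE_loc {X : Type} [AddCommGroup X] [Module R X] (k : ℕ) (hk : ∀ x : X, a^k • x = 0)
    (i : ℕ) (e : EE R X (Loc a N) i) : e = 0 :=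
  EE_eq_zero_of_bij _ hk (smul_loc_bij a N k) i e

/-- dimension shift along `H¹_a`. -/
noncomputable def shiftH1 (h : NZD a N) {X : Type} [AddCommGroup X] [Module R X] (k : ℕ)
    (hk : ∀ x : X, a^k • x = 0) (i : ℕ) : EE R X (H1 a N) i ≃ₗ[R] EE R X N (i+1) :=
  LinearEquiv.ofBijective (EE.dR (SES_H1 h) i) (by
    constructor
    · rw [injective_iff_map_eq_zero]
      intro e he
      obtain ⟨b, rfl⟩ := (EE.exR3 (SES_H1 h) i e).1 he
      rw [EE_loc k hk i b, map_zero]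
    · intro e
      exact (EE.exR1 (SES_H1 h) i e).1 (EE_loc k hk _ _))

lemma hom_H1_zero (h : NZD a N) {X : Type} [AddCommGroup X] [Module R X] (k : ℕ)
    (hk : ∀ x : X, a^k • x = 0) (e : EE R X N 0) : e = 0 := by
  apply EE.post_inj0 (toLoc a N) (toLoc_inj h)
  exact (EE_loc k hk 0 (EE.post (toLoc a N) 0 e)).trans (map_zero _).symm

/-- iterated `H¹`, outermost first -/
noncomputable def HL : List R → ModuleCat.{0} R → ModuleCat.{0} R
  | [], N => N
  | f :: fs, N => ModuleCat.of R (H1 f (HL fs N))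

/-- iterated nonzerodivisors -/
def NZL : List R → ModuleCat.{0} R → Prop
  | [], _ => True
  | f :: fs, N => NZD f (HL fs N) ∧ NZL fs N

lemma HL_append (l l' : List R) (N : ModuleCat.{0} R) : HL (l ++ l') N = HL l (HL l' N) := by
  induction l with
  | nil => rfl
  | cons a l ih => exact congrArg (fun M : ModuleCat.{0} R => ModuleCat.of R (H1 a M)) ih

/-- the dimension shift, natural in `X` -/
noncomputable def shiftHL {X : Type} [AddCommGroup X] [Module R X] (N : ModuleCat.{0} R) : (fs : List R) →
    NZL fs N → (∀ f ∈ fs, ∃ k : ℕ, ∀ x : X, f^k • x = 0) → (i j : ℕ) → j = i + fs.length →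
    EE R X (HL fs N) i ≃ₗ[R] EE R X N j
  | [], _, _, _, _, e => e ▸ LinearEquiv.refl _ _
  | f :: fs, h, hk, i, j, e =>
    (shiftH1 (N := HL fs N) h.1 (hk f (by simp)).choose (hk f (by simp)).choose_spec i).trans
    (shiftHL N fs h.2 (fun g hg => hk g (by simp [hg])) (i+1) j (by simp at e; omega))

lemma shiftHL_nat {X X' : Type} [AddCommGroup X] [Module R X] [AddCommGroup X'] [Module R X']
    (N : ModuleCat.{0} R) (fs : List R) (h : NZL fs N) (hk : ∀ f ∈ fs, ∃ k : ℕ, ∀ x : X, f^k • x = 0)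
    (hk' : ∀ f ∈ fs, ∃ k : ℕ, ∀ x : X', f^k • x = 0) (i j : ℕ) (hj : j = i + fs.length) (g : X' →ₗ[R] X)
    (e : EE R X (HL fs N) i) :
    shiftHL N fs h hk' i j hj (EE.pre g i e) = EE.pre g _ (shiftHL N fs h hk i j hj e) := by
  induction fs generalizing i with
  | nil =>
    have h' : i = j := hj.symm
    subst h'
    rfl
  | cons f fs ih =>
    have := ih h.2 (fun g hg => hk g (by simp [hg]))
      (fun g hg => hk' g (by simp [hg])) (i+1) (by simp at hj; omega) (shiftH1 (N := HL fs N) h.1 (hk f (by simp)).choose (hk f (by simp)).choose_spec i e)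
    refine Eq.trans ?_ this
    exact congrArg (shiftHL N fs h.2 _ (i+1) j _) (EE.pre_dR (SES_H1 h.1) g _ _).symm

/-- `Ext^i(X,N) = 0` for `i < length`. -/
lemma ext_lt_zero {X : Type} [AddCommGroup X] [Module R X] (fs : List R) (N : ModuleCat.{0} R)
    (h : NZL fs N) (hk : ∀ f ∈ fs, ∃ k : ℕ, ∀ x : X, f^k • x = 0) (i : ℕ) (hi : i < fs.length)
    (e : EE R X N i) : e = 0 := by
  induction fs generalizing i with
  | nil => simp at hi
  | cons f fs ih =>
    have hk2 : ∀ f ∈ fs, ∃ k : ℕ, ∀ x : X, f^k • x = 0 := fun g hg => hk g (by simp [hg])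
    rcases Nat.lt_or_ge i fs.length with h1 | h1
    · exact ih h.2 hk2 i h1 e
    · obtain ⟨k, hk1⟩ := hk f (by simp)
      have h2 : i = 0 + fs.length := by simp at hi; omega
      obtain ⟨e', rfl⟩ := (shiftHL N fs h.2 hk2 0 i h2).surjective e
      rw [hom_H1_zero h.1 k hk1 e', map_zero]

end H1
end HL
end

section
namespace HL
section colim
variable {R : Type} [CommRing R]

/-- `Γ_I(H)` -/
def Gam (I : Ideal R) (H : Type) [AddCommGroup H] [Module R H] : Submodule R H where
  carrier := {v | ∃ k : ℕ, ∀ r ∈ I^k, r • v = 0}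
  add_mem' := by
    rintro u v ⟨k, hk⟩ ⟨l, hl⟩
    refine ⟨k + l, fun r hr => ?_⟩
    rw [smul_add, hk r (Ideal.pow_le_pow_right (by omega) hr), hl r (Ideal.pow_le_pow_right (by omega) hr), add_zero]
  zero_mem' := ⟨0, fun r _ => smul_zero r⟩
  smul_mem' := by
    rintro c v ⟨k, hk⟩
    exact ⟨k, fun r hr => by rw [smul_comm, hk r hr, smul_zero]⟩

variable (I : Ideal R) (c : ℕ) (N : ModuleCat.{0} R) (H : Type) [AddCommGroup H] [Module R H]
  (φ : ∀ k : ℕ, EE R (R ⧸ I^k) N c ≃ₗ[R] ((R ⧸ I^k) →ₗ[R] H))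

noncomputable def cocMap (k : ℕ) : EE R (R ⧸ I^k) N c →ₗ[R] Gam I H where
  toFun e := ⟨φ k e 1, k, fun r hr => by
    rw [← map_smul]
    have : r • (1 : R ⧸ I^k) = 0 := by
      rw [Algebra.smul_def, mul_one]; exact Ideal.Quotient.eq_zero_iff_mem.2 hr
    rw [this, map_zero]⟩
  map_add' x y := by ext; simp
  map_smul' r x := by ext; simp

noncomputable def cocOld (k : ℕ) : ((Ext R (ModuleCat R) c).obj (op (ModuleCat.of R (R ⧸ I^k)))).obj
      (ModuleCat.of R N) →ₗ[R] Gam I H :=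
  cocMap I c N H φ k ∘ₗ (EE.old (X := R ⧸ I^k) (N := N) c).toLinearMap

noncomputable def cocMap' (j : (ℕᵒᵖ)ᵒᵖ) :
    ((localCohomology.diagram (localCohomology.idealPowersDiagram I) c).flip.obj N).obj j ⟶ ModuleCat.of R (Gam I H) :=
  ModuleCat.ofHom (cocOld I c N H φ j.unop.unop)

lemma mapQ_id_one (k l : ℕ) (h : I^l ≤ Submodule.comap LinearMap.id (I^k)) :
   Submodule.mapQ (I^l) (I^k) LinearMap.id h (1 : R ⧸ I^l) = (1 : R ⧸ I^k) := rfl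

noncomputable def coc (hφ : ∀ k l (g : (R ⧸ I^l) →ₗ[R] (R ⧸ I^k)) (e), φ l (EE.pre g c e) = φ k e ∘ₗ g) :
    Limits.Cocone ((localCohomology.diagram (localCohomology.idealPowersDiagram I) c).flip.obj N) where
  pt := ModuleCat.of R (Gam I H)
  ι := { app := cocMap' I c N H φ
         naturality := by
          intro j j' w
          ext x
          apply Subtype.ext
          have e1 := EE.old_nat (X := R ⧸ I^(j.unop.unop)) (X' := R ⧸ I^(j'.unop.unop)) (N := N)
            (Submodule.mapQ _ _ LinearMap.id ((localCohomology.idealPowersDiagram I).map w.unop).down.down) c x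
          have e2 := congrArg (fun z => φ j'.unop.unop z 1) e1
          exact e2.trans (by
            have := hφ j.unop.unop j'.unop.unop (Submodule.mapQ _ _ LinearMap.id ((localCohomology.idealPowersDiagram I).map w.unop).down.down) (EE.old (X := R ⧸ I^(j.unop.unop)) (N := N) c x)
            exact congrArg (fun z => z 1) this) }

/-- The identification of local cohomology. -/
theorem lc_equiv (hφ : ∀ k l (g : (R ⧸ I^l) →ₗ[R] (R ⧸ I^k)) (e), φ l (EE.pre g c e) = φ k e ∘ₗ g) :
    Nonempty ((localCohomology I c).obj N ≃ₗ[R] Gam I H) := by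
  let F := localCohomology.diagram (localCohomology.idealPowersDiagram I) c
  let E := (evaluation (ModuleCat.{0} R) (ModuleCat.{0} R)).obj N
  have hc : Limits.IsColimit (E.mapCocone (Limits.colimit.cocone F)) :=
    Limits.isColimitOfPreserves E (Limits.colimit.isColimit F)
  let D : (localCohomology I c).obj N ⟶ ModuleCat.of R (Gam I H) := hc.desc (coc I c N H φ hφ)
  have hD : ∀ j x, D.hom ((E.mapCocone (Limits.colimit.cocone F)).ι.app j x) = (coc I c N H φ hφ).ι.app j x := by
    intro j x
    have := hc.fac (coc I c N H φ hφ) j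
    exact congrArg (fun z => z.hom x) this
  refine ⟨LinearEquiv.ofBijective D.hom ⟨?_, ?_⟩⟩
  · rw [injective_iff_map_eq_zero]
    intro x hx
    obtain ⟨j, y, rfl⟩ := Limits.Concrete.isColimit_exists_rep _ hc x
    have h1 : (coc I c N H φ hφ).ι.app j y = (0 : Gam I H) := (hD j y).symm.trans hx
    have h2 : φ j.unop.unop (EE.old (X := R ⧸ I^(j.unop.unop)) (N := N) c y) 1 = 0 :=
      congrArg Subtype.val h1
    have h3 : φ j.unop.unop (EE.old (X := R ⧸ I^(j.unop.unop)) (N := N) c y) = 0 := by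
      ext; exact h2
    have h4 : y = 0 := by
      have h5 := (LinearEquiv.map_eq_zero_iff _).1 h3
      exact (LinearEquiv.map_eq_zero_iff (EE.old (X := R ⧸ I^(j.unop.unop)) (N := N) c)).1 h5
    rw [h4]
    exact map_zero ((E.mapCocone (Limits.colimit.cocone F)).ι.app j).hom
  · rintro ⟨v, k, hk⟩
    let g : (R ⧸ I^k) →ₗ[R] H := Submodule.liftQ (I^k) (LinearMap.toSpanSingleton R H v) (fun r hr => hk r hr)
    let y := (EE.old (X := R ⧸ I^k) (N := N) c).symm ((φ k).symm g)
    refine ⟨(E.mapCocone (Limits.colimit.cocone F)).ι.app (op (op k)) y, ?_⟩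
    refine (hD (op (op k)) y).trans (Subtype.ext ?_)
    change φ k (EE.old (X := R ⧸ I^k) (N := N) c y) 1 = v
    rw [LinearEquiv.apply_symm_apply, LinearEquiv.apply_symm_apply]
    exact one_smul R v

/-- local cohomology as `Γ_I` of iterated `H¹`. -/
theorem lc_HL (fs : List R) (h : NZL fs N) (hf : ∀ f ∈ fs, f ∈ I) :
    Nonempty ((localCohomology I fs.length).obj N ≃ₗ[R] Gam I (HL fs N)) := by
  have hk : ∀ k : ℕ, ∀ f ∈ fs, ∃ j : ℕ, ∀ x : R ⧸ I^k, f^j • x = 0 := by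
    intro k f hff
    refine ⟨k, fun x => ?_⟩
    obtain ⟨r, rfl⟩ := Ideal.Quotient.mk_surjective x
    have : f^k • (Ideal.Quotient.mk (I^k) r) = Ideal.Quotient.mk (I^k) (f^k * r) := rfl
    rw [this]
    exact Ideal.Quotient.eq_zero_iff_mem.2 (Ideal.mul_mem_right _ _ (Ideal.pow_mem_pow (hf f hff) k))
  refine lc_equiv I _ N (HL fs N) (fun k => (shiftHL N fs h (hk k) 0 _ (zero_add _).symm).symm.trans EE.hom0) ?_
  intro k l g e
  obtain ⟨e, rfl⟩ := (shiftHL N fs h (hk k) 0 _ (zero_add _).symm).surjective e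
  rw [← shiftHL_nat N fs h (hk k) (hk l)]
  simp only [LinearEquiv.trans_apply, LinearEquiv.symm_apply_apply]
  exact EE.hom0_pre g e
end colim
end HL
end

section
namespace HL
section div
variable {R : Type} [CommRing R] {N : Type} [AddCommGroup N] [Module R N]

/-- divisibility along a list (outermost first) -/
def Div (N : Type) [AddCommGroup N] [Module R N] (bs : List R) : Prop :=
  ∀ pre b post, bs = pre ++ b :: post → ∀ k : ℕ, ∀ w : N, (∀ a ∈ pre, a^k • w = 0) →
    ∃ w' : N, (∀ a ∈ pre, a^k • w' = 0) ∧ b • w' = w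

lemma Div.pow {bs : List R} (h : Div N bs) {pre : List R} {b : R} {post : List R} (e : bs = pre ++ b :: post)
    (k j : ℕ) (w : N) (hw : ∀ a ∈ pre, a^k • w = 0) :
    ∃ w' : N, (∀ a ∈ pre, a^k • w' = 0) ∧ b^j • w' = w := by
  induction j generalizing w with
  | zero => exact ⟨w, hw, by simp⟩
  | succ j ih =>
    obtain ⟨w1, h1, rfl⟩ := h pre b post e k w hw
    obtain ⟨w2, h2, rfl⟩ := ih w1 h1
    exact ⟨w2, h2, by rw [pow_succ', smul_smul]⟩

/-- torsion lifts modulo a nonzerodivisor -/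
lemma Div.lift_aux {bs : List R} (h : Div N bs) {t : R} (ht : NZD t N) (k : ℕ) (w : N) :
    ∀ (pre post : List R), bs = pre ++ post → (∀ b ∈ pre, ∃ u, b^k • w = t • u) →
    ∃ w', (∀ b ∈ pre, b^k • w' = 0) ∧ ∃ u, w - w' = t • u := by
  intro pre
  induction pre using List.reverseRecOn with
  | nil => intro post _ _; exact ⟨w, by simp, 0, by simp⟩
  | append_singleton pre b ih =>
    intro post e hw
    obtain ⟨w', h1, u, hu⟩ := ih (b :: post) (by simpa using e) (fun c hc => hw c (by simp [hc]))
    obtain ⟨u2, hu2⟩ := hw b (by simp)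
    have h3 : b^k • w' = t • (u2 - b^k • u) := by
      have : w' = w - t • u := by rw [← hu]; abel
      rw [this, smul_sub, hu2, smul_sub, smul_comm]
    obtain ⟨u4, h4, h5⟩ := h.pow (by simpa using e) k k (u2 - b^k • u) (pre := pre) (b := b) (post := post) (by
      intro a ha
      apply ht
      rw [smul_comm, ← h3, smul_comm, h1 a ha, smul_zero])
    refine ⟨w' - t • u4, ?_, u + u4, ?_⟩
    · intro c hc
      rcases List.mem_append.1 hc with hc | hc
      · rw [smul_sub, h1 c hc, smul_comm, h4 c hc]; simp
      · obtain rfl : c = b := by simpa using hc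
        rw [smul_sub, h3, smul_comm, h5, sub_self]
    · rw [smul_add, ← hu]; abel

lemma Div.lift {bs : List R} (h : Div N bs) {t : R} (ht : NZD t N) (k : ℕ) (w : N)
    (hw : ∀ b ∈ bs, ∃ u, b^k • w = t • u) :
    ∃ w', (∀ b ∈ bs, b^k • w' = 0) ∧ ∃ u, w - w' = t • u :=
  h.lift_aux ht k w bs [] (by simp) hw

lemma NZD.pow' {b : R} (h : NZD b N) (k : ℕ) : NZD (b^k) N := fun _ hv => h.pow k hv

/-- elements killed by `b^k` in `H1`. -/
lemma H1_tors {b : R} (h : NZD b N) (k : ℕ) (u : H1 b N) (hu : b^k • u = 0) : ∃ w, ej b k w = u := by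
  obtain ⟨j, w, hj, rfl⟩ := ej_surj' b u k
  rw [← map_smul, ej_eq_zero' h] at hu
  obtain ⟨w', hw'⟩ := hu
  obtain ⟨i, rfl⟩ := Nat.exists_eq_add_of_le hj
  refine ⟨w', ?_⟩
  have : w = b^i • w' := h.cancel k (by rw [hw', smul_smul, pow_add])
  rw [this, add_comm k i, ej_pow]

lemma Div_H1 {b : R} {l : List R} (hb : NZD b N) (ihl : Div N l) : Div (H1 b N) (b :: l) := by
  intro pre c post e k w hw
  cases pre with
  | nil =>
    obtain ⟨rfl, -⟩ : b = c ∧ _ := by simpa using e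
    obtain ⟨j, v, rfl⟩ := ej_surj b w
    exact ⟨ej b (j+1) v, by simp, ej_succ ..⟩
  | cons b' pre =>
    obtain ⟨rfl, e2⟩ : b = b' ∧ l = pre ++ c :: post := by simpa using e
    obtain ⟨w0, rfl⟩ := H1_tors hb k w (hw b (by simp))
    have h1 : ∀ a ∈ pre, ∃ u, a^k • w0 = b^k • u := by
      intro a ha
      have := hw a (by simp [ha])
      rwa [← map_smul, ej_eq_zero' hb] at this
    obtain ⟨w1, h2, u, hu⟩ := ihl.lift_aux (hb.pow' k) k w0 pre (c :: post) e2 h1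
    obtain ⟨w2, h3, h4⟩ := ihl pre c post e2 k w1 h2
    refine ⟨ej b k w2, ?_, ?_⟩
    · intro a ha
      rcases List.mem_cons.1 ha with rfl | ha
      · exact pow_smul_ej _ _ _
      · rw [← map_smul, h3 a ha, map_zero]
    · rw [← map_smul, h4]
      have : w0 = w1 + b^k • u := by rw [← hu]; abel
      rw [this, map_add, (ej_eq_zero' hb).2 ⟨u, rfl⟩, add_zero]

lemma Div_HL (N : ModuleCat.{0} R) (l : List R) (h : NZL l N) : Div (HL l N) l := by
  induction l with
  | nil => intro pre b post e; simp at e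
  | cons b l ih => exact Div_H1 h.1 (ih h.2)

/-- `v ↦ v / (b_1^k ⋯ b_r^k)` -/
noncomputable def eps (k : ℕ) (N : ModuleCat.{0} R) : (l : List R) → N →ₗ[R] HL l N
  | [] => LinearMap.id
  | b :: l => ej (N := HL l N) b k ∘ₗ eps k N l

lemma eps_tors (k : ℕ) (N : ModuleCat.{0} R) (l : List R) (v : N) (b : R) (hb : b ∈ l) :
    b^k • eps k N l v = 0 := by
  induction l with
  | nil => simp at hb
  | cons c l ih =>
    change b^k • ej c k (eps k N l v) = 0
    rcases List.mem_cons.1 hb with rfl | hb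
    · exact pow_smul_ej _ _ _
    · rw [← map_smul, ih hb, map_zero]

lemma eps_surj (k : ℕ) (N : ModuleCat.{0} R) (l : List R) (h : NZL l N) (u : HL l N)
    (hu : ∀ b ∈ l, b^k • u = 0) : ∃ v, eps k N l v = u := by
  induction l with
  | nil => exact ⟨u, rfl⟩
  | cons b l ih =>
    have hb : NZD b (HL l N) := h.1
    obtain ⟨w0, rfl⟩ := H1_tors hb k u (hu b (by simp))
    have h1 : ∀ a ∈ l, ∃ u, a^k • w0 = b^k • u := by
      intro a ha
      have := hu a (by simp [ha])
      have h2 : ej b k (a^k • w0) = 0 := (map_smul _ _ _).trans this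
      rwa [ej_eq_zero' hb] at h2
    obtain ⟨w1, h2, u, hu⟩ := (Div_HL N l h.2).lift (hb.pow' k) k w0 h1
    obtain ⟨v, rfl⟩ := ih h.2 w1 h2
    refine ⟨v, ?_⟩
    change ej b k (eps k N l v) = ej b k w0
    have : w0 = eps k N l v + b^k • u := by rw [← hu]; abel
    rw [this, map_add, (ej_eq_zero' hb).2 ⟨u, rfl⟩, add_zero]

/-- the ideal `(b^k : b ∈ l)` -/
def pI (k : ℕ) (l : List R) : Ideal R := Ideal.span {r | ∃ b ∈ l, r = b^k}

lemma mem_pI {k : ℕ} {l : List R} {b : R} (hb : b ∈ l) : b^k ∈ pI k l :=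
  Ideal.subset_span ⟨b, hb, rfl⟩

lemma pI_smul {k : ℕ} {l : List R} {v : N} (h : ∀ b ∈ l, b^k • v = 0) {r : R} (hr : r ∈ pI k l) : r • v = 0 := by
  have : pI k l ≤ LinearMap.ker (LinearMap.toSpanSingleton R N v) := by
    rw [pI, Ideal.span_le]
    rintro _ ⟨b, hb, rfl⟩
    exact h b hb
  exact this hr

lemma eps_ker (k : ℕ) (l : List R) (h : NZL l (ModuleCat.of R R)) (v : R) :
    eps k (ModuleCat.of R R) l v = 0 ↔ v ∈ pI k l := by
  constructor
  · intro hv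
    induction l generalizing v with
    | nil => 
      have : v = 0 := hv
      rw [this]; exact zero_mem _
    | cons b l ih =>
      have hb : NZD b (HL l (ModuleCat.of R R)) := h.1
      obtain ⟨u, hu⟩ := (ej_eq_zero' hb).1 hv
      obtain ⟨w, rfl⟩ := eps_surj k (ModuleCat.of R R) l h.2 u (by
        intro a ha
        apply hb.pow k
        rw [smul_comm, ← hu]
        exact eps_tors k (ModuleCat.of R R) l v a ha)
      have h1 : eps k (ModuleCat.of R R) l (v - b^k • w : R) = 0 := by
        have := map_sub (eps k (ModuleCat.of R R) l) v (b^k • w)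
        exact this.trans (by rw [map_smul, hu, sub_self])
      have h2 := ih h.2 _ h1
      have h3 : pI k l ≤ pI k (b :: l) := Ideal.span_mono (by
        rintro _ ⟨a, ha, rfl⟩; exact ⟨a, by simp [ha], rfl⟩)
      have h4 : v = (v - b^k • w : R) + (b^k * w : R) := by
        change v = (v - b^k * w : R) + (b^k * w : R); ring
      rw [h4]
      exact add_mem (h3 h2) (Ideal.mul_mem_right _ _ (mem_pI (by simp)))
  · intro hv
    have : eps k (ModuleCat.of R R) l (v • (1 : R)) = 0 :=
      (map_smul _ _ _).trans (pI_smul (eps_tors k _ l _) hv)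
    rwa [smul_eq_mul, mul_one] at this
end div
end HL
end

section
namespace HL
variable {A : Type} [CommRing A]

/-- every class in `Ext^i(N,A)` is killed by an element outside `P`. -/
def KP (P : Ideal A) (N : Type) [AddCommGroup N] [Module A N] (i : ℕ) : Prop :=
  ∀ e : EE A N A i, ∃ s, s ∉ P ∧ s • e = 0

section
variable {P : Ideal A} {X Y Z : Type} [AddCommGroup X] [Module A X] [AddCommGroup Y] [Module A Y]
  [AddCommGroup Z] [Module A Z] {f : X →ₗ[A] Y} {g : Y →ₗ[A] Z} {i : ℕ}

lemma notMem_mul (hP : P.IsPrime) {s t : A} (hs : s ∉ P) (ht : t ∉ P) : s * t ∉ P :=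
  fun h => (hP.mem_or_mem h).elim hs ht

lemma KP.mid (hP : P.IsPrime) (h : SES f g) (h1 : KP P X i) (h3 : KP P Z i) : KP P Y i := by
  intro e
  obtain ⟨s, hs, hse⟩ := h1 (EE.pre f i e)
  rw [← map_smul] at hse
  obtain ⟨e', he'⟩ := (EE.exL2 h i _).1 hse
  obtain ⟨t, ht, hte⟩ := h3 e'
  refine ⟨t * s, notMem_mul hP ht hs, ?_⟩
  rw [mul_smul, ← he', ← map_smul, hte, map_zero]

lemma KP.left (hP : P.IsPrime) (h : SES f g) (h2 : KP P Y i) (h3 : KP P Z (i+1)) : KP P X i := by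
  intro e
  obtain ⟨s, hs, hse⟩ := h3 (EE.dL h i e)
  rw [← map_smul] at hse
  obtain ⟨e', he'⟩ := (EE.exL1 h i _).1 hse
  obtain ⟨t, ht, hte⟩ := h2 e'
  refine ⟨t * s, notMem_mul hP ht hs, ?_⟩
  rw [mul_smul, ← he', ← map_smul, hte, map_zero]

lemma KP.iso (f : X ≃ₗ[A] Y) (h : KP P X i) : KP P Y i := by
  intro e
  obtain ⟨s, hs, hse⟩ := h (EE.preE f i e)
  exact ⟨s, hs, (EE.preE f i).injective (by rw [map_smul, hse, map_zero])⟩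

lemma KP.triv {s : A} (hs : s ∉ P) (h : ∀ x : X, s • x = 0) : KP P X i :=
  fun e => ⟨s, hs, EE.smul_eq_zero_left s h i e⟩
end

/-- A Nakayama type lemma. -/
lemma nak {P : Ideal A} (hP : P.IsPrime) {E : Type} [AddCommGroup E] [Module A E] [Module.Finite A E] {t : A}
    (ht : t ∈ P) (h : ∀ e : E, ∃ s, s ∉ P ∧ ∃ e', s • e = t • e') : ∃ s, s ∉ P ∧ ∀ e : E, s • e = 0 := by
  obtain ⟨G, hG⟩ := (Module.Finite.fg_top : (⊤ : Submodule A E).FG)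
  choose s hs e' he' using h
  have hs' : (∏ x ∈ G, s x) ∉ P := by
    rw [hP.prod_mem_iff]; push Not; exact fun x _ => hs x
  set σ := ∏ x ∈ G, s x
  have key : LinearMap.range (σ • LinearMap.id : E →ₗ[A] E) ≤ (Ideal.span {t}) • (⊤ : Submodule A E) := by
    rw [LinearMap.range_eq_map, ← hG, Submodule.map_span, Submodule.span_le]
    rintro _ ⟨x, hx, rfl⟩
    obtain ⟨c, hc⟩ := Finset.dvd_prod_of_mem s hx
    simp only [LinearMap.smul_apply, LinearMap.id_apply, SetLike.mem_coe]
    rw [show σ = c * s x from by rw [mul_comm]; exact hc, mul_smul, he']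
    rw [hG]
    exact Submodule.smul_mem _ _ (Submodule.smul_mem_smul (Ideal.mem_span_singleton_self t) trivial)
  obtain ⟨p, hp, -, hc, h0⟩ := LinearMap.exists_monic_and_natDegree_eq_and_coeff_mem_pow_and_aeval_eq_zero A _ _ key
  have e2 : ∀ q : Polynomial A, Polynomial.aeval (σ • LinearMap.id : E →ₗ[A] E) q = q.eval σ • LinearMap.id := by
    intro q
    have := Polynomial.aeval_algebraMap_apply (Module.End A E) σ q
    simp only [Algebra.algebraMap_eq_smul_one, Polynomial.coe_aeval_eq_eval] at this
    exact this
  refine ⟨p.eval σ, ?_, fun e => ?_⟩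
  · intro hmem
    rw [Polynomial.eval_eq_sum_range, Finset.sum_range_succ, hp.coeff_natDegree, one_mul] at hmem
    have h2 : ∑ k ∈ Finset.range p.natDegree, p.coeff k * σ^k ∈ P := by
      refine Ideal.sum_mem _ fun k hk => Ideal.mul_mem_right _ _ ?_
      have := hc k
      have h3 : (Ideal.span {t})^(p.natDegree - k) ≤ P :=
        (Ideal.pow_le_self (by have := Finset.mem_range.1 hk; omega)).trans (by simpa [Ideal.span_le] using ht)
      exact h3 this
    exact hs' (hP.mem_of_pow_mem _ ((Ideal.add_mem_iff_right _ h2).1 hmem))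
  · have := congrArg (fun φ : E →ₗ[A] E => φ e) ((e2 p).symm.trans h0)
    simpa using this

variable [IsNoetherianRing A]

lemma SES_mul {X : Type} [AddCommGroup X] [Module A X] {t : A} (h : NZD t X) :
    SES (t • LinearMap.id : X →ₗ[A] X) (LinearMap.range (t • LinearMap.id : X →ₗ[A] X)).mkQ :=
  ⟨by rw [injective_iff_map_eq_zero]; exact h, fun x => by simp, Submodule.mkQ_surjective _⟩

lemma KP.step {P : Ideal A} (hP : P.IsPrime) {X : Type} [AddCommGroup X] [Module A X] [Module.Finite A X]
    {t : A} (ht : t ∈ P) (h : NZD t X) {i : ℕ}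
    (hq : KP P (X ⧸ (LinearMap.range (t • LinearMap.id : X →ₗ[A] X))) (i+1)) : KP P X i := by
  have : ∀ e : EE A X A i, ∃ s, s ∉ P ∧ ∃ e', s • e = t • e' := by
    intro e
    obtain ⟨s, hs, hse⟩ := hq (EE.dL (SES_mul h) i e)
    rw [← map_smul] at hse
    obtain ⟨e', he'⟩ := (EE.exL1 (SES_mul h) i _).1 hse
    exact ⟨s, hs, e', by rw [← he', ← EE.smul_pre]⟩
  obtain ⟨s, hs, h⟩ := nak hP ht this
  exact fun e => ⟨s, hs, h e⟩

lemma NZD_prime {Q : Ideal A} (hQ : Q.IsPrime) {t : A} (ht : t ∉ Q) : NZD t (A ⧸ Q) := by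
  intro v hv
  obtain ⟨v, rfl⟩ := Ideal.Quotient.mk_surjective v
  rw [← Ideal.Quotient.mk_eq_mk, ← Submodule.Quotient.mk_smul, Ideal.Quotient.mk_eq_mk, Ideal.Quotient.eq_zero_iff_mem] at hv
  exact Ideal.Quotient.eq_zero_iff_mem.2 ((hQ.mem_or_mem hv).resolve_left ht)

lemma smul_quot_zero {Q : Ideal A} {r : A} (hr : r ∈ Q) (x : A ⧸ Q) : r • x = 0 := by
  obtain ⟨v, rfl⟩ := Ideal.Quotient.mk_surjective x
  rw [← Ideal.Quotient.mk_eq_mk, ← Submodule.Quotient.mk_smul, Ideal.Quotient.mk_eq_mk, Ideal.Quotient.eq_zero_iff_mem]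
  exact Ideal.mul_mem_right _ _ hr

/-- dévissage with annihilators -/
lemma devissage (C : ∀ (N : Type) [AddCommGroup N] [Module A N] [Module.Finite A N], Prop)
    (J : Ideal A)
    (hQ : ∀ Q : Ideal A, Q.IsPrime → J ≤ Q → C (A ⧸ Q))
    (h0 : ∀ (N : Type) [AddCommGroup N] [Module A N] [Module.Finite A N] [Subsingleton N], C N)
    (hiso : ∀ (N N' : Type) [AddCommGroup N] [Module A N] [Module.Finite A N]
      [AddCommGroup N'] [Module A N'] [Module.Finite A N'], (N ≃ₗ[A] N') → C N → C N')
    (hses : ∀ (X Y Z : Type) [AddCommGroup X] [Module A X] [Module.Finite A X]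
      [AddCommGroup Y] [Module A Y] [Module.Finite A Y] [AddCommGroup Z] [Module A Z] [Module.Finite A Z]
      (f : X →ₗ[A] Y) (g : Y →ₗ[A] Z), SES f g → C X → C Z → C Y)
    (N : Type) [AddCommGroup N] [Module A N] [hN : Module.Finite A N] (hJ : ∀ r ∈ J, ∀ x : N, r • x = 0) : C N := by
  revert hJ
  refine IsNoetherianRing.induction_on_isQuotientEquivQuotientPrime A hN
    (motive := fun N _ _ _ => (∀ r ∈ J, ∀ x : N, r • x = 0) → C N) ?_ ?_ ?_
  · intro N _ _ _ _ _; exact h0 N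
  · intro N _ _ _ p e hJ
    refine hiso (A ⧸ p.1) N e.symm (hQ p.1 p.2 fun r hr => ?_)
    have := hJ r hr (e.symm 1)
    rw [← map_smul, e.symm.map_eq_zero_iff] at this
    rw [← Ideal.Quotient.eq_zero_iff_mem, ← this]
    change _ = Ideal.Quotient.mk _ (r * 1)
    rw [mul_one]
  · intro X _ _ _ Y _ _ _ Z _ _ _ f g hf hg hfg hX hZ hJ
    refine hses X Y Z f g ⟨hf, hfg, hg⟩ (hX fun r hr x => hf (by rw [map_smul, hJ r hr, map_zero])) (hZ fun r hr z => ?_)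
    obtain ⟨y, rfl⟩ := hg z
    rw [← map_smul, hJ r hr, map_zero]

lemma KP.dev {P : Ideal A} (hP : P.IsPrime) (i : ℕ) (J : Ideal A)
    (hQ : ∀ Q : Ideal A, Q.IsPrime → J ≤ Q → Q ≤ P → KP P (A ⧸ Q) i)
    (N : Type) [AddCommGroup N] [Module A N] [hN : Module.Finite A N] (hJ : ∀ r ∈ J, ∀ x : N, r • x = 0) :
    KP P N i := by
  refine devissage (fun N _ _ _ => KP P N i) J ?_ ?_ ?_ ?_ N hJ
  · intro Q hQp hJQ
    by_cases h : Q ≤ P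
    · exact hQ Q hQp hJQ h
    · obtain ⟨s, hs, hs'⟩ := Set.not_subset.1 h
      exact KP.triv hs' fun x => smul_quot_zero hs x
  · intro N _ _ _ _
    exact KP.triv (s := 1) ((Ideal.ne_top_iff_one P).1 hP.ne_top) fun x => Subsingleton.elim _ _
  · intro N N' _ _ _ _ _ _ e h
    exact h.iso e
  · intro X Y Z _ _ _ _ _ _ _ _ _ f g h hX hZ
    exact KP.mid hP h hX hZ

/-- Noetherian induction version -/
lemma KP.noeth {P : Ideal A} (hP : P.IsPrime) (h : ℕ) (h0 : ∀ i, h < i → KP P (A ⧸ P) i) (J : Ideal A) :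
    ∀ (N : Type) [AddCommGroup N] [Module A N] [Module.Finite A N] (_ : ∀ r ∈ J, ∀ x : N, r • x = 0) (i : ℕ),
      h < i → KP P N i := by
  induction J using (wellFounded_gt (α := Ideal A)).induction with
  | _ J ih =>
  intro N _ _ _ hJ i hi
  refine KP.dev hP i J (fun Q hQ hJQ hQP => ?_) N hJ
  by_cases e : Q = P
  · subst e; exact h0 i hi
  obtain ⟨t, ht, htQ⟩ := SetLike.exists_of_lt (lt_of_le_of_ne hQP e)
  refine KP.step hP ht (NZD_prime hQ htQ) ?_
  refine ih (J ⊔ Ideal.span {t}) ?_ _ ?_ (i+1) (by omega)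
  · refine lt_of_le_of_ne le_sup_left fun e => htQ (hJQ ?_)
    rw [e]; exact Ideal.mem_sup_right (Ideal.mem_span_singleton_self t)
  · intro r hr x
    obtain ⟨x, rfl⟩ := Submodule.mkQ_surjective _ x
    obtain ⟨a, ha, b, hb, rfl⟩ := Submodule.mem_sup.1 hr
    obtain ⟨b, rfl⟩ := Ideal.mem_span_singleton'.1 hb
    rw [add_smul, ← map_smul, ← map_smul, smul_quot_zero (hJQ ha), map_zero, zero_add]
    exact (Submodule.Quotient.mk_eq_zero _).2 ⟨b • x, by simp [smul_smul, mul_comm]⟩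

/-- projective dimension bound -/
lemma pd (k : ℕ) (l : List A) (h : NZL l (ModuleCat.of A A)) (N : Type) [AddCommGroup N] [Module A N]
    (i : ℕ) (hi : l.length < i) (e : EE A (A ⧸ pI k l) N i) : e = 0 := by
  induction l generalizing i with
  | nil =>
    obtain ⟨i, rfl⟩ : ∃ j, i = j + 1 := ⟨i - 1, by simp at hi; omega⟩
    have : pI k ([] : List A) = ⊥ := by simp [pI]
    have e' : A ≃ₗ[A] (A ⧸ pI k ([] : List A)) := (Submodule.quotEquivOfEqBot _ this).symm
    exact (EE.preE e' (i+1)).injective ((EE.proj _ _).trans (EE.proj _ _).symm)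
  | cons b l ih =>
    obtain ⟨i, rfl⟩ : ∃ j, i = j + 1 := ⟨i - 1, by omega⟩
    have hb : NZD (b^k) (A ⧸ pI k l) := by
      intro v hv
      obtain ⟨v, rfl⟩ := Ideal.Quotient.mk_surjective v
      rw [← Ideal.Quotient.mk_eq_mk, ← Submodule.Quotient.mk_smul, Ideal.Quotient.mk_eq_mk, Ideal.Quotient.eq_zero_iff_mem,
        ← eps_ker k l h.2, map_smul] at hv
      rw [Ideal.Quotient.eq_zero_iff_mem, ← eps_ker k l h.2]
      exact h.1.pow k hv
    have key : ∀ e : EE A ((A ⧸ pI k l) ⧸ LinearMap.range (b^k • LinearMap.id : (A ⧸ pI k l) →ₗ[A] _)) N (i+1), e = 0 := by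
      intro e
      have h1 := ih h.2 (i+1) (by simp at hi; omega) (EE.pre (Submodule.mkQ _) _ e)
      obtain ⟨e', rfl⟩ := (EE.exL3 (SES_mul hb) i _).1 h1
      have h2 : e' = 0 := ih h.2 i (by simp at hi; omega) e'
      rw [h2, map_zero]
    let φ : ((A ⧸ pI k l) ⧸ LinearMap.range (b^k • LinearMap.id : (A ⧸ pI k l) →ₗ[A] _)) ≃ₗ[A] (A ⧸ pI k (b::l)) := by
      refine LinearEquiv.ofBijective (Submodule.liftQ _ (Submodule.mapQ _ _ LinearMap.id ?_) ?_) ⟨?_, ?_⟩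
      · exact Ideal.span_mono (by rintro _ ⟨c, hc, rfl⟩; exact ⟨c, by simp [hc], rfl⟩)
      · rintro _ ⟨x, rfl⟩
        obtain ⟨x, rfl⟩ := Submodule.mkQ_surjective _ x
        simp only [LinearMap.smul_apply, LinearMap.id_apply, LinearMap.mem_ker, map_smul]
        exact smul_quot_zero (mem_pI (by simp)) _
      · rw [injective_iff_map_eq_zero]
        intro x hx
        obtain ⟨x, rfl⟩ := Submodule.mkQ_surjective _ x
        obtain ⟨x, rfl⟩ := Submodule.mkQ_surjective _ x
        have : x ∈ pI k (b :: l) := (Submodule.Quotient.mk_eq_zero _).1 hx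
        have e3 : pI k (b :: l) = Ideal.span {b^k} ⊔ pI k l := by
          rw [pI, pI, ← Ideal.span_union]; congr 1; ext r; simp
        rw [e3] at this
        obtain ⟨r, hr, y, hy, rfl⟩ := Submodule.mem_sup.1 this
        obtain ⟨r, rfl⟩ := Ideal.mem_span_singleton'.1 hr
        rw [map_add, (Submodule.Quotient.mk_eq_zero _).2 hy |> (show (pI k l).mkQ y = 0 from ·), add_zero]
        refine (Submodule.Quotient.mk_eq_zero _).2 ⟨(pI k l).mkQ r, ?_⟩
        simp only [LinearMap.smul_apply, LinearMap.id_apply]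
        rw [← map_smul, smul_eq_mul, mul_comm]
      · intro x
        obtain ⟨x, rfl⟩ := Submodule.mkQ_surjective _ x
        exact ⟨Submodule.mkQ _ (Submodule.mkQ _ x), rfl⟩
    exact (EE.preE φ (i+1)).injective ((key _).trans (key _).symm)

end HL
end

section
namespace HL
variable {A : Type} [CommRing A] [IsNoetherianRing A]

/-- `xs` is a regular system of parameters. -/
structure Rg [IsLocalRing A] (xs : List A) : Prop where
  nz : NZL xs (ModuleCat.of A A)
  mx : pI 1 xs = maximalIdeal A

/-- the prime `P` is associated to the regular sequence `g`. -/
structure Gr (g : List A) (P : Ideal A) : Prop where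
  pr : P.IsPrime
  nz : NZL g (ModuleCat.of A A)
  mem : ∀ b ∈ g, b ∈ P
  ass : ∃ u, ∀ r, r * u ∈ pI 1 g ↔ r ∈ P

lemma kill_quot {g : List A} {Q : Ideal A} (hg : ∀ b ∈ g, b ∈ Q) :
    ∀ b ∈ g, ∃ k : ℕ, ∀ x : A ⧸ Q, b^k • x = 0 :=
  fun b hb => ⟨1, fun x => by rw [pow_one]; exact smul_quot_zero (hg b hb) x⟩

lemma Gr.cls {g : List A} {P Q : Ideal A} (h : Gr g P) (hQ : Q ≤ P) (hg : ∀ b ∈ g, b ∈ Q) :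
    ∃ e : EE A (A ⧸ Q) A g.length, ∀ s : A, s • e = 0 → s ∈ P := by
  obtain ⟨u, hu⟩ := h.ass
  let φ : A ⧸ Q →ₗ[A] HL g (ModuleCat.of A A) :=
    Submodule.liftQ Q (LinearMap.toSpanSingleton A _ (eps 1 (ModuleCat.of A A) g u)) (by
      intro r hr
      rw [LinearMap.mem_ker, LinearMap.toSpanSingleton_apply, ← map_smul, eps_ker 1 g h.nz]
      exact (hu r).2 (hQ hr))
  refine ⟨shiftHL (ModuleCat.of A A) g h.nz (kill_quot hg) 0 g.length (by omega) (EE.hom0.symm φ), fun s hs => ?_⟩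
  rw [← map_smul, LinearEquiv.map_eq_zero_iff, ← map_smul, LinearEquiv.map_eq_zero_iff] at hs
  have h2 : s • φ (Submodule.mkQ Q 1) = 0 := by rw [← LinearMap.smul_apply, hs]; rfl
  have h3 : s • ((1:A) • eps 1 (ModuleCat.of A A) g u) = 0 := h2
  rw [one_smul, ← map_smul, eps_ker 1 g h.nz] at h3
  exact (hu s).1 h3

lemma Gr.len_le {g f : List A} {P : Ideal A} (h : Gr g P) (hf : NZL f (ModuleCat.of A A)) (hfP : ∀ b ∈ f, b ∈ P) :
    f.length ≤ g.length := by
  by_contra hlt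
  obtain ⟨e, he⟩ := h.cls le_rfl h.mem
  have : e = 0 := ext_lt_zero f (ModuleCat.of A A) hf (kill_quot hfP) _ (by omega) e
  exact h.pr.ne_top ((Ideal.eq_top_iff_one _).2 (he 1 (by rw [this, smul_zero])))

lemma Gr.len_eq {g f : List A} {P : Ideal A} (h : Gr g P) (h' : Gr f P) : f.length = g.length :=
  le_antisymm (h.len_le h'.nz h'.mem) (h'.len_le h.nz h.mem)


lemma HL_tors (N : ModuleCat.{0} A) (g : List A) (b : A) (hb : b ∈ g) (v : HL g N) : ∃ k : ℕ, b^k • v = 0 := by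
  induction g with
  | nil => simp at hb
  | cons c g ih =>
    have key : ∀ x : H1 c (HL g N), ∃ k : ℕ, b^k • x = 0 := by
      intro x
      obtain ⟨j, w, rfl⟩ := ej_surj c x
      rcases List.mem_cons.1 hb with rfl | hb
      · exact ⟨j, pow_smul_ej b j w⟩
      · obtain ⟨k, hk⟩ := ih hb w
        exact ⟨k, by rw [← map_smul, hk, map_zero]⟩
    exact key v

lemma Gr_of_ann {g : List A} {q : Ideal A} (hq : q.IsPrime) (hg : NZL g (ModuleCat.of A A))
    (v : HL g (ModuleCat.of A A)) (hv : ∀ r : A, r • v = 0 ↔ r ∈ q) : Gr g q := by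
  have hgq : ∀ b ∈ g, b ∈ q := fun b hb => by
    obtain ⟨k, hk⟩ := HL_tors _ g b hb v
    exact hq.mem_of_pow_mem k ((hv _).1 hk)
  obtain ⟨u, rfl⟩ := eps_surj 1 _ g hg v fun b hb => by rw [pow_one]; exact (hv b).2 (hgq b hb)
  refine ⟨hq, hg, hgq, u, fun r => ?_⟩
  rw [← hv, ← map_smul, eps_ker 1 g hg]; rfl

lemma exists_ann {N : Type} [AddCommGroup N] [Module A N] (v : N) (hv : v ≠ 0) :
    ∃ (q : Ideal A) (w : A), q.IsPrime ∧ ∀ r : A, r • (w • v) = 0 ↔ r ∈ q := by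
  have h0 : (⟨v, Submodule.mem_span_singleton_self v⟩ : Submodule.span A {v}) ≠ 0 := by simpa using hv
  obtain ⟨q, hq, hle⟩ := exists_le_isAssociatedPrime_of_isNoetherianRing A _ h0
  obtain ⟨hp, ⟨x, hx⟩, hxq⟩ := (isAssociatedPrime_iff).1 hq
  obtain ⟨w, rfl⟩ := Submodule.mem_span_singleton.1 hx
  refine ⟨q, w, hp, fun r => ?_⟩
  rw [hxq, Submodule.mem_colon_singleton, Submodule.mem_bot, ← Subtype.coe_inj]; rfl

/-- prime avoidance extension. -/
lemma extend (g : List A) (hg : NZL g (ModuleCat.of A A)) (J : Ideal A) (hJ : ∀ b ∈ g, b ∈ J) :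
    (∃ b ∈ J, NZL (b :: g) (ModuleCat.of A A)) ∨ ∃ q, Gr g q ∧ J ≤ q := by
  by_cases h : (J : Set A) ⊆ ⋃ p ∈ associatedPrimes A (A ⧸ pI 1 g), (p : Set A)
  · right
    obtain ⟨q, hq, hJq⟩ := (Ideal.subset_union_prime_finite (associatedPrimes.finite A (A ⧸ pI 1 g)) (f := id) 0 0
      (fun i hi _ _ => hi.isPrime)).1 h
    refine ⟨q, ?_, hJq⟩
    have hq' := hq
    obtain ⟨hp, x, hx⟩ := (isAssociatedPrime_iff).1 hq'
    obtain ⟨u, rfl⟩ := Submodule.mkQ_surjective _ x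
    refine ⟨hp, hg, fun b hb => hJq (hJ b hb), u, fun r => ?_⟩
    change _ ↔ r ∈ q
    rw [hx, Submodule.mem_colon_singleton]
    rw [Submodule.mem_bot, ← map_smul, Submodule.mkQ_apply, Submodule.Quotient.mk_eq_zero]
    rfl
  · left
    obtain ⟨b, hbJ, hb⟩ := Set.not_subset.1 h
    refine ⟨b, hbJ, fun v hv => ?_, hg⟩
    by_contra hv0
    obtain ⟨q, w, hq, hw⟩ := exists_ann (A := A) v hv0
    have hG := Gr_of_ann hq hg (w • v) hw
    obtain ⟨u, hu⟩ := hG.ass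
    refine hb (Set.mem_biUnion (x := q) ?_ ?_)
    · refine (isAssociatedPrime_iff).2 ⟨hq, Submodule.mkQ _ u, ?_⟩
      ext r
      rw [Submodule.mem_colon_singleton, Submodule.mem_bot, ← map_smul, Submodule.mkQ_apply,
        Submodule.Quotient.mk_eq_zero, ← hu]; rfl
    · exact (hw b).1 (by rw [smul_comm, hv, smul_zero])

lemma Rg.gr [IsLocalRing A] {xs : List A} (h : Rg xs) : Gr xs (maximalIdeal A) :=
  ⟨inferInstance, h.nz, fun b hb => by rw [← h.mx]; simpa using mem_pI (k := 1) hb, 1, fun r => by rw [mul_one, h.mx]⟩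

section
variable [IsLocalRing A] {xs : List A}

lemma Rg.top (H : Rg xs) (N : Type) [AddCommGroup N] [Module A N] [Module.Finite A N] (i : ℕ) (hi : xs.length < i)
    (e : EE A N A i) : e = 0 := by
  obtain ⟨s, hs, hse⟩ := KP.noeth (P := maximalIdeal A) inferInstance xs.length
    (fun i hi e => ⟨1, (Ideal.ne_top_iff_one _).1 (maximalIdeal.isMaximal A).ne_top, by
      rw [one_smul]
      revert e; rw [← H.mx]; exact fun e => pd 1 xs H.nz A i hi e⟩) ⊥ N
    (fun r hr x => by rw [Ideal.mem_bot.1 hr, zero_smul]) i hi e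
  have : IsUnit s := by simpa using hs
  exact (this.smul_eq_zero).1 hse

/-- local vanishing -/
lemma Gr.van (H : Rg xs) {g : List A} {P : Ideal A} (h : Gr g P) (N : Type) [AddCommGroup N] [Module A N] [Module.Finite A N]
    (i : ℕ) (hi : g.length < i) : KP P N i := by
  suffices ∀ k i : ℕ, xs.length < i + k → g.length < i → ∀ (N : Type) [AddCommGroup N] [Module A N] [Module.Finite A N],
      KP P N i from this (xs.length + 1) i (by omega) hi N
  intro k
  have h1 : (1 : A) ∉ P := (Ideal.ne_top_iff_one _).1 h.pr.ne_top
  induction k with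
  | zero => exact fun i hk _ N _ _ _ e => ⟨1, h1, by rw [H.top N i hk e, smul_zero]⟩
  | succ k ih =>
    intro i hk hi N _ _ _
    refine KP.dev h.pr i ⊥ (fun Q hQ _ hQP => ?_) N (fun r hr x => by rw [Ideal.mem_bot.1 hr, zero_smul])
    by_cases e : Q = P
    · subst e
      obtain ⟨u, hu⟩ := h.ass
      let φ : A ⧸ Q →ₗ[A] A ⧸ pI 1 g := Submodule.mapQ Q (pI 1 g) (u • LinearMap.id) (fun r hr => by
        rw [Submodule.mem_comap]; simpa [mul_comm] using (hu r).2 hr)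
      have hφ : Function.Injective φ := by
        rw [injective_iff_map_eq_zero]
        intro x hx
        obtain ⟨x, rfl⟩ := Submodule.mkQ_surjective _ x
        have : u * x ∈ pI 1 g := (Submodule.Quotient.mk_eq_zero _).1 hx
        exact (Submodule.Quotient.mk_eq_zero _).2 ((hu x).1 (by rwa [mul_comm]))
      have hs : SES φ (LinearMap.range φ).mkQ := ⟨hφ, fun x => by simp, Submodule.mkQ_surjective _⟩
      refine KP.left h.pr hs (fun e => ⟨1, h1, by rw [pd 1 g h.nz A i hi e, smul_zero]⟩) (ih (i+1) (by omega) (by omega) _)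
    · obtain ⟨t, ht, htQ⟩ := SetLike.exists_of_lt (lt_of_le_of_ne hQP e)
      exact KP.step h.pr ht (NZD_prime hQ htQ) (ih (i+1) (by omega) (by omega) _)

lemma Gr.um (H : Rg xs) {g : List A} {q Q : Ideal A} (h : Gr g q) (hQ : Q.IsPrime) (hQq : Q ≤ q) (k : ℕ) (hk : g.length ≤ k)
    (e : EE A (A ⧸ Q) A k) (he : ∀ s : A, s • e = 0 → s ∈ q) : Q = q ∧ k = g.length := by
  have h2 : ¬ KP q (A ⧸ Q) k := by
    intro h2; obtain ⟨s, hs, hse⟩ := h2 e; exact hs (he s hse)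
  constructor
  · by_contra hne
    obtain ⟨t, ht, htQ⟩ := SetLike.exists_of_lt (lt_of_le_of_ne hQq hne)
    exact h2 (KP.step h.pr ht (NZD_prime hQ htQ) (h.van H _ (k+1) (by omega)))
  · by_contra hne
    exact h2 (h.van H _ k (by omega))

lemma Gr.lt (H : Rg xs) {g g' : List A} {Q Q' : Ideal A} (h : Gr g Q) (h' : Gr g' Q') (hlt : Q < Q') : g.length < g'.length := by
  by_contra hle
  obtain ⟨e, he⟩ := h.cls le_rfl h.mem
  exact hlt.ne (h'.um H h.pr hlt.le g.length (by omega) e fun s hs => hlt.le (he s hs)).1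

lemma len_le_n (H : Rg xs) (g : List A) (hg : NZL g (ModuleCat.of A A)) (hm : ∀ b ∈ g, b ∈ maximalIdeal A) :
    g.length ≤ xs.length := H.gr.len_le hg hm

lemma exists_Gr (H : Rg xs) (P : Ideal A) (hP : P.IsPrime) : ∃ g, Gr g P := by
  suffices ∀ (k : ℕ) (g : List A), NZL g (ModuleCat.of A A) → (∀ b ∈ g, b ∈ P) → k + g.length = xs.length + 1 →
      ∃ g, Gr g P from this (xs.length + 1) [] trivial (by simp) (by simp)
  intro k
  induction k with
  | zero =>
    intro g hg hm hk
    have := len_le_n H g hg fun b hb => IsLocalRing.le_maximalIdeal hP.ne_top (hm b hb)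
    omega
  | succ k ih =>
    intro g hg hm hk
    rcases extend g hg P hm with ⟨b, hb, hbg⟩ | ⟨q, hq, hPq⟩
    · exact ih (b :: g) hbg (by simpa [hb] using hm) (by simp; omega)
    · obtain ⟨e, he⟩ := hq.cls hPq hm
      obtain ⟨rfl, -⟩ := hq.um H hP hPq _ le_rfl e he
      exact ⟨g, hq⟩

/-- cover lemma -/
lemma Gr.cover (H : Rg xs) {g g' : List A} {p P : Ideal A} (h : Gr g p) (h' : Gr g' P) (hpP : p ≤ P) (a : A) (haP : a ∈ P)
    (hap : a ∉ p) (hmin : ∀ Q : Ideal A, Q.IsPrime → p ≤ Q → a ∈ Q → Q ≤ P → Q = P) : g'.length ≤ g.length + 1 := by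
  by_contra hlt
  obtain ⟨e, he⟩ := h.cls le_rfl h.mem
  have : KP P (A ⧸ p) g.length := by
    refine KP.step h'.pr haP (NZD_prime h.pr hap) ?_
    refine KP.dev h'.pr _ (p ⊔ Ideal.span {a}) ?_ _ ?_
    · intro Q hQ hJ hQP
      obtain rfl := hmin Q hQ (le_sup_left.trans hJ) (hJ (Ideal.mem_sup_right (Ideal.mem_span_singleton_self a))) hQP
      refine fun e => ⟨1, (Ideal.ne_top_iff_one _).1 hQ.ne_top, ?_⟩
      rw [ext_lt_zero g' (ModuleCat.of A A) h'.nz (kill_quot h'.mem) _ (by omega) e, smul_zero]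
    · intro r hr x
      obtain ⟨x, rfl⟩ := Submodule.mkQ_surjective _ x
      obtain ⟨c, hc, b, hb, rfl⟩ := Submodule.mem_sup.1 hr
      obtain ⟨b, rfl⟩ := Ideal.mem_span_singleton'.1 hb
      rw [add_smul, ← map_smul, ← map_smul, smul_quot_zero hc, map_zero, zero_add]
      exact (Submodule.Quotient.mk_eq_zero _).2 ⟨b • x, by simp [smul_smul, mul_comm]⟩
  obtain ⟨s, hs, hse⟩ := this e
  exact hs (hpP (he s hse))
end

end HL
end

section
namespace HL
variable {A : Type} [CommRing A] [IsNoetherianRing A] [IsLocalRing A]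

def DL : ℕ → Ideal A → Prop
  | 0, J => ∀ Q : Ideal A, Q.IsPrime → J ≤ Q → Q = maximalIdeal A
  | e+1, J => ∀ Q Q' : Ideal A, Q.IsPrime → Q'.IsPrime → J ≤ Q → Q < Q' → DL e Q'

lemma DL_of {e : ℕ} {J : Ideal A} (h : ∀ Q : Ideal A, Q.IsPrime → J ≤ Q → DL e Q) : DL e J := by
  cases e with
  | zero => exact fun Q hQ hJ => h Q hQ hJ Q hQ le_rfl
  | succ e => exact fun Q Q' hQ hQ' hJ hlt => h Q hQ hJ Q Q' hQ hQ' le_rfl hlt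

lemma DL_mono {e : ℕ} {J J' : Ideal A} (hJ : J ≤ J') (h : DL e J) : DL e J' := by
  cases e with
  | zero => exact fun Q hQ h' => h Q hQ (hJ.trans h')
  | succ e => exact fun Q Q' hQ hQ' h' hlt => h Q Q' hQ hQ' (hJ.trans h') hlt

lemma DL_coheight (I : Ideal A) (e : ℕ) (x : PrimeSpectrum.zeroLocus (I : Set A)) (hx : Order.coheight x ≤ e) :
    DL e x.1.asIdeal := by
  induction e generalizing x with
  | zero =>
    intro Q hQ hJ
    have hmx : IsMax x := by
      rw [← Order.coheight_eq_zero]; simpa using hx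
    have hm : (I : Set A) ⊆ maximalIdeal A :=
      fun r hr => IsLocalRing.le_maximalIdeal x.1.2.ne_top (x.2 hr)
    have h1 := hmx (b := ⟨⟨maximalIdeal A, inferInstance⟩, hm⟩) (IsLocalRing.le_maximalIdeal x.1.2.ne_top)
    exact le_antisymm (IsLocalRing.le_maximalIdeal hQ.ne_top) (le_trans h1 hJ)
  | succ e ih =>
    intro Q Q' hQ hQ' hJ hlt
    let y : PrimeSpectrum.zeroLocus (I : Set A) := ⟨⟨Q', hQ'⟩, fun r hr => hlt.le (hJ (x.2 hr))⟩
    have hxy : x < y := show x.1.asIdeal < Q' from lt_of_le_of_lt hJ hlt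
    refine ih y ?_
    have h1 := Order.coheight_add_one_le hxy
    have := h1.trans hx
    push_cast at this
    exact (ENat.add_le_add_iff_right (by simp)).1 this

lemma DL_dim (I : Ideal A) (d : ℕ) (hd : ringKrullDim (A ⧸ I) = d) : DL d I := by
  rw [ringKrullDim_quotient] at hd
  refine DL_of fun Q hQ hI => ?_
  refine DL_coheight I d ⟨⟨Q, hQ⟩, hI⟩ ?_
  have := Order.coheight_le_krullDim (⟨⟨Q, hQ⟩, hI⟩ : PrimeSpectrum.zeroLocus (I : Set A))
  rw [hd] at this
  exact_mod_cast this

variable {xs : List A}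

lemma isch (H : Rg xs) (e : ℕ) : ∀ (J : Ideal A) (N : Type) [AddCommGroup N] [Module A N] [Module.Finite A N]
    (_ : ∀ r ∈ J, ∀ x : N, r • x = 0) (i : ℕ), DL e J → i + e < xs.length → KP (maximalIdeal A) N i := by
  have hm : ∀ i, i < xs.length → KP (maximalIdeal A) (A ⧸ maximalIdeal A) i := fun i hi e =>
    ⟨1, (Ideal.ne_top_iff_one _).1 (maximalIdeal.isMaximal A).ne_top, by
      rw [ext_lt_zero xs (ModuleCat.of A A) H.nz (kill_quot H.gr.mem) _ hi e, smul_zero]⟩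
  induction e with
  | zero =>
    intro J N _ _ _ hJ i hD hi
    refine KP.dev inferInstance i J (fun Q hQ hJQ _ => ?_) N hJ
    obtain rfl := hD Q hQ hJQ
    exact hm i (by omega)
  | succ e ih =>
    intro J N _ _ _ hJ i hD hi
    refine KP.dev inferInstance i J (fun Q hQ hJQ hQm => ?_) N hJ
    by_cases hne : Q = maximalIdeal A
    · subst hne; exact hm i (by omega)
    obtain ⟨t, ht, htQ⟩ := SetLike.exists_of_lt (lt_of_le_of_ne hQm hne)
    refine KP.step inferInstance ht (NZD_prime hQ htQ) ?_
    refine KP.dev inferInstance _ (Q ⊔ Ideal.span {t}) ?_ _ ?_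
    · intro Q' hQ' hJ' _
      have hlt : Q < Q' := lt_of_le_of_ne (le_sup_left.trans hJ') fun h => htQ (by
        rw [h]; exact hJ' (Ideal.mem_sup_right (Ideal.mem_span_singleton_self t)))
      exact ih Q' _ (fun r hr x => smul_quot_zero hr x) (i+1) (hD Q Q' hQ hQ' hJQ hlt) (by omega)
    · intro r hr x
      obtain ⟨x, rfl⟩ := Submodule.mkQ_surjective _ x
      obtain ⟨c, hc, b, hb, rfl⟩ := Submodule.mem_sup.1 hr
      obtain ⟨b, rfl⟩ := Ideal.mem_span_singleton'.1 hb
      rw [add_smul, ← map_smul, ← map_smul, smul_quot_zero hc, map_zero, zero_add]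
      exact (Submodule.Quotient.mk_eq_zero _).2 ⟨b • x, by simp [smul_smul, mul_comm]⟩

/-- a regular sequence of length `n - d` in `I`. -/
lemma exists_f (H : Rg xs) (I : Ideal A) (d c : ℕ) (hD : DL d I) (hc : c + d ≤ xs.length) :
    ∃ f : List A, f.length = c ∧ NZL f (ModuleCat.of A A) ∧ ∀ b ∈ f, b ∈ I := by
  induction c with
  | zero => exact ⟨[], rfl, trivial, by simp⟩
  | succ c ih =>
    obtain ⟨f, hl, hf, hfI⟩ := ih (by omega)
    rcases extend f hf I hfI with ⟨b, hb, hbf⟩ | ⟨q, hq, hIq⟩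
    · exact ⟨b :: f, by simp [hl], hbf, by simpa [hb] using hfI⟩
    · exfalso
      obtain ⟨e, he⟩ := hq.cls le_rfl hq.mem
      obtain ⟨s, hs, hse⟩ := isch H d q (A ⧸ q) (fun r hr x => smul_quot_zero hr x) f.length (DL_mono hIq hD) (by omega) e
      exact hs (IsLocalRing.le_maximalIdeal hq.pr.ne_top (he s hse))

lemma exists_y (H : Rg xs) (f : List A) (hf : NZL f (ModuleCat.of A A)) (hfm : ∀ b ∈ f, b ∈ maximalIdeal A) (d : ℕ)
    (hd : f.length + d ≤ xs.length) : ∃ y : List A, y.length = d ∧ NZL (y ++ f) (ModuleCat.of A A) ∧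
      ∀ b ∈ y, b ∈ maximalIdeal A := by
  induction d with
  | zero => exact ⟨[], rfl, hf, by simp⟩
  | succ d ih =>
    obtain ⟨y, hl, hy, hym⟩ := ih (by omega)
    have hm : ∀ b ∈ y ++ f, b ∈ maximalIdeal A := by
      intro b hb; rcases List.mem_append.1 hb with h | h
      · exact hym b h
      · exact hfm b h
    rcases extend (y ++ f) hy _ hm with ⟨b, hb, hbf⟩ | ⟨q, hq, hIq⟩
    · exact ⟨b :: y, by simp [hl], hbf, List.forall_mem_cons.2 ⟨hb, hym⟩⟩
    · exfalso
      have : q = maximalIdeal A := le_antisymm (IsLocalRing.le_maximalIdeal hq.pr.ne_top) hIq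
      subst this
      have := hq.len_eq H.gr
      simp at this; omega

lemma primary_of_len (H : Rg xs) (g : List A) (hg : NZL g (ModuleCat.of A A)) (hl : g.length = xs.length)
    (hgm : ∀ b ∈ g, b ∈ maximalIdeal A) (Q : Ideal A) (hQ : Q.IsPrime) (hgQ : ∀ b ∈ g, b ∈ Q) : Q = maximalIdeal A := by
  by_contra hne
  obtain ⟨g', hg'⟩ := exists_Gr H Q hQ
  have h1 := hg'.len_le hg hgQ
  have h2 := hg'.lt H H.gr (lt_of_le_of_ne (IsLocalRing.le_maximalIdeal hQ.ne_top) hne)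
  omega

lemma exists_p (H : Rg xs) (I : Ideal A) (d : ℕ) (hd : ringKrullDim (A ⧸ I) = d) (f : List A)
    (hf : NZL f (ModuleCat.of A A)) (hfI : ∀ b ∈ f, b ∈ I) (hl : f.length + d = xs.length) :
    ∃ (p : Ideal A) (g : List A), Gr g p ∧ g.length = f.length ∧ I ≤ p := by
  rw [ringKrullDim_quotient] at hd
  obtain ⟨s, hs⟩ := Order.le_krullDim_iff.1 hd.symm.le
  choose G hG using fun x : PrimeSpectrum.zeroLocus (I : Set A) => exists_Gr H x.1.asIdeal x.1.2
  have hmono : StrictMono fun x => (G x).length := fun x y hxy => (hG x).lt H (hG y) hxy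
  have h1 := (s.map _ hmono).head_add_length_le_nat
  have h2 : (s.map _ hmono).head = (G s.head).length := by simp [LTSeries.head_map]
  have h3 : (s.map _ hmono).last = (G s.last).length := by simp [LTSeries.last_map]
  have h4 : (s.map _ hmono).length = d := hs
  have h5 := len_le_n H _ (hG s.last).nz fun b hb => IsLocalRing.le_maximalIdeal s.last.1.2.ne_top ((hG s.last).mem b hb)
  have h6 := (hG s.head).len_le hf fun b hb => s.head.2 (hfI b hb)
  exact ⟨_, _, hG s.head, by omega, s.head.2⟩

end HL
end

section
namespace HL

section depth
variable {R : Type} [CommRing R] (P : Ideal R) [hP : P.IsPrime]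

lemma depth0 (h0 : Subsingleton (EE (Localization.AtPrime P) (ResidueField (Localization.AtPrime P)) (Localization.AtPrime P) 0))
    (r : R) (hr : ∀ x ∈ P, ∃ s, s ∉ P ∧ s * x * r = 0) : ∃ s, s ∉ P ∧ s * r = 0 := by
  set L := Localization.AtPrime P
  have key : ∀ z ∈ maximalIdeal L, z * algebraMap R L r = 0 := by
    intro z hz
    obtain ⟨⟨x, t⟩, hxt⟩ := IsLocalization.surj P.primeCompl z
    have hx : x ∈ P := by
      rw [← IsLocalization.AtPrime.to_map_mem_maximal_iff L P, ← hxt]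
      exact Ideal.mul_mem_right _ _ hz
    obtain ⟨s, hs, hsx⟩ := hr x hx
    have h2 : algebraMap R L (t * s) * (z * algebraMap R L r) = 0 := by
      have : algebraMap R L (t * s) * (z * algebraMap R L r) = algebraMap R L (s * x * r) := by
        rw [map_mul, map_mul, map_mul, ← hxt]; ring
      rw [this, hsx, map_zero]
    have hu : IsUnit (algebraMap R L (t * s)) := IsLocalization.map_units L (⟨t * s, notMem_mul hP t.2 hs⟩ : P.primeCompl)
    exact (hu.mul_right_eq_zero).1 h2
  let φ : ResidueField L →ₗ[L] L := Submodule.liftQ (maximalIdeal L) (LinearMap.toSpanSingleton L L (algebraMap R L r))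
    (fun z hz => by simpa using key z hz)
  have h1 : φ = 0 := EE.hom0.symm.injective (Subsingleton.elim _ _)
  have h2 : φ (Submodule.mkQ _ 1) = 0 := by rw [h1]; rfl
  have h3 : (1 : L) • algebraMap R L r = 0 := h2
  rw [one_smul, IsLocalization.map_eq_zero_iff P.primeCompl] at h3
  obtain ⟨s, hs⟩ := h3
  exact ⟨s, s.2, hs⟩

lemma depth1 (h1 : Subsingleton (EE (Localization.AtPrime P) (ResidueField (Localization.AtPrime P)) (Localization.AtPrime P) 1))
    (g : P →ₗ[R] Localization.AtPrime P) : ∃ a : Localization.AtPrime P, ∀ x : P, g x = (x : R) • a := by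
  set L := Localization.AtPrime P
  let m := maximalIdeal L
  have hloc : ∀ z : m, ∃ (x : P) (t : P.primeCompl), (t : R) • (z : L) = algebraMap R L x := by
    intro z
    obtain ⟨⟨x, t⟩, hxt⟩ := IsLocalization.surj P.primeCompl (z : L)
    have hx : x ∈ P := by
      rw [← IsLocalization.AtPrime.to_map_mem_maximal_iff L P, ← hxt]
      exact Ideal.mul_mem_right _ _ z.2
    exact ⟨⟨x, hx⟩, t, by rw [← hxt, Algebra.smul_def, mul_comm]⟩
  have hu : ∀ t : P.primeCompl, IsUnit (algebraMap R L t) := IsLocalization.map_units L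
  have hcan : ∀ (t : P.primeCompl) (a b : L), (t : R) • a = (t : R) • b → a = b := by
    intro t a b h
    rw [Algebra.smul_def, Algebra.smul_def] at h
    exact (hu t).mul_left_cancel h
  have hinj : ∀ x y : P, algebraMap R L x = algebraMap R L y → g x = g y := by
    intro x y h
    obtain ⟨s, hs⟩ := (IsLocalization.eq_iff_exists P.primeCompl L).1 h
    refine hcan s _ _ ?_
    rw [← map_smul, ← map_smul]; congr 1; ext; exact hs
  choose X T hXT using hloc
  choose U hU using fun t => (hu t).exists_right_inv
  have huniq : ∀ (z : m) (x : P) (t : P.primeCompl), (t : R) • (z : L) = algebraMap R L x → (t : R) • (U (T z) * g (X z)) = g x := by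
    intro z x t h
    refine hcan (T z) _ _ ?_
    have h2 : g ((T z : R) • x) = g ((t : R) • X z) := by
      apply hinj
      simp only [Submodule.coe_smul, smul_eq_mul, map_mul, ← h, ← hXT, Algebra.smul_def]; ring
    rw [map_smul, map_smul] at h2
    rw [h2]
    simp only [Algebra.smul_def]
    calc _ = (algebraMap R L (T z) * U (T z)) * (algebraMap R L t * g (X z)) := by ring
      _ = _ := by rw [hU, one_mul]
  obtain ⟨W, hW⟩ : ∃ W : m → L, ∀ (z : m) (x : P) (t : P.primeCompl), (t : R) • (z : L) = algebraMap R L x → (t : R) • W z = g x :=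
    ⟨_, huniq⟩
  let G : m →ₗ[L] L :=
    { toFun := W
      map_add' := by
        intro z w
        refine hcan (T z * T w) _ _ ?_
        have := hW (z + w) ((T w : R) • X z + (T z : R) • X w) (T z * T w) (by
          simp only [Submodule.coe_add, Submodule.coe_smul, smul_eq_mul, map_add, map_mul, ← hXT, Algebra.smul_def, Submonoid.coe_mul]
          ring)
        rw [this, map_add, map_smul, map_smul, ← hW z _ _ (hXT z), ← hW w _ _ (hXT w)]
        simp only [Algebra.smul_def, Submonoid.coe_mul, map_mul]; ring
      map_smul' := by
        intro c z
        obtain ⟨⟨r, t⟩, hrt⟩ := IsLocalization.surj P.primeCompl c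
        refine hcan (t * T z) _ _ ?_
        have := hW (c • z) (r • X z) (t * T z) (by
          simp only [Submodule.coe_smul, smul_eq_mul, map_mul, ← hXT, Algebra.smul_def, Submonoid.coe_mul, ← hrt]
          ring)
        rw [this, map_smul, ← hW z _ _ (hXT z)]
        rw [RingHom.id_apply, smul_eq_mul, Algebra.smul_def r, Algebra.smul_def (T z : R), Algebra.smul_def _ (c * W z),
          Submonoid.coe_mul, map_mul]
        have hrt' : algebraMap R L r = c * algebraMap R L t := hrt.symm
        change algebraMap R L r * _ = _
        rw [hrt']; ring }
  have hS : SES (Submodule.subtype m) (Submodule.mkQ m) := SES.quot m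
  have h2 : EE.dL (N := L) hS 0 (EE.hom0.symm G) = 0 := Subsingleton.elim (α := EE L (ResidueField L) L 1) _ _
  obtain ⟨e, he⟩ := (EE.exL1 hS 0 _).1 h2
  have h3 : EE.hom0 e ∘ₗ Submodule.subtype m = G := by
    rw [← EE.hom0_pre, he, LinearEquiv.apply_symm_apply]
  refine ⟨EE.hom0 e 1, fun x => ?_⟩
  have hxm : algebraMap R L x ∈ m := (IsLocalization.AtPrime.to_map_mem_maximal_iff L P _).2 x.2
  have h4 := hW ⟨_, hxm⟩ x 1 (by simp)
  rw [← h4, OneMemClass.coe_one, one_smul]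
  change G ⟨_, hxm⟩ = _
  rw [← h3]
  change EE.hom0 e (algebraMap R L x) = _
  rw [Algebra.smul_def, ← smul_eq_mul, ← map_smul, smul_eq_mul, mul_one]

end depth
end HL
end

section
namespace HL
variable {A : Type} [CommRing A] [IsNoetherianRing A]

def tor (J : Ideal A) (N : Type) [AddCommGroup N] [Module A N] : Submodule A N where
  carrier := {v | ∀ r ∈ J, r • v = 0}
  add_mem' := fun hu hv r hr => by rw [smul_add, hu r hr, hv r hr, add_zero]
  zero_mem' := fun r _ => smul_zero r
  smul_mem' := fun a v hv r hr => by rw [smul_comm, hv r hr, smul_zero]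

lemma mem_tor {J : Ideal A} {N : Type} [AddCommGroup N] [Module A N] {v : N} : v ∈ tor J N ↔ ∀ r ∈ J, r • v = 0 := Iff.rfl

lemma tor_mono {J J' : Ideal A} (h : J ≤ J') (N : Type) [AddCommGroup N] [Module A N] : tor J' N ≤ tor J N :=
  fun _ hv r hr => hv r (h hr)

lemma pI_pow_le (l : List A) (k : ℕ) : ∀ b ∈ l, b^k ∈ pI k l := fun b hb => mem_pI hb

abbrev HA (f : List A) : Type := HL f (ModuleCat.of A A)

lemma tor_pI_eps (k : ℕ) (f : List A) (hf : NZL f (ModuleCat.of A A)) (v : HA f) (hv : v ∈ tor (pI k f) (HA f)) :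
    ∃ b : A, v = b • eps k (ModuleCat.of A A) f (1 : A) := by
  obtain ⟨b, rfl⟩ := eps_surj k _ f hf v fun b hb => hv _ (mem_pI hb)
  refine ⟨b, ?_⟩
  rw [← map_smul]
  congr 1
  exact (mul_one b).symm

lemma eps_mem_tor (k : ℕ) (f : List A) (v : A) :
    eps k (ModuleCat.of A A) f v ∈ tor (pI k f) (HA f) :=
  by
  intro r hr
  refine pI_smul (N := HL f (ModuleCat.of A A)) (fun b hb => ?_) hr
  exact eps_tors k (ModuleCat.of A A) f v b hb

lemma tor_finite (k : ℕ) (f : List A) (hf : NZL f (ModuleCat.of A A)) (J : Ideal A) (hJ : pI k f ≤ J) :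
    Module.Finite A (tor J (HA f)) := by
  have h1 : Module.Finite A (tor (pI k f) (HA f)) := by
    refine Module.Finite.of_surjective (LinearMap.toSpanSingleton A (tor (pI k f) (HA f)) ⟨_, eps_mem_tor k f 1⟩) ?_
    rintro ⟨v, hv⟩
    obtain ⟨b, rfl⟩ := tor_pI_eps k f hf v hv
    exact ⟨b, rfl⟩
  exact Module.Finite.of_injective (Submodule.inclusion (tor_mono hJ _)) (Submodule.inclusion_injective _)

lemma kp_shift {f : List A} (hf : NZL f (ModuleCat.of A A)) {P : Ideal A} {Z : Type} [AddCommGroup Z] [Module A Z]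
    (hZ : ∀ b ∈ f, ∃ k : ℕ, ∀ x : Z, b^k • x = 0) (h : KP P Z (f.length + 1)) (e : EE A Z (HA f) 1) :
    ∃ s, s ∉ P ∧ s • e = 0 := by
  obtain ⟨s, hs, hse⟩ := h (shiftHL (ModuleCat.of A A) f hf hZ 1 (f.length+1) (by omega) e)
  exact ⟨s, hs, by rwa [← map_smul, LinearEquiv.map_eq_zero_iff] at hse⟩

lemma Gr.vec {f : List A} {p : Ideal A} (h : Gr f p) : ∃ v : HA f, ∀ r : A, r • v = 0 ↔ r ∈ p := by
  obtain ⟨u, hu⟩ := h.ass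
  refine ⟨eps 1 (ModuleCat.of A A) f u, fun r => ?_⟩
  rw [← map_smul, eps_ker 1 f h.nz]; exact hu r

variable [IsLocalRing A] {xs : List A}

lemma Gr.swap (H : Rg xs) {f g : List A} {p : Ideal A} (h : Gr g p) (hf : NZL f (ModuleCat.of A A)) (hfp : ∀ b ∈ f, b ∈ p)
    (hl : g.length ≤ f.length) : Gr f p := by
  rcases extend f hf p hfp with ⟨b, hb, hbf⟩ | ⟨q, hq, hpq⟩
  · have := h.len_le hbf (by simpa [hb] using hfp)
    simp at this; omega
  · by_cases e : p = q
    · subst e; exact hq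
    · have := h.lt H hq (lt_of_le_of_ne hpq e)
      have := h.len_le hf hfp
      omega

/-- key generic lemma -/
lemma gen_lem (H : Rg xs) {f : List A} (hf : NZL f (ModuleCat.of A A)) (k : ℕ) (J : Ideal A) (hJ : pI k f ≤ J) {g : List A} {P : Ideal A}
    (hP : Gr g P) (hfP : ∀ b ∈ f, b ∈ P) (hl : g.length ≤ f.length + 1) (φ : tor J (HA f) →ₗ[A] HA f) :
    ∃ s, s ∉ P ∧ ∃ b : A, ∀ v, s • φ v = b • (v : HA f) := by
  let B := tor (pI k f) (HA f)
  let ι : tor J (HA f) →ₗ[A] B := Submodule.inclusion (tor_mono hJ _)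
  have hS : SES ι (LinearMap.range ι).mkQ :=
    ⟨Submodule.inclusion_injective _, fun x => by simp, Submodule.mkQ_surjective _⟩
  have hBf : Module.Finite A B := tor_finite k f hf _ le_rfl
  have hZ : ∀ b ∈ f, ∃ k : ℕ, ∀ x : B ⧸ LinearMap.range ι, b^k • x = 0 := by
    intro b hb
    refine ⟨k, fun x => ?_⟩
    obtain ⟨x, rfl⟩ := Submodule.mkQ_surjective _ x
    rw [← map_smul, show b^k • x = 0 from Subtype.ext (x.2 _ (mem_pI hb)), map_zero]
  have hK : KP P (B ⧸ LinearMap.range ι) (f.length + 1) := by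
    by_cases hc : g.length ≤ f.length
    · exact hP.van H _ _ (by omega)
    rcases extend f hf P hfP with ⟨t, ht, htf⟩ | ⟨q, hq, hpq⟩
    · refine KP.step hP.pr ht ?_ (hP.van H _ _ (by omega))
      intro x hx
      obtain ⟨x, rfl⟩ := Submodule.mkQ_surjective _ x
      rw [← map_smul] at hx
      obtain ⟨w, hw⟩ := (Submodule.Quotient.mk_eq_zero _).1 hx
      refine (Submodule.Quotient.mk_eq_zero _).2 ⟨⟨x.1, fun r hr => ?_⟩, rfl⟩
      refine htf.1 _ ?_
      have : t • (x : HA f) = w := (congrArg Subtype.val hw).symm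
      rw [smul_comm, this]; exact w.2 r hr
    · exfalso
      by_cases e : P = q
      · subst e; have := hP.len_eq hq; omega
      · have := hP.lt H hq (lt_of_le_of_ne hpq e); omega
  obtain ⟨s, hs, hse⟩ := kp_shift hf hZ hK (EE.dL hS 0 (EE.hom0.symm φ))
  rw [← map_smul] at hse
  obtain ⟨e, he⟩ := (EE.exL1 hS 0 _).1 hse
  have h3 : EE.hom0 e ∘ₗ ι = s • φ := by
    rw [← EE.hom0_pre, he, map_smul, LinearEquiv.apply_symm_apply]
  set ψ := EE.hom0 e
  obtain ⟨b, hb⟩ := tor_pI_eps k f hf (ψ ⟨_, eps_mem_tor k f 1⟩) (fun r hr => by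
    rw [← map_smul, show r • (⟨_, eps_mem_tor k f 1⟩ : B) = 0 from Subtype.ext (eps_mem_tor k f 1 r hr), map_zero])
  refine ⟨s, hs, b, fun v => ?_⟩
  rw [← LinearMap.smul_apply, ← h3, LinearMap.comp_apply]
  obtain ⟨c, hc⟩ := tor_pI_eps k f hf v (ι v).2
  have : ι v = c • (⟨_, eps_mem_tor k f 1⟩ : B) := Subtype.ext hc
  rw [this, map_smul, hb, hc, smul_comm]

lemma ann_loc (H : Rg xs) {f : List A} (I : Ideal A) (hfI : ∀ b ∈ f, b ∈ I) {p : Ideal A} (hp : Gr f p)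
    (r : A) (hr : ∀ v ∈ tor I (HA f), r • v = 0) : ∃ s, s ∉ p ∧ s * r ∈ I := by
  by_contra hcon
  push Not at hcon
  have hcon' : ∀ s, s * r ∈ I → s ∈ p := fun s hs => by by_contra h; exact hcon s h hs
  let K : Ideal A := Submodule.colon I {r}
  have hK : ∀ a, a ∈ K ↔ a * r ∈ I := fun a => by rw [Submodule.mem_colon_singleton]; rfl
  let φ : A ⧸ K →ₗ[A] A ⧸ I := Submodule.mapQ K I (r • LinearMap.id) (fun a ha => by
    rw [Submodule.mem_comap]; simpa [mul_comm] using (hK a).1 ha)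
  have hφ : Function.Injective φ := by
    rw [injective_iff_map_eq_zero]
    intro x hx
    obtain ⟨x, rfl⟩ := Submodule.mkQ_surjective _ x
    have : r * x ∈ I := (Submodule.Quotient.mk_eq_zero _).1 hx
    exact (Submodule.Quotient.mk_eq_zero _).2 ((hK x).2 (by rwa [mul_comm]))
  have hS : SES φ (LinearMap.range φ).mkQ := ⟨hφ, fun x => by simp, Submodule.mkQ_surjective _⟩
  obtain ⟨v, hv⟩ := hp.vec
  let ψ : A ⧸ K →ₗ[A] HA f := Submodule.liftQ K (LinearMap.toSpanSingleton A _ v) (fun a ha => by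
    rw [LinearMap.mem_ker, LinearMap.toSpanSingleton_apply]
    exact (hv a).2 (hcon' a ((hK a).1 ha)))
  have hZ : ∀ b ∈ f, ∃ k : ℕ, ∀ x : (A ⧸ I) ⧸ LinearMap.range φ, b^k • x = 0 := by
    intro b hb
    refine ⟨1, fun x => ?_⟩
    obtain ⟨x, rfl⟩ := Submodule.mkQ_surjective _ x
    rw [← map_smul, pow_one, smul_quot_zero (hfI b hb), map_zero]
  obtain ⟨s, hs, hse⟩ := kp_shift hp.nz hZ (hp.van H _ _ (by omega)) (EE.dL hS 0 (EE.hom0.symm ψ))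
  rw [← map_smul] at hse
  obtain ⟨e, he⟩ := (EE.exL1 hS 0 _).1 hse
  have h3 : EE.hom0 e ∘ₗ φ = s • ψ := by
    rw [← EE.hom0_pre, he, map_smul, LinearEquiv.apply_symm_apply]
  set θ := EE.hom0 e
  have h4 : s • v = θ (φ (Submodule.mkQ K 1)) := by
    rw [← LinearMap.comp_apply, h3]
    change s • v = s • ((1 : A) • v)
    rw [one_smul]
  have h5 : φ (Submodule.mkQ K 1) = r • Submodule.mkQ I 1 := rfl
  rw [h5, map_smul, hr (θ (Submodule.mkQ I 1)) (fun a ha => by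
    rw [← map_smul, show a • Submodule.mkQ I 1 = 0 from smul_quot_zero ha _, map_zero])] at h4
  exact hs ((hv s).1 h4)

end HL
end

section
namespace HL
variable {A : Type} [CommRing A] [IsNoetherianRing A]

lemma fg_kill {P : Ideal A} (hP : P.IsPrime) {N : Type} [AddCommGroup N] [Module A N] (L : Submodule A N)
    (U : Submodule A N) (hU : U.FG) (h : ∀ x ∈ U, ∃ s, s ∉ P ∧ s • x ∈ L) : ∃ s, s ∉ P ∧ ∀ x ∈ U, s • x ∈ L := by
  obtain ⟨t, rfl⟩ := hU
  suffices ∀ t' : Finset N, t' ⊆ t → ∃ s, s ∉ P ∧ ∀ x ∈ t', s • x ∈ L by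
    obtain ⟨s, hs, hst⟩ := this t le_rfl
    refine ⟨s, hs, fun x hx => ?_⟩
    have : Submodule.span A (t : Set N) ≤ L.comap (s • LinearMap.id) := by
      rw [Submodule.span_le]; intro y hy; exact hst y hy
    exact this hx
  classical
  intro t'
  induction t' using Finset.induction_on with
  | empty => exact fun _ => ⟨1, fun h1 => hP.ne_top ((Ideal.eq_top_iff_one _).2 h1), by simp⟩
  | insert a t' ha ih =>
    intro hsub
    obtain ⟨s, hs, hst⟩ := ih fun x hx => hsub (Finset.mem_insert_of_mem hx)
    obtain ⟨s', hs', hst'⟩ := h a (Submodule.subset_span (hsub (Finset.mem_insert_self _ _)))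
    refine ⟨s * s', notMem_mul hP hs hs', fun x hx => ?_⟩
    rcases Finset.mem_insert.1 hx with rfl | hx
    · rw [mul_smul]; exact L.smul_mem _ hst'
    · rw [mul_comm, mul_smul]; exact L.smul_mem _ (hst x hx)

lemma assP {P : Ideal A} {Z : Type} [AddCommGroup Z] [Module A Z] (L : Submodule A Z)
    (hL : ∀ t z, t ∉ P → t • z ∈ L → z ∈ L) (z : Z) (hz : z ∉ L) :
    ∃ (q : Ideal A) (y : A), q.IsPrime ∧ q ≤ P ∧ (∀ r : A, r • (y • z) ∈ L ↔ r ∈ q) ∧ y • z ∉ L := by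
  obtain ⟨q, y, hq, hy⟩ := exists_ann (A := A) (L.mkQ z) (by simpa using hz)
  have hy' : ∀ r : A, r • (y • z) ∈ L ↔ r ∈ q := fun r => by
    rw [← hy, ← map_smul, ← map_smul, Submodule.mkQ_apply, Submodule.Quotient.mk_eq_zero]
  have h1 : y • z ∉ L := fun h => hq.ne_top ((Ideal.eq_top_iff_one _).2 ((hy' 1).1 (by rwa [one_smul])))
  exact ⟨q, y, hq, fun r hr => by_contra fun hrP => h1 (hL r _ hrP ((hy' r).2 hr)), hy', h1⟩

def satS {P : Ideal A} (hP : P.IsPrime) {Z : Type} [AddCommGroup Z] [Module A Z] (L : Submodule A Z) : Submodule A Z where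
  carrier := {z | ∃ s, s ∉ P ∧ s • z ∈ L}
  add_mem' := by
    rintro a b ⟨s, hs, h⟩ ⟨t, ht, h'⟩
    refine ⟨s * t, notMem_mul hP hs ht, ?_⟩
    rw [smul_add]
    refine L.add_mem ?_ ?_
    · rw [mul_comm, mul_smul]; exact L.smul_mem _ h
    · rw [mul_smul]; exact L.smul_mem _ h'
  zero_mem' := ⟨1, fun h1 => hP.ne_top ((Ideal.eq_top_iff_one _).2 h1), by simp⟩
  smul_mem' := by
    rintro a b ⟨s, hs, h⟩
    exact ⟨s, hs, by rw [smul_comm]; exact L.smul_mem _ h⟩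

lemma satS_sat {P : Ideal A} (hP : P.IsPrime) {Z : Type} [AddCommGroup Z] [Module A Z] (L : Submodule A Z)
    (t : A) (z : Z) (ht : t ∉ P) (h : t • z ∈ satS hP L) : z ∈ satS hP L := by
  obtain ⟨s, hs, h⟩ := h
  exact ⟨s * t, notMem_mul hP hs ht, by rwa [mul_smul]⟩

lemma ass_le {P : Ideal A} (hP : P.IsPrime) {N : Type} [AddCommGroup N] [Module A N] (v : N)
    (hv : ∀ s : A, s • v = 0 → s ∈ P) :
    ∃ (q : Ideal A) (w : A), q.IsPrime ∧ q ≤ P ∧ ∀ r : A, r • (w • v) = 0 ↔ r ∈ q := by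
  obtain ⟨q, y, hq, hqP, h, h1⟩ := assP (satS hP (⊥ : Submodule A N)) (satS_sat hP _) v
    (by rintro ⟨s, hs, h⟩; exact hs (hv s (by simpa using h)))
  obtain ⟨s, hs, hk⟩ := fg_kill hP (LinearMap.ker (LinearMap.toSpanSingleton A N (y • v))) q
    ((isNoetherianRing_iff_ideal_fg A).1 inferInstance q) (fun x hx => by
      obtain ⟨s, hs, h⟩ := (h x).2 hx
      refine ⟨s, hs, ?_⟩
      rw [LinearMap.mem_ker, map_smul]; simpa using h)
  refine ⟨q, s * y, hq, hqP, fun r => ⟨fun hr => (h r).1 ⟨s, hs, ?_⟩, fun hr => ?_⟩⟩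
  · rw [Submodule.mem_bot, ← hr]; simp only [smul_smul]; ring_nf
  · have := hk r hr
    rw [LinearMap.mem_ker, map_smul, LinearMap.toSpanSingleton_apply] at this
    rw [← this]; simp only [smul_smul]; ring_nf

variable [IsLocalRing A] {xs : List A}
variable {f : List A} (I : Ideal A)

def D0 (I : Ideal A) : Prop := ∀ P : Ideal A, P.IsPrime → (∃ Q : Ideal A, Q.IsPrime ∧ I ≤ Q ∧ Q < P) →
  ∀ r, (∀ x ∈ P, ∃ s, s ∉ P ∧ s * x * r ∈ I) → ∃ s, s ∉ P ∧ s * r ∈ I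

def D1 (I : Ideal A) : Prop := ∀ P : Ideal A, P.IsPrime →
  (∃ Q Q' : Ideal A, Q.IsPrime ∧ Q'.IsPrime ∧ I ≤ Q ∧ Q < Q' ∧ Q' < P) →
  ∀ r s : A → A, (∀ x ∈ P, s x ∉ P) →
    (∀ x ∈ P, ∀ y ∈ P, ∀ z ∈ P, z - (x + y) ∈ I → ∃ σ, σ ∉ P ∧ σ * (r z * s x * s y - s z * (r x * s y + r y * s x)) ∈ I) →
    (∀ a, ∀ x ∈ P, ∀ z ∈ P, z - a * x ∈ I → ∃ σ, σ ∉ P ∧ σ * (r z * s x - a * r x * s z) ∈ I) →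
    ∃ r0 s0, s0 ∉ P ∧ ∀ x ∈ P, ∃ σ, σ ∉ P ∧ σ * (r x * s0 - s x * x * r0) ∈ I

variable (f) in
def uI : Ideal A where
  carrier := {a | ∀ v ∈ tor I (HA f), a • v = 0}
  add_mem' := fun h h' v hv => by rw [add_smul, h v hv, h' v hv, add_zero]
  zero_mem' := fun v _ => zero_smul _ _
  smul_mem' := fun c a h v hv => by rw [smul_eq_mul, mul_smul, h v hv, smul_zero]

variable (f) in
def jI : Ideal A where
  carrier := {a | ∀ x ∈ uI f I, a * x ∈ I}
  add_mem' := fun h h' v hv => by rw [add_mul]; exact I.add_mem (h v hv) (h' v hv)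
  zero_mem' := fun v _ => by rw [zero_mul]; exact I.zero_mem
  smul_mem' := fun c a h v hv => by rw [smul_eq_mul, mul_assoc]; exact I.mul_mem_left _ (h v hv)

variable (f) in
def Good (P : Ideal A) : Prop :=
  (∀ φ : tor I (HA f) →ₗ[A] HA f, ∃ s, s ∉ P ∧ ∃ r : A, ∀ v, s • φ v = r • (v : HA f)) ∧
  (∀ x ∈ uI f I, ∃ s, s ∉ P ∧ s * x ∈ I)

variable (f) in
def LI {P : Ideal A} (hP : P.IsPrime) : Submodule A ((tor I (HA f) →ₗ[A] HA f) × A) where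
  carrier := {z | ∃ s, s ∉ P ∧ ∃ r : A, (∀ v, s • z.1 v = r • (v : HA f)) ∧ s * z.2 - r ∈ jI f I}
  add_mem' := by
    rintro a b ⟨s, hs, r, h1, h2⟩ ⟨s', hs', r', h1', h2'⟩
    refine ⟨s * s', notMem_mul hP hs hs', s' * r + s * r', fun v => ?_, ?_⟩
    · rw [Prod.fst_add, LinearMap.add_apply, add_smul, mul_smul s' r, mul_smul s r', ← h1, ← h1',
        smul_add, mul_smul, smul_comm, mul_smul]
    · have : s * s' * (a + b).2 - (s' * r + s * r') = s' * (s * a.2 - r) + s * (s' * b.2 - r') := by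
        rw [Prod.snd_add]; ring
      rw [this]; exact (jI f I).add_mem (Ideal.mul_mem_left _ _ h2) (Ideal.mul_mem_left _ _ h2')
  zero_mem' := ⟨1, fun h1 => hP.ne_top ((Ideal.eq_top_iff_one _).2 h1), 0, by simp, by simp⟩
  smul_mem' := by
    rintro c a ⟨s, hs, r, h1, h2⟩
    refine ⟨s, hs, c * r, fun v => ?_, ?_⟩
    · rw [Prod.smul_fst, LinearMap.smul_apply, smul_comm, h1, mul_smul]
    · have : s * (c • a).2 - c * r = c * (s * a.2 - r) := by
        rw [Prod.smul_snd, smul_eq_mul]; ring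
      rw [this]; exact Ideal.mul_mem_left _ _ h2

lemma LI_sat {P : Ideal A} (hP : P.IsPrime) (t : A) (z) (ht : t ∉ P) (h : t • z ∈ LI f I hP) : z ∈ LI f I hP := by
  obtain ⟨s, hs, r, h1, h2⟩ := h
  refine ⟨s * t, notMem_mul hP hs ht, r, fun v => ?_, ?_⟩
  · rw [← h1, mul_smul]; rfl
  · rw [mul_assoc]; exact h2

lemma pI_le (hfI : ∀ b ∈ f, b ∈ I) : pI 1 f ≤ I := by
  rw [pI, Ideal.span_le]
  rintro _ ⟨b, hb, rfl⟩
  simpa using hfI b hb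

lemma I_le_u : I ≤ uI f I := fun _ hx v hv => hv _ hx
lemma I_le_j : I ≤ jI f I := fun _ hx _ _ => Ideal.mul_mem_right _ _ hx

lemma fgA (J : Ideal A) : Submodule.FG J := (isNoetherianRing_iff_ideal_fg A).1 inferInstance J

lemma Good.j {P : Ideal A} (hP : P.IsPrime) (h : Good f I P) : ∃ s, s ∉ P ∧ s ∈ jI f I := 
  fg_kill hP I (uI f I) (fgA _) h.2


lemma good_low (H : Rg xs) (hf : NZL f (ModuleCat.of A A)) (I : Ideal A) (hfI : ∀ b ∈ f, b ∈ I) {P : Ideal A} {g : List A} (hP : Gr g P) (hl : g.length ≤ f.length) (hu : uI f I ≤ P) : Good f I P := by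
  have hfP : ∀ b ∈ f, b ∈ P := fun b hb => hu (I_le_u I (hfI b hb))
  exact ⟨fun φ => gen_lem H hf 1 I (pI_le I hfI) hP hfP (by omega) φ,
    fun x hx => ann_loc H I hfI (hP.swap H hf hfP hl) x hx⟩

lemma exists_Gf (H : Rg xs) (hf : NZL f (ModuleCat.of A A)) (I : Ideal A) (hfI : ∀ b ∈ f, b ∈ I) {P : Ideal A} (hP : P.IsPrime) (hu : uI f I ≤ P) : ∃ q, Gr f q ∧ q ≤ P ∧ I ≤ q := by
  have hfin := tor_finite 1 f hf I (pI_le I hfI)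
  by_contra hcon
  obtain ⟨s, hs, hsk⟩ := fg_kill hP (⊥ : Submodule A (HA f)) (tor I (HA f)) (Module.Finite.iff_fg.1 hfin) (fun x hx => by
    by_contra hc
    push Not at hc
    obtain ⟨q, w, hq, hqP, hqa⟩ := ass_le hP x (fun s hs => by_contra fun h => hc s h ((Submodule.mem_bot A).2 hs))
    refine hcon ⟨q, Gr_of_ann hq hf _ hqa, hqP, fun i hi => (hqa i).1 ?_⟩
    rw [smul_comm, hx i hi, smul_zero])
  exact hs (hu fun v hv => (Submodule.mem_bot A).1 (hsk v hv))

lemma good_mid (H : Rg xs) (hf : NZL f (ModuleCat.of A A)) (I : Ideal A) (hfI : ∀ b ∈ f, b ∈ I) (d0 : D0 I) {P : Ideal A} {g : List A} (hP : Gr g P) (hl : f.length < g.length) (hu : uI f I ≤ P)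
    (hch : ¬ ∃ Q Q' : Ideal A, Q.IsPrime ∧ Q'.IsPrime ∧ I ≤ Q ∧ Q < Q' ∧ Q' < P) : Good f I P := by
  have hfP : ∀ b ∈ f, b ∈ P := fun b hb => hu (I_le_u I (hfI b hb))
  obtain ⟨q, hq, hqP, hIq⟩ := exists_Gf H hf I hfI hP.pr hu
  have hlt : q < P := lt_of_le_of_ne hqP (by rintro rfl; have := hP.len_eq hq; omega)
  obtain ⟨a, haP, haq⟩ := SetLike.exists_of_lt hlt
  have hl2 := hq.cover H hP hqP a haP haq (fun Q hQ hqQ haQ hQP => by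
    by_contra hne
    exact hch ⟨q, Q, hq.pr, hQ, hIq, lt_of_le_of_ne hqQ (by rintro rfl; exact haq haQ), lt_of_le_of_ne hQP hne⟩)
  refine ⟨fun φ => gen_lem H hf 1 I (pI_le I hfI) hP hfP (by omega) φ, fun x hx => ?_⟩
  by_contra hcon
  obtain ⟨q', y, hq', hqP', h, h1⟩ := assP (satS hP.pr I) (satS_sat hP.pr I) x hcon
  rcases eq_or_lt_of_le hqP' with rfl | hlt'
  · exact h1 (d0 _ hP.pr ⟨q, hq.pr, hIq, hlt⟩ _ fun x hx => by
      obtain ⟨s, hs, h⟩ := (h x).2 hx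
      exact ⟨s, hs, by rw [mul_assoc]; exact h⟩)
  · obtain ⟨g', hg'⟩ := exists_Gr H q' hq'
    have := hg'.lt H hP hlt'
    have hIq' : I ≤ q' := fun i hi => (h i).1 ⟨1, fun h1 => hP.pr.ne_top ((Ideal.eq_top_iff_one _).2 h1), by
      rw [one_smul]; exact Ideal.mul_mem_right _ _ hi⟩
    obtain ⟨s, hs, hsx⟩ := ann_loc H I hfI (hg'.swap H hf (fun b hb => hIq' (hfI b hb)) (by omega)) x hx
    refine hs ((h s).1 ⟨1, fun h1 => hP.pr.ne_top ((Ideal.eq_top_iff_one _).2 h1), ?_⟩)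
    rw [one_smul, smul_comm]; exact I.mul_mem_left _ hsx

lemma good_high (H : Rg xs) (hf : NZL f (ModuleCat.of A A)) (I : Ideal A) (hfI : ∀ b ∈ f, b ∈ I) (d0 : D0 I) (d1 : D1 I) {P : Ideal A} {g : List A} (hP : Gr g P) (hl : f.length < g.length) (hu : uI f I ≤ P)
    (hch : ∃ Q Q' : Ideal A, Q.IsPrime ∧ Q'.IsPrime ∧ I ≤ Q ∧ Q < Q' ∧ Q' < P)
    (ih : ∀ q : Ideal A, q.IsPrime → uI f I ≤ q → q < P → Good f I q) : Good f I P := by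
  have hfin := tor_finite 1 f hf I (pI_le I hfI)
  have one : (1 : A) ∉ P := fun h1 => hP.pr.ne_top ((Ideal.eq_top_iff_one _).2 h1)
  have d0' : ∀ r, (∀ x ∈ P, ∃ s, s ∉ P ∧ s * x * r ∈ I) → ∃ s, s ∉ P ∧ s * r ∈ I := by
    obtain ⟨Q, Q', h1, h2, h3, h4, h5⟩ := hch
    exact d0 P hP.pr ⟨Q, h1, h3, h4.trans h5⟩
  have c1 : ∀ r ∈ uI f I, r ∈ jI f I → ∃ s, s ∉ P ∧ s * r ∈ I := by
    intro r hru hrj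
    by_contra hcon
    obtain ⟨q, y, hq, hqP, h, h1⟩ := assP (satS hP.pr I) (satS_sat hP.pr I) r hcon
    rcases eq_or_lt_of_le hqP with rfl | hlt
    · exact h1 (d0' _ fun x hx => by
        obtain ⟨s, hs, h⟩ := (h x).2 hx
        exact ⟨s, hs, by rw [mul_assoc]; exact h⟩)
    by_cases huq : uI f I ≤ q
    · obtain ⟨s, hs, hsr⟩ := (ih q hq huq hlt).2 r hru
      refine hs ((h s).1 ⟨1, one, ?_⟩)
      rw [one_smul, smul_comm]; exact I.mul_mem_left _ hsr
    · obtain ⟨x, hx, hxq⟩ := SetLike.not_le_iff_exists.1 huq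
      refine hxq ((h x).1 ⟨1, one, ?_⟩)
      rw [one_smul, smul_comm]
      refine I.mul_mem_left _ ?_
      rw [smul_eq_mul, mul_comm]; exact hrj x hx
  have c2 : ∀ z, z ∈ LI f I hP.pr := by
    by_contra! hcon
    obtain ⟨z, hz⟩ := hcon
    obtain ⟨q, y, hq, hqP, h, h1⟩ := assP _ (LI_sat I hP.pr) z hz
    generalize y • z = w at h h1
    obtain ⟨ψ, b⟩ := w
    rcases eq_or_lt_of_le hqP with rfl | hlt
    · have hx : ∀ x, ∃ s r, x ∈ q → s ∉ q ∧ (∀ v, s • (x • ψ) v = r • (v : HA f)) ∧ s * (x * b) - r ∈ jI f I := by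
        intro x
        by_cases hx : x ∈ q
        · obtain ⟨s, hs, r, h1, h2⟩ := (h x).2 hx
          exact ⟨s, r, fun _ => ⟨hs, h1, h2⟩⟩
        · exact ⟨0, 0, fun h => absurd h hx⟩
      choose s r hsr using hx
      have hψI : ∀ i ∈ I, ∀ v, i • ψ v = 0 := fun i hi v => by
        rw [← map_smul, show i • v = 0 from Subtype.ext (v.2 i hi), map_zero]
      obtain ⟨r0, s0, hs0, hrs⟩ := d1 q hP.pr hch r s (fun x hx => (hsr x hx).1) (fun x hx y hy z hz hxyz => by
          refine c1 _ ?_ ?_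
          · intro v hv
            have e1 := (hsr x hx).2.1 ⟨v, hv⟩
            have e2 := (hsr y hy).2.1 ⟨v, hv⟩
            have e3 := (hsr z hz).2.1 ⟨v, hv⟩
            have e4 := hψI _ hxyz ⟨v, hv⟩
            simp only [LinearMap.smul_apply, smul_smul] at e1 e2 e3
            have : (r z * s x * s y - s z * (r x * s y + r y * s x)) • v =
              (s x * s y) • (r z • v) - (s z * s y) • (r x • v) - (s z * s x) • (r y • v) := by module
            rw [this, ← e1, ← e2, ← e3, ← smul_zero (s x * s y * s z), ← e4]; module
          · have : r z * s x * s y - s z * (r x * s y + r y * s x) = 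
              - (s x * s y) * (s z * (z * b) - r z) + (s z * s y) * (s x * (x * b) - r x) + (s z * s x) * (s y * (y * b) - r y)
                + (s x * s y * s z * b) * (z - (x + y)) := by ring
            rw [this]
            exact (jI f I).add_mem ((jI f I).add_mem ((jI f I).add_mem (Ideal.mul_mem_left _ _ (hsr z hz).2.2)
              (Ideal.mul_mem_left _ _ (hsr x hx).2.2)) (Ideal.mul_mem_left _ _ (hsr y hy).2.2)) 
              (Ideal.mul_mem_left _ _ (I_le_j I hxyz)))
        (fun a x hx z hz hxyz => by
          refine c1 _ ?_ ?_
          · intro v hv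
            have e1 := (hsr x hx).2.1 ⟨v, hv⟩
            have e3 := (hsr z hz).2.1 ⟨v, hv⟩
            have e4 := hψI _ hxyz ⟨v, hv⟩
            simp only [LinearMap.smul_apply, smul_smul] at e1 e3
            have : (r z * s x - a * r x * s z) • v =
              (s x) • (r z • v) - (a * s z) • (r x • v) := by module
            rw [this, ← e1, ← e3, ← smul_zero (s x * s z), ← e4]; module
          · have : r z * s x - a * r x * s z = 
              - (s x) * (s z * (z * b) - r z) + (s z * a) * (s x * (x * b) - r x) 
                + (s x * s z * b) * (z - a * x) := by ring
            rw [this]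
            exact (jI f I).add_mem ((jI f I).add_mem (Ideal.mul_mem_left _ _ (hsr z hz).2.2)
              (Ideal.mul_mem_left _ _ (hsr x hx).2.2)) 
              (Ideal.mul_mem_left _ _ (I_le_j I hxyz)))
      -- ψ' locally zero
      let ψ' : tor I (HA f) →ₗ[A] HA f := s0 • ψ - r0 • (tor I (HA f)).subtype
      have hψ' : ∀ v, ψ' v = s0 • ψ v - r0 • (v : HA f) := fun v => rfl
      obtain ⟨s1, hs1, hk⟩ := fg_kill hP.pr (LinearMap.ker ψ') ⊤ hfin.1 (fun v _ => by
        by_contra! hc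
        obtain ⟨q', w, hq', hqP', hqa⟩ := ass_le hP.pr (ψ' v) (fun s hs => by_contra fun h => hc s h (by
          rw [LinearMap.mem_ker, map_smul, hs]))
        have : q' = q := by
          refine le_antisymm hqP' fun x hx => ?_
          obtain ⟨σ, hσ, hσI⟩ := hrs x hx
          have e1 := (hsr x hx).2.1 v
          simp only [LinearMap.smul_apply, smul_smul] at e1
          have e2 := v.2 _ hσI
          have : (σ * s x * x) • (w • ψ' v) = 0 := by
            rw [hψ']
            have : (σ * s x * x) • (w • (s0 • ψ v - r0 • (v : HA f))) =
              (w * σ * s0) • ((s x * x) • ψ v) - (w * σ * s x * x * r0) • (v : HA f) := by module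
            rw [this, e1, ← smul_zero w, ← e2]; module
          have := (hqa _).1 this
          rcases hq'.mem_or_mem this with h | h
          · exact absurd (hqP' h) (notMem_mul hP.pr hσ (hsr x hx).1)
          · exact h
        rw [this] at hqa
        have := hP.len_eq (Gr_of_ann hP.pr hf _ hqa)
        omega)
      obtain ⟨s2, hs2, hk2⟩ := fg_kill hP.pr (Submodule.comap (LinearMap.mulLeft A (s0 * b - r0)) I) (uI f I) (fgA _) (by
        intro y hy
        suffices ∃ s, s ∉ q ∧ s * ((LinearMap.mulLeft A (s0 * b - r0)) y) ∈ I by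
          obtain ⟨s, hs, h⟩ := this
          exact ⟨s, hs, by rw [Submodule.mem_comap, map_smul]; exact h⟩
        refine d0' _ fun x hx => ?_
        obtain ⟨σ, hσ, hσI⟩ := hrs x hx
        refine ⟨σ * s x, notMem_mul hP.pr hσ (hsr x hx).1, ?_⟩
        have e1 := (hsr x hx).2.2 y hy
        have : σ * s x * x * (LinearMap.mulLeft A (s0 * b - r0)) y = 
          (σ * s0) * ((s x * (x * b) - r x) * y) + y * (σ * (r x * s0 - s x * x * r0)) := by
          rw [LinearMap.mulLeft_apply]; ring
        rw [this]
        exact I.add_mem (I.mul_mem_left _ e1) (I.mul_mem_left _ hσI))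
      refine h1 ⟨s2 * s1 * s0, notMem_mul hP.pr (notMem_mul hP.pr hs2 hs1) hs0, s2 * s1 * r0, fun v => ?_, ?_⟩
      · have := hk v trivial
        rw [LinearMap.mem_ker, map_smul, hψ'] at this
        rw [← sub_eq_zero, ← smul_zero s2, ← this]
        module
      · intro x hx
        have := hk2 _ hx
        rw [Submodule.mem_comap, map_smul, LinearMap.mulLeft_apply, smul_eq_mul] at this
        have e : (s2 * s1 * s0 * b - s2 * s1 * r0) * x = s1 * (s2 * ((s0 * b - r0) * x)) := by ring
        rw [show (ψ, b).2 = b from rfl, e]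
        exact I.mul_mem_left _ this
    by_cases huq : uI f I ≤ q
    · obtain ⟨s, hs, r, hr⟩ := (ih q hq huq hlt).1 ψ
      obtain ⟨σ, hσ, hσj⟩ := (ih q hq huq hlt).j I hq
      refine notMem_mul hq hσ hs ((h _).1 ⟨1, one, σ * r, fun v => ?_, ?_⟩)
      · rw [one_smul, mul_smul σ r, ← hr, smul_smul]; rfl
      · rw [one_mul, show ((σ * s) • (ψ, b)).2 = σ * s * b from rfl, show σ * s * b - σ * r = (s * b - r) * σ by ring]
        exact Ideal.mul_mem_left _ _ hσj
    · obtain ⟨x, hx, hxq⟩ := SetLike.not_le_iff_exists.1 huq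
      refine hxq ((h x).1 ⟨1, one, x * b, fun v => ?_, ?_⟩)
      · rw [one_smul, mul_comm, mul_smul, hx v v.2, smul_zero]
        change x • ψ v = 0
        rw [← map_smul, show x • v = 0 from Subtype.ext (hx v v.2), map_zero]
      · rw [one_mul, show (x • (ψ, b)).2 = x * b from rfl, sub_self]; exact Ideal.zero_mem _
  refine ⟨fun φ => ?_, fun x hx => ?_⟩
  · obtain ⟨s, hs, r, hr, _⟩ := c2 (φ, 0)
    exact ⟨s, hs, r, hr⟩
  · obtain ⟨s, hs, r, hr, hj⟩ := c2 ((tor I (HA f)).subtype, 0)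
    refine ⟨r, fun hrP => ?_, ?_⟩
    · have : s - r ∈ uI f I := fun v hv => by
        have := hr ⟨v, hv⟩
        rw [sub_smul, ← this]; exact sub_self _
      have := P.add_mem (hu this) hrP
      rw [sub_add_cancel] at this; exact hs this
    · have := hj x hx
      rw [show s * ((tor I (HA f)).subtype, (0:A)).2 - r = - r by simp, neg_mul] at this
      simpa using this

theorem endo_scalar (H : Rg xs) (hf : NZL f (ModuleCat.of A A)) (I : Ideal A) (hfI : ∀ b ∈ f, b ∈ I) (d0 : D0 I) (d1 : D1 I) (φ : tor I (HA f) →ₗ[A] HA f) : ∃ r : A, ∀ v, φ v = r • (v : HA f) := by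
  have main : ∀ (k : ℕ) (P : Ideal A) (g : List A), Gr g P → g.length = k → uI f I ≤ P → Good f I P := by
    intro k
    induction k using Nat.strong_induction_on with
    | _ k ih =>
      intro P g hP hk hu
      by_cases hl : g.length ≤ f.length
      · exact good_low H hf I hfI hP hl hu
      push Not at hl
      by_cases hch : ∃ Q Q' : Ideal A, Q.IsPrime ∧ Q'.IsPrime ∧ I ≤ Q ∧ Q < Q' ∧ Q' < P
      · refine good_high H hf I hfI d0 d1 hP hl hu hch fun q hq huq hlt => ?_
        obtain ⟨g', hg'⟩ := exists_Gr H q hq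
        exact ih _ (hk ▸ hg'.lt H hP hlt) q g' hg' rfl huq
      · exact good_mid H hf I hfI d0 hP hl hu hch
  by_cases hu : uI f I = ⊤
  · refine ⟨0, fun v => ?_⟩
    have h1 : (1 : A) ∈ uI f I := hu ▸ trivial
    rw [show v = 0 from Subtype.ext (by have := h1 v v.2; rwa [one_smul] at this), map_zero, zero_smul]
  · obtain ⟨g, hg⟩ := exists_Gr H (maximalIdeal A) inferInstance
    obtain ⟨s, hs, r, hr⟩ := (main _ _ g hg rfl (le_maximalIdeal hu)).1 φ
    have hsu : IsUnit s := by simpa using hs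
    obtain ⟨t, rfl⟩ := hsu
    refine ⟨↑t⁻¹ * r, fun v => ?_⟩
    rw [mul_smul, ← hr, smul_smul, Units.inv_mul, one_smul]

end HL
end

section
namespace HL
variable {A : Type} [CommRing A] [IsNoetherianRing A]

def S2 (R : Type) [CommRing R] : Prop := ∀ (P : Ideal R) (hP : P.IsPrime) (i : ℕ),
      (i : ℕ∞) < min 2 (Order.height (⟨P, hP⟩ : PrimeSpectrum R)) →
      Subsingleton ((((Ext (Localization.AtPrime P) (ModuleCat (Localization.AtPrime P)) i).obj
          (op (ModuleCat.of (Localization.AtPrime P)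
            (ResidueField (Localization.AtPrime P))))).obj
        (ModuleCat.of (Localization.AtPrime P) (Localization.AtPrime P))) : Type)

lemma S2.EE {R : Type} [CommRing R] (h : S2 R) (P : Ideal R) [hP : P.IsPrime] (i : ℕ)
    (hi : (i : ℕ∞) < min 2 (Order.height (⟨P, hP⟩ : PrimeSpectrum R))) :
    Subsingleton (EE (Localization.AtPrime P) (ResidueField (Localization.AtPrime P)) (Localization.AtPrime P) i) :=
  haveI := h P hP i hi
  (HL.EE.old i).symm.toEquiv.subsingleton

lemma q_prime {I P : Ideal A} (hP : P.IsPrime) (h : I ≤ P) : (P.map (Ideal.Quotient.mk I)).IsPrime :=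
  Ideal.map_isPrime_of_surjective Ideal.Quotient.mk_surjective (by rwa [Ideal.mk_ker])

lemma q_lt {I P Q : Ideal A} (h : I ≤ P) (h' : P < Q) : P.map (Ideal.Quotient.mk I) < Q.map (Ideal.Quotient.mk I) := by
  obtain ⟨x, hx, hx'⟩ := SetLike.exists_of_lt h'
  refine lt_of_le_of_ne (Ideal.map_mono h'.le) fun e => hx' ?_
  rw [← Ideal.mem_quotient_iff_mem h, e]
  exact Ideal.mem_map_of_mem _ hx

lemma S2.d0 (I : Ideal A) (h : S2 (A ⧸ I)) : D0 I := by
  rintro P hP ⟨Q, hQ, hIQ, hQP⟩ r hr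
  have hIP := hIQ.trans hQP.le
  haveI hP' := q_prime hP hIP
  haveI hQ' := q_prime hQ hIQ
  have hlt : (⟨_, hQ'⟩ : PrimeSpectrum (A ⧸ I)) < ⟨_, hP'⟩ := q_lt hIQ hQP
  have h1 := Order.height_add_one_le hlt
  have := h.EE (P.map (Ideal.Quotient.mk I)) 0 (by
    refine lt_min (by norm_num) (lt_of_lt_of_le ?_ h1)
    rw [Nat.cast_zero]
    exact pos_iff_ne_zero.2 (by simp))
  obtain ⟨s, hs, hsr⟩ := depth0 _ this (Ideal.Quotient.mk I r) (fun x hx => by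
    obtain ⟨x, rfl⟩ := Ideal.Quotient.mk_surjective x
    obtain ⟨s, hs, h⟩ := hr x ((Ideal.mem_quotient_iff_mem hIP).1 hx)
    refine ⟨Ideal.Quotient.mk I s, fun hc => hs ((Ideal.mem_quotient_iff_mem hIP).1 hc), ?_⟩
    rw [← map_mul, ← map_mul]; exact Ideal.Quotient.eq_zero_iff_mem.2 h)
  obtain ⟨s, rfl⟩ := Ideal.Quotient.mk_surjective s
  refine ⟨s, fun hc => hs ((Ideal.mem_quotient_iff_mem hIP).2 hc), ?_⟩
  rw [← map_mul] at hsr; exact Ideal.Quotient.eq_zero_iff_mem.1 hsr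

lemma S2.d1 (I : Ideal A) (h : S2 (A ⧸ I)) : D1 I := by
  rintro P hP ⟨Q, Q', hQ, hQ', hIQ, hQQ, hQP⟩ r s hs hadd hsm
  have hIQ' := hIQ.trans hQQ.le
  have hIP := hIQ'.trans hQP.le
  haveI iP := q_prime hP hIP
  haveI iQ := q_prime hQ hIQ
  haveI iQ' := q_prime hQ' hIQ'
  have hlt : (⟨_, iQ'⟩ : PrimeSpectrum (A ⧸ I)) < ⟨_, iP⟩ := q_lt hIQ' hQP
  have hlt' : (⟨_, iQ⟩ : PrimeSpectrum (A ⧸ I)) < ⟨_, iQ'⟩ := q_lt hIQ hQQ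
  have h1 := Order.height_add_one_le hlt
  have h2 := Order.height_add_one_le hlt'
  have hE := h.EE (P.map (Ideal.Quotient.mk I)) 1 (by
    refine lt_min (by norm_num) (lt_of_lt_of_le ?_ h1)
    refine lt_of_lt_of_le ?_ (add_le_add_left h2 1)
    rw [add_assoc]
    refine lt_of_lt_of_le ?_ (le_add_self)
    norm_num)
  set P' := P.map (Ideal.Quotient.mk I)
  have hmem : ∀ x, Ideal.Quotient.mk I x ∈ P' ↔ x ∈ P := fun x => Ideal.mem_quotient_iff_mem hIP
  let l : A ⧸ I → A := Function.surjInv Ideal.Quotient.mk_surjective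
  have hl : ∀ x, Ideal.Quotient.mk I (l x) = x := Function.surjInv_eq Ideal.Quotient.mk_surjective
  have hlP : ∀ x : P', l x ∈ P := fun x => (hmem _).1 (by rw [hl]; exact x.2)
  let σ : P' → P'.primeCompl := fun x => ⟨Ideal.Quotient.mk I (s (l x)), fun hc => hs _ (hlP x) ((hmem _).1 hc)⟩
  let L := Localization.AtPrime P'
  have hc : ∀ {x}, x ∉ P → Ideal.Quotient.mk I x ∈ P'.primeCompl := fun h hc => h ((hmem _).1 hc)
  let g : P' →ₗ[A ⧸ I] L :=
    { toFun := fun x => IsLocalization.mk' L (Ideal.Quotient.mk I (r (l x))) (σ x)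
      map_add' := by
        intro x y
        rw [← IsLocalization.mk'_add, IsLocalization.eq]
        obtain ⟨t, ht, hti⟩ := hadd (l x) (hlP x) (l y) (hlP y) (l ↑(x + y)) (hlP _) (by
          rw [← Ideal.Quotient.eq_zero_iff_mem]; simp [hl])
        refine ⟨⟨_, hc ht⟩, ?_⟩
        rw [← Ideal.Quotient.eq_zero_iff_mem] at hti
        simp only [map_mul, map_sub, map_add] at hti
        rw [← sub_eq_zero, ← hti]
        simp only [σ, Submonoid.coe_mul]
        ring
      map_smul' := by
        intro a x
        obtain ⟨t, ht, hti⟩ := hsm (l a) (l x) (hlP x) (l ↑(a • x)) (hlP _) (by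
          rw [← Ideal.Quotient.eq_zero_iff_mem]; simp [hl])
        rw [RingHom.id_apply, Algebra.smul_def, ← IsLocalization.mk'_one (M := P'.primeCompl) L a, ← IsLocalization.mk'_mul, IsLocalization.eq]
        refine ⟨⟨_, hc ht⟩, ?_⟩
        rw [← Ideal.Quotient.eq_zero_iff_mem] at hti
        simp only [map_mul, map_sub, map_add, hl] at hti
        rw [← sub_eq_zero, ← hti]
        simp only [σ, Submonoid.coe_mul, Submonoid.coe_one]
        ring }
  obtain ⟨a, ha⟩ := depth1 P' hE g
  obtain ⟨a0, s0, rfl⟩ := IsLocalization.exists_mk'_eq P'.primeCompl a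
  obtain ⟨s0, hs0⟩ := s0
  obtain ⟨s0, rfl⟩ := Ideal.Quotient.mk_surjective s0
  obtain ⟨r0, rfl⟩ := Ideal.Quotient.mk_surjective a0
  refine ⟨r0, s0, fun h => hs0 ((hmem _).2 h), fun x hx => ?_⟩
  let x' : P' := ⟨Ideal.Quotient.mk I x, (hmem _).2 hx⟩
  have h3 := ha x'
  change IsLocalization.mk' L (Ideal.Quotient.mk I (r (l x'))) (σ x') = _ at h3
  rw [Algebra.smul_def, ← IsLocalization.mk'_one (M := P'.primeCompl) L, ← IsLocalization.mk'_mul, IsLocalization.eq] at h3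
  obtain ⟨⟨t, ht⟩, h3⟩ := h3
  obtain ⟨t, rfl⟩ := Ideal.Quotient.mk_surjective t
  have hlx : x - 1 * l x' ∈ I := by rw [← Ideal.Quotient.eq_zero_iff_mem]; simp [hl, x']
  obtain ⟨w, hw, hwi⟩ := hsm 1 (l x') (hlP x') x hx hlx
  refine ⟨w * t * s (l x'), notMem_mul hP (notMem_mul hP hw fun h => ht ((hmem _).2 h)) (hs _ (hlP x')), ?_⟩
  rw [← Ideal.Quotient.eq_zero_iff_mem] at hwi ⊢
  simp only [map_mul, map_sub, map_add, map_one, σ, Submonoid.coe_mul, Submonoid.coe_one] at hwi h3 ⊢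
  have e1 : (x' : A ⧸ I) = Ideal.Quotient.mk I x := rfl
  rw [e1] at h3 hwi ⊢
  linear_combination (Ideal.Quotient.mk I t * Ideal.Quotient.mk I s0) * hwi + Ideal.Quotient.mk I w * Ideal.Quotient.mk I (s x) * h3

end HL
end

section
namespace HL
section Comb
open Finset
variable {n : ℕ}

/-- Multi-index binomial coefficient. -/
def ch (γ α : Fin n →₀ ℕ) : ℕ := ∏ i, (γ i).choose (α i)

lemma ch_zero (γ : Fin n →₀ ℕ) : ch γ 0 = 1 := by simp [ch]
lemma ch_self (γ : Fin n →₀ ℕ) : ch γ γ = 1 := by simp [ch]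
lemma ch_not_le {γ α : Fin n →₀ ℕ} (h : ¬ α ≤ γ) : ch γ α = 0 := by
  rw [Finsupp.le_def] at h; push Not at h
  obtain ⟨i, hi⟩ := h
  exact Finset.prod_eq_zero (mem_univ i) (Nat.choose_eq_zero_of_lt hi)

lemma vand (γ δ α : Fin n →₀ ℕ) :
    ∑ a ∈ antidiagonal α, ch γ a.1 * ch δ a.2 = ch (γ + δ) α := by
  simp only [ch, Finsupp.add_apply, Nat.add_choose_eq]
  rw [Finset.prod_univ_sum]
  refine Finset.sum_bij' (fun a _ i => (a.1 i, a.2 i))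
    (fun b _ => (Finsupp.equivFunOnFinite.symm fun i => (b i).1, Finsupp.equivFunOnFinite.symm fun i => (b i).2)) ?_ ?_ ?_ ?_ ?_
  · intro a ha
    rw [HasAntidiagonal.mem_antidiagonal] at ha
    simp only [Fintype.mem_piFinset, HasAntidiagonal.mem_antidiagonal]
    intro i; rw [← ha]; rfl
  · intro b hb
    simp only [Fintype.mem_piFinset, HasAntidiagonal.mem_antidiagonal] at hb
    rw [HasAntidiagonal.mem_antidiagonal]
    ext i; simpa using hb i
  · intro a ha
    ext i <;> simp
  · intro b hb; ext i <;> simp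
  · intro a ha
    rw [Finset.prod_mul_distrib]

lemma vsum {M : Type} [AddCommMonoid M] (α β : Fin n →₀ ℕ) (G : (Fin n →₀ ℕ) × (Fin n →₀ ℕ) → M) :
    ∑ a ∈ antidiagonal α, ∑ b ∈ antidiagonal β, (ch (a.1+b.1) a.1 * ch (a.2+b.2) a.2) • G (a.1+b.1, a.2+b.2)
      = ch (α+β) α • ∑ p ∈ antidiagonal (α+β), G p := by
  classical
  rw [← Finset.sum_product' (antidiagonal α) (antidiagonal β)
    (fun a b => (ch (a.1+b.1) a.1 * ch (a.2+b.2) a.2) • G (a.1+b.1, a.2+b.2))]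
  rw [← Finset.sum_fiberwise_of_maps_to (t := antidiagonal (α+β))
    (g := fun x : ((Fin n →₀ ℕ) × (Fin n →₀ ℕ)) × ((Fin n →₀ ℕ) × (Fin n →₀ ℕ)) => (x.1.1+x.2.1, x.1.2+x.2.2))]
  · rw [Finset.smul_sum]
    refine Finset.sum_congr rfl fun p hp => ?_
    have e1 : ∀ x ∈ (antidiagonal α ×ˢ antidiagonal β).filter (fun x => (x.1.1+x.2.1, x.1.2+x.2.2) = p),
        (ch (x.1.1+x.2.1) x.1.1 * ch (x.1.2+x.2.2) x.1.2) • G (x.1.1+x.2.1, x.1.2+x.2.2)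
          = (ch p.1 x.1.1 * ch p.2 x.1.2) • G p := by
      intro x hx
      have := (mem_filter.1 hx).2
      rw [this, ← this]
    rw [Finset.sum_congr rfl e1, ← Finset.sum_smul]
    congr 1
    rw [HasAntidiagonal.mem_antidiagonal] at hp
    rw [← hp, ← vand]
    symm
    rw [← Finset.sum_filter_add_sum_filter_not (antidiagonal α) (fun a => a.1 ≤ p.1 ∧ a.2 ≤ p.2)]
    have z : ∑ a ∈ (antidiagonal α).filter (fun a => ¬ (a.1 ≤ p.1 ∧ a.2 ≤ p.2)), ch p.1 a.1 * ch p.2 a.2 = 0 := by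
      refine Finset.sum_eq_zero ?_
      intro a ha
      have := (mem_filter.1 ha).2
      by_cases h : a.1 ≤ p.1
      · rw [ch_not_le (γ := p.2) (fun h' => this ⟨h, h'⟩), mul_zero]
      · rw [ch_not_le h, zero_mul]
    rw [z, add_zero]
    · refine Finset.sum_bij' (fun a _ => (a, (p.1 - a.1, p.2 - a.2))) (fun x _ => x.1) ?_ ?_ ?_ ?_ ?_
      · intro a ha
        obtain ⟨h1, h2, h3⟩ := mem_filter.1 ha
        rw [HasAntidiagonal.mem_antidiagonal] at h1
        have e2 := add_tsub_cancel_of_le h2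
        have e3 := add_tsub_cancel_of_le h3
        rw [mem_filter, mem_product]
        refine ⟨⟨HasAntidiagonal.mem_antidiagonal.2 h1, HasAntidiagonal.mem_antidiagonal.2 ?_⟩, ?_⟩
        · have : α + (p.1 - a.1 + (p.2 - a.2)) = α + β := by
            rw [← hp, ← h1]; nth_rw 2 [← e2, ← e3]; exact add_add_add_comm _ _ _ _
          exact add_left_cancel this
        · simp only [e2, e3]
      · intro x hx
        obtain ⟨h1, h2⟩ := mem_filter.1 hx
        rw [← h2, mem_filter]
        exact ⟨(mem_product.1 h1).1, le_self_add, le_self_add⟩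
      · intro a ha; rfl
      · intro x hx
        obtain ⟨h1, h2⟩ := mem_filter.1 hx
        rw [← h2]; simp
      · intro a ha; rfl
  · intro x hx
    obtain ⟨h1, h2⟩ := mem_product.1 hx
    rw [HasAntidiagonal.mem_antidiagonal] at h1 h2 ⊢
    rw [← h1, ← h2]; exact add_add_add_comm _ _ _ _
end Comb
end HL
end

section
namespace HL
section HSsec
open Finset

/-- A commutative ring with Hasse–Schmidt derivations along coordinates `x i`. -/
structure HSR (n : ℕ) (C : Type) [CommRing C] where
  x : Fin n → C
  d : (Fin n →₀ ℕ) → C →+ C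
  d_zero : ∀ c, d 0 c = c
  d_one : ∀ α, α ≠ 0 → d α 1 = 0
  d_mul : ∀ α b c, d α (b * c) = ∑ p ∈ antidiagonal α, d p.1 b * d p.2 c
  d_d : ∀ α β c, d α (d β c) = ch (α+β) α • d (α+β) c
  d_x : ∀ i, d (Finsupp.single i 1) (x i) = 1
  d_x' : ∀ i α, α ≠ 0 → α ≠ Finsupp.single i 1 → d α (x i) = 0

variable {n : ℕ} {C : Type} [CommRing C] (h : HSR n C)

/-- A module with compatible Hasse–Schmidt operators. -/
structure HS (N : Type) [AddCommGroup N] [Module C N] where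
  D : (Fin n →₀ ℕ) → N →+ N
  D_zero : ∀ v, D 0 v = v
  D_smul : ∀ α (c : C) v, D α (c • v) = ∑ p ∈ antidiagonal α, h.d p.1 c • D p.2 v
  D_D : ∀ α β v, D α (D β v) = ch (α+β) α • D (α+β) v

/-- Twisted module of power series. -/
def TT (h : HSR n C) (N : Type) : Type := (Fin n →₀ ℕ) → N

variable (N : Type) [AddCommGroup N] [Module C N] {N' : Type} [AddCommGroup N'] [Module C N']

noncomputable instance : AddCommGroup (TT h N) := inferInstanceAs (AddCommGroup ((Fin n →₀ ℕ) → N))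

noncomputable instance : SMul C (TT h N) := ⟨fun c u α => ∑ p ∈ antidiagonal α, h.d p.1 c • u p.2⟩

lemma TT.smul_apply (c : C) (u : TT h N) (α) : (c • u) α = ∑ p ∈ antidiagonal α, h.d p.1 c • u p.2 := rfl
lemma TT.add_apply (u v : TT h N) (α) : (u + v) α = u α + v α := rfl
lemma TT.zero_apply (α) : (0 : TT h N) α = 0 := rfl

lemma anti_split {M : Type} [AddCommMonoid M] (α : Fin n →₀ ℕ) (F : (Fin n →₀ ℕ) × (Fin n →₀ ℕ) → M) :
    ∑ p ∈ antidiagonal α, F p = F (0, α) + ∑ p ∈ (antidiagonal α).erase (0, α), F p := by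
  rw [Finset.add_sum_erase _ _ (by simp [HasAntidiagonal.mem_antidiagonal])]

lemma anti_erase {α : Fin n →₀ ℕ} {p : (Fin n →₀ ℕ) × (Fin n →₀ ℕ)} (hp : p ∈ (antidiagonal α).erase (0, α)) :
    p.1 ≠ 0 ∧ p.2 < α := by
  obtain ⟨h1, h2⟩ := Finset.mem_erase.1 hp
  rw [HasAntidiagonal.mem_antidiagonal] at h2
  have h3 : p.1 ≠ 0 := fun h => h1 (by rw [h, zero_add] at h2; exact Prod.ext h h2)
  refine ⟨h3, lt_of_le_of_ne (by rw [← h2]; exact le_add_self) fun h => h3 ?_⟩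
  rw [h] at h2
  simpa using h2

noncomputable instance : Module C (TT h N) where
  one_smul u := by
    funext α
    rw [TT.smul_apply, anti_split, Finset.sum_eq_zero, add_zero, h.d_zero, one_smul]
    intro p hp
    rw [h.d_one _ (anti_erase hp).1, zero_smul]
  mul_smul a b u := by
    funext α
    rw [TT.smul_apply, TT.smul_apply]
    simp only [TT.smul_apply, h.d_mul, Finset.sum_smul, Finset.smul_sum, mul_smul]
    rw [Finset.sum_sigma', Finset.sum_sigma']
    refine Finset.sum_bij' (fun x _ => ⟨(x.2.1, x.2.2 + x.1.2), (x.2.2, x.1.2)⟩)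
      (fun x _ => ⟨(x.1.1 + x.2.1, x.2.2), (x.1.1, x.2.1)⟩) ?_ ?_ ?_ ?_ ?_
    · rintro ⟨⟨a1, a2⟩, ⟨b1, b2⟩⟩ hx
      simp only [mem_sigma, HasAntidiagonal.mem_antidiagonal] at hx ⊢
      obtain ⟨rfl, rfl⟩ := hx
      exact ⟨(add_assoc _ _ _).symm, trivial⟩
    · rintro ⟨⟨a1, a2⟩, ⟨b1, b2⟩⟩ hx
      simp only [mem_sigma, HasAntidiagonal.mem_antidiagonal] at hx ⊢
      obtain ⟨rfl, rfl⟩ := hx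
      exact ⟨add_assoc _ _ _, trivial⟩
    · rintro ⟨⟨a1, a2⟩, ⟨b1, b2⟩⟩ hx
      simp only [mem_sigma, HasAntidiagonal.mem_antidiagonal] at hx ⊢
      obtain ⟨rfl, rfl⟩ := hx
      rfl
    · rintro ⟨⟨a1, a2⟩, ⟨b1, b2⟩⟩ hx
      simp only [mem_sigma, HasAntidiagonal.mem_antidiagonal] at hx ⊢
      obtain ⟨rfl, rfl⟩ := hx
      rfl
    · rintro ⟨⟨a1, a2⟩, ⟨b1, b2⟩⟩ hx
      rfl
  smul_zero c := by
    funext α; rw [TT.smul_apply]; simp only [TT.zero_apply, smul_zero, Finset.sum_const_zero]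
  smul_add c u v := by
    funext α; simp only [TT.smul_apply, TT.add_apply, smul_add, Finset.sum_add_distrib]
  add_smul c c' u := by
    funext α; simp only [TT.smul_apply, TT.add_apply, map_add, add_smul, Finset.sum_add_distrib]
  zero_smul u := by
    funext α; simp only [TT.smul_apply, TT.zero_apply, map_zero, zero_smul, Finset.sum_const_zero]

variable {N}
variable {h} in
/-- Taylor map. -/
noncomputable def HS.T (H : HS h N) : N →ₗ[C] TT h N where
  toFun v α := H.D α v
  map_add' u v := by funext α; exact map_add _ _ _
  map_smul' c v := by funext α; exact H.D_smul α c v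

noncomputable def TT.map (g : N →ₗ[C] N') : TT h N →ₗ[C] TT h N' where
  toFun u α := g (u α)
  map_add' u v := by funext α; exact map_add _ _ _
  map_smul' c v := by
    funext α
    change g ((c • v) α) = ∑ p ∈ antidiagonal α, h.d p.1 c • g (v p.2)
    rw [TT.smul_apply, map_sum]; simp only [map_smul]

variable (N) in
noncomputable def TT.ev : TT h N →ₗ[C] N where
  toFun u := u 0
  map_add' u v := rfl
  map_smul' c u := by
    rw [TT.smul_apply]; simp [h.d_zero]

lemma TT.sm (m k : ℕ) (c : C) (w : N) : (m*k) • (c • w) = (m • c) • (k • w) := by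
  simp only [← Nat.cast_smul_eq_nsmul C, smul_smul, smul_eq_mul]
  congr 1; push_cast; ring

variable (N) in
lemma TT.smul2_apply (c : C) (u : TT h (TT h N)) (α β) : (c • u) α β =
    ∑ a ∈ antidiagonal α, ∑ b ∈ antidiagonal β, h.d b.1 (h.d a.1 c) • u a.2 b.2 := by
  have := TT.smul_apply h (TT h N) c u α
  rw [this]
  exact Finset.sum_apply β _ _

variable (N) in
noncomputable def TT.del : TT h N →ₗ[C] TT h (TT h N) where
  toFun u α β := ch (α+β) β • u (α+β)
  map_add' u v := by funext α β; exact smul_add _ _ _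
  map_smul' c u := by
    funext α β
    refine Eq.trans ?_ (TT.smul2_apply h N c (fun α β => ch (α+β) β • u (α+β)) α β).symm
    simp only [TT.smul_apply]
    have hh : ∀ γ δ : Fin n →₀ ℕ, γ + δ = δ + γ := fun γ δ => add_comm _ _
    rw [hh α β, ← vsum β α (fun p => h.d p.1 c • u p.2), Finset.sum_comm]
    refine Finset.sum_congr rfl fun a ha => ?_
    refine Finset.sum_congr rfl fun b hb => ?_
    rw [h.d_d, hh a.2 b.2]
    exact TT.sm _ _ _ _

lemma TT.smul_inj {a : C} (ha : Function.Bijective (fun v : N => a • v)) (u : TT h N) (hu : a • u = 0) : u = 0 := by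
  funext α
  induction α using WellFoundedLT.induction with
  | ind α ih =>
    have := congrFun hu α
    rw [TT.smul_apply, anti_split, h.d_zero, Finset.sum_eq_zero, add_zero] at this
    · exact ha.1 (by simpa [TT.zero_apply] using this)
    · intro p hp; rw [ih _ (anti_erase hp).2]; exact smul_zero _

noncomputable def TT.solve (a : C) (g : N → N) (w : TT h N) : TT h N :=
  (wellFounded_lt (α := Fin n →₀ ℕ)).fix fun α r => g (w α - ∑ p ∈ ((antidiagonal α).erase (0, α)).attach,
    h.d p.1.1 a • r p.1.2 (anti_erase p.2).2)

lemma TT.smul_surj {a : C} (ha : Function.Bijective (fun v : N => a • v)) (w : TT h N) : ∃ u : TT h N, a • u = w := by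
  obtain ⟨g, hg⟩ := ha.2.hasRightInverse
  refine ⟨TT.solve h a g w, ?_⟩
  funext α
  rw [TT.smul_apply, anti_split, h.d_zero]
  have : TT.solve h a g w α = g (w α - ∑ p ∈ (antidiagonal α).erase (0, α), h.d p.1 a • TT.solve h a g w p.2) := by
    rw [TT.solve, WellFounded.fix_eq]
    congr 2
    exact Finset.sum_attach ((antidiagonal α).erase (0, α)) (fun p => h.d p.1 a • TT.solve h a g w p.2)
  change a • TT.solve h a g w α + _ = _
  rw [this]
  have h2 := hg (w α - ∑ p ∈ (antidiagonal α).erase (0, α), h.d p.1 a • TT.solve h a g w p.2)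
  simp only at h2
  rw [h2]
  exact sub_add_cancel _ _

lemma TT.bij {a : C} (ha : Function.Bijective (fun v : N => a • v)) : Function.Bijective (fun v : TT h N => a • v) := by
  refine ⟨fun u v huv => ?_, TT.smul_surj h ha⟩
  rw [← sub_eq_zero]; apply TT.smul_inj h ha; rw [smul_sub]; exact sub_eq_zero.2 huv

variable {h}
/-- Build an HS structure from a linear Taylor map. -/
noncomputable def HS.ofT (T : N →ₗ[C] TT h N) (h0 : ∀ v, T v 0 = v)
    (h1 : ∀ v, TT.map h T (T v) = TT.del h N (T v)) : HS h N where
  D α := { toFun := fun v => T v α, map_zero' := by rw [map_zero]; rfl, map_add' := fun u v => by rw [map_add]; rfl }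
  D_zero := h0
  D_smul α c v := by
    change T (c • v) α = _
    rw [map_smul, TT.smul_apply]; rfl
  D_D α β v := by
    have := congrFun (congrFun (h1 v) β) α
    change T (T v β) α = ch (β + α) α • T v (β + α) at this
    rw [add_comm β α] at this
    exact this

lemma HS.TD (H : HS h N) (v : N) : TT.map h H.T (H.T v) = TT.del h N (H.T v) := by
  funext β α
  change H.D α (H.D β v) = ch (β + α) α • H.D (β+α) v
  rw [H.D_D, add_comm α β]

lemma isUnit_of_bij {a : C} (ha : Function.Bijective (fun v : N => a • v)) (x : Submonoid.powers a) :
    IsUnit (algebraMap C (Module.End C N) x) := by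
  obtain ⟨_, k, rfl⟩ := x
  rw [map_pow]
  apply IsUnit.pow
  rw [Module.End.isUnit_iff]
  exact ha

lemma loc_bij (a : C) (N : Type) [AddCommGroup N] [Module C N] : Function.Bijective (fun v : Loc a N => a • v) := by
  have := smul_loc_bij a N 1
  simp only [pow_one] at this
  exact this

noncomputable def HS.locT (H : HS h N) (a : C) : Loc a N →ₗ[C] TT h (Loc a N) :=
  LocalizedModule.lift (Submonoid.powers a) (TT.map h (toLoc a N) ∘ₗ H.T) (isUnit_of_bij (TT.bij h (loc_bij a N)))

lemma HS.locT_to (H : HS h N) (a : C) (v : N) : H.locT a (toLoc a N v) = TT.map h (toLoc a N) (H.T v) :=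
  LinearMap.congr_fun (LocalizedModule.lift_comp (Submonoid.powers a) (TT.map h (toLoc a N) ∘ₗ H.T) (isUnit_of_bij (TT.bij h (loc_bij a N)))) v

lemma loc_ext {a : C} (ha : Function.Bijective (fun v : N' => a • v)) {f g : Loc a N →ₗ[C] N'}
    (hfg : ∀ v, f (toLoc a N v) = g (toLoc a N v)) : f = g := by
  ext x
  obtain ⟨j, v, rfl⟩ := fr_surj a x
  have hb : ∀ (k : ℕ) (w : N'), a^k • w = 0 → w = 0 := fun k => by
    induction k with
    | zero => intro w hw; simpa using hw
    | succ k ih => intro w hw; rw [pow_succ', mul_smul] at hw; exact ih _ (ha.1 (by simpa using hw))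
  rw [← sub_eq_zero]
  apply hb j
  have e : a^j • fr a j v = toLoc a N v := by rw [← fr_zero]; exact fr_add a j 0 v
  rw [smul_sub, ← map_smul f, ← map_smul g, e, hfg, sub_self]

noncomputable def HS.loc (H : HS h N) (a : C) : HS h (Loc a N) := HS.ofT (H.locT a)
  (fun v => by
    have : TT.ev h (Loc a N) ∘ₗ H.locT a = LinearMap.id := by
      apply loc_ext (loc_bij a N)
      intro v
      rw [LinearMap.comp_apply, HS.locT_to]
      exact congrArg (toLoc a N) (H.D_zero v)
    exact LinearMap.congr_fun this v)
  (fun v => by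
    have : TT.map h (H.locT a) ∘ₗ H.locT a = TT.del h (Loc a N) ∘ₗ H.locT a := by
      apply loc_ext (TT.bij h (TT.bij h (loc_bij a N)))
      intro v
      rw [LinearMap.comp_apply, LinearMap.comp_apply, HS.locT_to]
      have e1 : TT.map h (H.locT a) (TT.map h (toLoc a N) (H.T v)) =
          TT.map h (TT.map h (toLoc a N)) (TT.map h H.T (H.T v)) := by
        funext α; exact HS.locT_to H a _
      have e2 : TT.del h (Loc a N) (TT.map h (toLoc a N) (H.T v)) =
          TT.map h (TT.map h (toLoc a N)) (TT.del h N (H.T v)) := by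
        funext α β; exact (map_nsmul (toLoc a N) _ _).symm
      rw [e1, e2, HS.TD]
    exact LinearMap.congr_fun this v)

lemma HS.loc_to (H : HS h N) (a : C) (α) (v : N) : (H.loc a).D α (toLoc a N v) = toLoc a N (H.D α v) :=
  congrFun (HS.locT_to H a v) α

noncomputable def HS.quot (H : HS h N) (K : Submodule C N) (hK : ∀ α, ∀ v ∈ K, H.D α v ∈ K) : HS h (N ⧸ K) where
  D α := QuotientAddGroup.map K.toAddSubgroup K.toAddSubgroup (H.D α) (hK α)
  D_zero v := by
    obtain ⟨v, rfl⟩ := K.mkQ_surjective v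
    exact congrArg K.mkQ (H.D_zero v)
  D_smul α c v := by
    obtain ⟨v, rfl⟩ := K.mkQ_surjective v
    have := congrArg K.mkQ (H.D_smul α c v)
    rw [map_sum] at this
    simp only [map_smul] at this
    exact this
  D_D α β v := by
    obtain ⟨v, rfl⟩ := K.mkQ_surjective v
    have := congrArg K.mkQ (H.D_D α β v)
    rw [map_nsmul] at this
    exact this

lemma HS.quot_mk (H : HS h N) (K : Submodule C N) (hK : ∀ α, ∀ v ∈ K, H.D α v ∈ K) (α) (v : N) :
    (H.quot K hK).D α (K.mkQ v) = K.mkQ (H.D α v) := rfl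

noncomputable def HS.sub (H : HS h N) (K : Submodule C N) (hK : ∀ α, ∀ v ∈ K, H.D α v ∈ K) : HS h K where
  D α := { toFun := fun v => ⟨H.D α v, hK α v v.2⟩, map_zero' := Subtype.ext (map_zero _),
           map_add' := fun u v => Subtype.ext (map_add _ _ _) }
  D_zero v := Subtype.ext (H.D_zero v)
  D_smul α c v := Subtype.ext (by
    simp only [AddMonoidHom.coe_mk, ZeroHom.coe_mk, Submodule.coe_smul, AddSubmonoidClass.coe_finset_sum]
    exact H.D_smul α c v)
  D_D α β v := Subtype.ext (H.D_D α β v)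

lemma HS.sub_coe (H : HS h N) (K : Submodule C N) (hK : ∀ α, ∀ v ∈ K, H.D α v ∈ K) (α) (v : K) :
    ((H.sub K hK).D α v : N) = H.D α v := rfl

variable (h) in
noncomputable def HS.self : HS h C where
  D := h.d
  D_zero := h.d_zero
  D_smul := h.d_mul
  D_D := h.d_d

noncomputable def HS.H1 (H : HS h N) (a : C) : HS h (H1 a N) :=
  (H.loc a).quot (LinearMap.range (toLoc a N)) (by
    rintro α _ ⟨v, rfl⟩
    exact ⟨H.D α v, (H.loc_to a α v).symm⟩)

lemma HS.H1_q (H : HS h N) (a : C) (α) (v : Loc a N) : (H.H1 a).D α (qH1 a N v) = qH1 a N ((H.loc a).D α v) := rfl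

noncomputable def HS.HL {M : ModuleCat.{0} C} (H : HS h M) : (l : List C) → HS h (HL l M)
  | [] => H
  | a :: l => HS.H1 (HS.HL H l) a


lemma HSR.d_pow (I : Ideal C) (N : ℕ) : ∀ (α : Fin n →₀ ℕ), ∀ r ∈ I^N, h.d α r ∈ I^(N - α.degree) := by
  induction N with
  | zero => intro α r hr; simp
  | succ N ih =>
    intro α r hr
    rw [pow_succ'] at hr
    induction hr using Submodule.mul_induction_on' with
    | mem_mul_mem a ha b hb =>
      rw [h.d_mul]
      refine Ideal.sum_mem _ fun p hp => ?_
      rw [HasAntidiagonal.mem_antidiagonal] at hp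
      have hdeg : p.1.degree + p.2.degree = α.degree := by rw [← hp, map_add]
      by_cases h0 : p.1 = 0
      · rw [h0, h.d_zero]
        have h1 := Ideal.mul_mem_mul ha (ih p.2 b hb)
        rw [← pow_succ'] at h1
        refine Ideal.pow_le_pow_right ?_ h1
        rw [h0] at hdeg; simp at hdeg; omega
      · refine Ideal.mul_mem_left _ _ (Ideal.pow_le_pow_right ?_ (ih p.2 b hb))
        have : p.1.degree ≠ 0 := fun h => h0 ((Finsupp.degree_eq_zero_iff _).1 h)
        omega
    | add a ha b hb h1 h2 => rw [map_add]; exact Ideal.add_mem _ h1 h2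

/-- Torsion submodules are stable. -/
lemma HS.pow_D (H : HS h N) (I : Ideal C) (k : ℕ) (v : N) (hv : ∀ r ∈ I^k, r • v = 0) (α : Fin n →₀ ℕ) :
    ∀ m, α.degree ≤ m → ∀ r ∈ I^(k+m), r • H.D α v = 0 := by
  induction α using WellFoundedLT.induction with
  | ind α ih =>
    intro m hm r hr
    have := H.D_smul α r v
    rw [hv r (Ideal.pow_le_pow_right (by omega) hr), map_zero, anti_split, h.d_zero, Finset.sum_eq_zero, add_zero] at this
    · exact this.symm
    · intro p hp
      obtain ⟨h1, h2⟩ := anti_erase hp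
      have hp2 := HasAntidiagonal.mem_antidiagonal.1 (Finset.mem_of_mem_erase hp)
      have hdeg : p.1.degree + p.2.degree = α.degree := by rw [← hp2, map_add]
      refine ih p.2 h2 (m - p.1.degree) (by omega) _ ?_
      have := HSR.d_pow (h := h) I (k+m) p.1 r hr
      refine Ideal.pow_le_pow_right ?_ this
      omega

end HSsec
end HL
end

section
namespace HL
section Kos
variable {S : Type} [CommRing S] [IsNoetherianRing S] {N : Type} [AddCommGroup N] [Module S N]

/-- successive surjectivity -/
def SRJ (N : Type) [AddCommGroup N] [Module S N] : List S → Prop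
  | [] => True
  | b :: l => (∀ v : N, (∀ c ∈ l, c • v = 0) → ∃ w : N, (∀ c ∈ l, c • w = 0) ∧ b • w = v) ∧ SRJ N l

lemma pI_le_of {l : List S} {J : Ideal S} (h : ∀ b ∈ l, b ∈ J) : pI 1 l ≤ J := by
  rw [pI, Ideal.span_le]; rintro r ⟨b, hb, rfl⟩; rw [pow_one]; exact h b hb

lemma mem_pI1 {l : List S} {b : S} (h : b ∈ l) : b ∈ pI 1 l := by simpa using mem_pI (k := 1) h

lemma pI_cons (b : S) (l : List S) : pI 1 (b :: l) = Ideal.span {b} ⊔ pI 1 l := by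
  apply le_antisymm
  · apply pI_le_of
    intro c hc
    rcases List.mem_cons.1 hc with rfl | hc
    · exact Ideal.mem_sup_left (Ideal.mem_span_singleton_self _)
    · exact Ideal.mem_sup_right (mem_pI1 hc)
  · rw [sup_le_iff, Ideal.span_singleton_le_iff_mem]
    exact ⟨mem_pI1 List.mem_cons_self, pI_le_of fun c hc => mem_pI1 (List.mem_cons_of_mem _ hc)⟩

lemma NZD_pI {b : S} {l : List S} (h : NZL (b :: l) (ModuleCat.of S S)) : NZD b (S ⧸ pI 1 l) := by
  intro v hv
  obtain ⟨v, rfl⟩ := Ideal.Quotient.mk_surjective v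
  have hv' : b * v ∈ pI 1 l := Ideal.Quotient.eq_zero_iff_mem.1 hv
  apply Ideal.Quotient.eq_zero_iff_mem.2
  rw [← eps_ker 1 l h.2] at hv' ⊢
  apply h.1
  rw [← map_smul]; exact hv'

lemma SES_pI {b : S} {l : List S} (h : NZL (b :: l) (ModuleCat.of S S)) :
    ∃ g : (S ⧸ pI 1 l) →ₗ[S] (S ⧸ pI 1 (b :: l)), SES (b • LinearMap.id : (S ⧸ pI 1 l) →ₗ[S] _) g := by
  have hle : pI 1 l ≤ pI 1 (b :: l) := by rw [pI_cons]; exact le_sup_right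
  refine ⟨Submodule.mapQ (pI 1 l) (pI 1 (b::l)) LinearMap.id hle, ?_, ?_, ?_⟩
  · rw [injective_iff_map_eq_zero]; exact NZD_pI h
  · intro x
    obtain ⟨x, rfl⟩ := Ideal.Quotient.mk_surjective x
    have e : (Submodule.mapQ (pI 1 l) (pI 1 (b::l)) LinearMap.id hle) (Ideal.Quotient.mk _ x) = Ideal.Quotient.mk _ x := rfl
    rw [e, Ideal.Quotient.eq_zero_iff_mem, pI_cons, Ideal.mem_span_singleton_sup]
    constructor
    · rintro ⟨a, c, hc, rfl⟩
      refine ⟨Ideal.Quotient.mk _ a, ?_⟩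
      change Ideal.Quotient.mk (pI 1 l) (b * a) = _
      rw [Ideal.Quotient.eq, mul_comm b a, sub_add_cancel_left]
      exact neg_mem hc
    · rintro ⟨y, hy⟩
      obtain ⟨a, rfl⟩ := Ideal.Quotient.mk_surjective y
      change Ideal.Quotient.mk (pI 1 l) (b * a) = _ at hy
      rw [eq_comm, Ideal.Quotient.eq] at hy
      exact ⟨a, _, hy, by ring⟩
  · intro x
    obtain ⟨x, rfl⟩ := Ideal.Quotient.mk_surjective x
    exact ⟨Ideal.Quotient.mk _ x, rfl⟩

/-- Koszul vanishing. -/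
theorem kos (l : List S) (h : NZL l (ModuleCat.of S S)) (hs : SRJ N l) :
    ∀ i (e : EE S (S ⧸ pI 1 l) N (i+1)), e = 0 := by
  induction l with
  | nil =>
    intro i e
    have hb : pI 1 ([] : List S) = ⊥ := le_bot_iff.1 (pI_le_of (by simp))
    have : Module.Projective S (S ⧸ pI 1 ([] : List S)) := by
      rw [hb]
      exact Module.Projective.of_equiv (Submodule.quotEquivOfEqBot (⊥ : Ideal S) rfl).symm
    exact EE.proj i e
  | cons b l ih =>
    intro i e
    obtain ⟨g, hg⟩ := SES_pI h
    have h1 : EE.pre g (i+1) e = 0 := ih h.2 hs.2 i _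
    obtain ⟨e', rfl⟩ := (EE.exL3 hg i e).1 h1
    apply (EE.exL1 hg i e').2
    cases i with
    | succ i => exact ⟨0, by rw [map_zero, ih h.2 hs.2 i e']⟩
    | zero =>
      obtain ⟨φ, rfl⟩ := EE.hom0.symm.surjective e'
      obtain ⟨w, hw, hbw⟩ := hs.1 (φ (Ideal.Quotient.mk _ 1)) (by
        intro c hc
        rw [← map_smul, smul_quot_zero (mem_pI1 hc), map_zero])
      refine ⟨EE.hom0.symm (Submodule.liftQ (pI 1 l) (LinearMap.toSpanSingleton S N w) ?_), ?_⟩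
      · intro r hr
        exact pI_smul (k := 1) (by simpa using hw) hr
      · apply EE.hom0.injective
        rw [EE.hom0_pre, LinearEquiv.apply_symm_apply, LinearEquiv.apply_symm_apply]
        ext
        simp only [LinearMap.comp_apply, LinearMap.smul_apply, LinearMap.id_apply, map_smul]
        refine Eq.trans ?_ hbw
        congr 1
        exact one_smul _ _
end Kos

section HSx
open Finset
variable {n : ℕ} {C : Type} [CommRing C] {h : HSR n C} {N : Type} [AddCommGroup N] [Module C N] (H : HS h N)

lemma HS.D_x (α : Fin n →₀ ℕ) (i : Fin n) (v : N) (hα : α i ≠ 0) :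
    H.D α (h.x i • v) = h.x i • H.D α v + H.D (α - Finsupp.single i 1) v := by
  have hle : Finsupp.single i 1 ≤ α := by rw [Finsupp.single_le_iff]; omega
  rw [H.D_smul, anti_split, h.d_zero]
  congr 1
  rw [Finset.sum_eq_single (Finsupp.single i 1, α - Finsupp.single i 1)]
  · rw [h.d_x, one_smul]
  · intro p hp hne
    rw [h.d_x' _ _ (anti_erase hp).1, zero_smul]
    intro e
    apply hne
    have hp2 := HasAntidiagonal.mem_antidiagonal.1 (Finset.mem_of_mem_erase hp)
    refine Prod.ext e ?_
    rw [← hp2, e, add_tsub_cancel_left]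
  · intro hn
    exfalso; apply hn
    rw [mem_erase, HasAntidiagonal.mem_antidiagonal]
    refine ⟨fun e => ?_, add_tsub_cancel_of_le hle⟩
    have := (Prod.ext_iff.1 e).1
    simp at this

lemma HS.D_x' (α : Fin n →₀ ℕ) (i : Fin n) (v : N) (hα : α i = 0) :
    H.D α (h.x i • v) = h.x i • H.D α v := by
  rw [H.D_smul, anti_split, h.d_zero, Finset.sum_eq_zero, add_zero]
  intro p hp
  rw [h.d_x' _ _ (anti_erase hp).1, zero_smul]
  intro e
  have hp2 := HasAntidiagonal.mem_antidiagonal.1 (Finset.mem_of_mem_erase hp)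
  rw [← hp2, e] at hα
  simp at hα

lemma HS.x_surj (i : Fin n) (l : List (Fin n)) (hi : i ∉ l) (m : ℕ) (v : N) (hv : ∀ j ∈ l, h.x j • v = 0) :
    ∃ w, (∀ j ∈ l, h.x j • w = 0) ∧ H.D (Finsupp.single i m) (h.x i ^ m • v) = v + h.x i • w := by
  induction m with
  | zero => exact ⟨0, by simp, by simp [H.D_zero]⟩
  | succ m ih =>
    obtain ⟨w, hw, e⟩ := ih
    refine ⟨H.D (Finsupp.single i (m+1)) (h.x i ^ m • v) + w, ?_, ?_⟩
    · intro j hj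
      have hne : i ≠ j := fun e => hi (e ▸ hj)
      rw [smul_add, hw j hj, ← H.D_x' _ _ _ (by simp [hne]), smul_comm, hv j hj, smul_zero, map_zero, add_zero]
    · rw [pow_succ', mul_smul, H.D_x _ _ _ (by simp), ← Finsupp.single_tsub, Nat.add_sub_cancel, e, smul_add]
      abel

lemma HS.SRJ (H : HS h N) {S : Type} [CommRing S] [IsNoetherianRing S] [Algebra S C] [Module S N] [IsScalarTower S C N] (y : Fin n → S)
    (hy : ∀ i, algebraMap S C (y i) = h.x i) (l : List (Fin n)) (hl : l.Nodup)
    (ht : ∀ i (v : N), ∃ m, h.x i ^ m • v = 0) : SRJ N (l.map y) := by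
  have hh : ∀ i (v : N), y i • v = h.x i • v := fun i v => by rw [← hy, algebraMap_smul]
  induction l with
  | nil => trivial
  | cons i l ih =>
    rw [List.nodup_cons] at hl
    refine ⟨?_, ih hl.2⟩
    intro v hv
    obtain ⟨m, hm⟩ := ht i v
    obtain ⟨w, hw, e⟩ := H.x_surj i l hl.1 m v (by
      intro j hj; rw [← hh]; exact hv _ (List.mem_map_of_mem hj))
    rw [hm, map_zero] at e
    refine ⟨-w, ?_, ?_⟩
    · intro c hc
      obtain ⟨j, hj, rfl⟩ := List.mem_map.1 hc
      rw [smul_neg, hh, hw j hj, neg_zero]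
    · rw [smul_neg, hh]; exact (eq_neg_of_add_eq_zero_left e.symm).symm
end HSx

section RS
variable (S C : Type) [CommRing S] [CommRing C] [Algebra S C]

/-- Restriction of scalars (type synonym). -/
def Rs (S C : Type) [CommRing S] [CommRing C] [Algebra S C] (N : Type) : Type := N
variable (N : Type) [AddCommGroup N] [Module C N] {N' : Type} [AddCommGroup N'] [Module C N']
noncomputable instance : AddCommGroup (Rs S C N) := inferInstanceAs (AddCommGroup N)
noncomputable instance : Module C (Rs S C N) := inferInstanceAs (Module C N)
noncomputable instance : Module S (Rs S C N) := Module.compHom N (algebraMap S C)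
instance : IsScalarTower S C (Rs S C N) := ⟨fun s c v => by
  rw [Algebra.smul_def]; exact mul_smul (algebraMap S C s) c (show N from v)⟩

variable {N}
/-- Restriction of scalars of maps. -/
noncomputable def Rs.map (f : N →ₗ[C] N') : Rs S C N →ₗ[S] Rs S C N' where
  toFun v := f v
  map_add' u v := map_add f u v
  map_smul' s v := map_smul f (algebraMap S C s) v

lemma Rs.smul (s : S) (v : Rs S C N) : s • v = algebraMap S C s • v := rfl

variable {S C}
lemma SES.rs {N'' : Type} [AddCommGroup N''] [Module C N''] {f : N →ₗ[C] N'} {g : N' →ₗ[C] N''} (h : SES f g) :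
    SES (Rs.map S C f) (Rs.map S C g) := ⟨h.inj, h.ex, h.surj⟩

end RS

section ExtHS
variable {S : Type} [CommRing S] [IsNoetherianRing S] {n : ℕ} {C : Type} [CommRing C] [Algebra S C] {h : HSR n C}

theorem ext_tors (y : Fin n → S) (hy : ∀ i, algebraMap S C (y i) = h.x i) (L : List (Fin n)) (hL : L.Nodup)
    (hnz : NZL (L.map y) (ModuleCat.of S S)) (N : Type) [AddCommGroup N] [Module C N] (H : HS h N) (ht : ∀ i (v : N), ∃ m, h.x i ^ m • v = 0)
    (i : ℕ) (e : EE S (S ⧸ pI 1 (L.map y)) (Rs S C N) (i+1)) : e = 0 :=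
  kos _ hnz (HS.SRJ (N := Rs S C N) (h := h) ⟨H.D, H.D_zero, H.D_smul, H.D_D⟩ y hy L hL ht) i e

lemma tors_sup {a : C} {N : Type} [AddCommGroup N] [Module C N] {J : Ideal C} {k j : ℕ} {v : N}
    (hk : ∀ r ∈ J^k, r • v = 0) (hj : a^j • v = 0) : ∀ r ∈ (J ⊔ Ideal.span {a})^(k+j), r • v = 0 := by
  intro r hr
  have := Ideal.sup_pow_add_le_pow_sup_pow (I := J) (J := Ideal.span {a}) (n := k) (m := j) hr
  rw [Ideal.span_singleton_pow] at this
  obtain ⟨p, hp, q, hq, rfl⟩ := Submodule.mem_sup.1 this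
  obtain ⟨c, rfl⟩ := Ideal.mem_span_singleton'.1 hq
  rw [add_smul, hk p hp, mul_smul, hj, smul_zero, add_zero]

lemma H1_torsion {a : C} {N : Type} [AddCommGroup N] [Module C N] {J : Ideal C}
    (hJ : ∀ v : N, ∃ k, ∀ r ∈ J^k, r • v = 0) (v : H1 a N) : ∃ k, ∀ r ∈ (J ⊔ Ideal.span {a})^k, r • v = 0 := by
  obtain ⟨j, v, rfl⟩ := ej_surj a v
  obtain ⟨k, hk⟩ := hJ v
  exact ⟨k + j, tors_sup (fun r hr => by rw [← map_smul, hk r hr, map_zero]) (pow_smul_ej _ _ _)⟩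

theorem extHS (y : Fin n → S) (hy : ∀ i, algebraMap S C (y i) = h.x i) (L : List (Fin n)) (hL : L.Nodup)
    (hnz : NZL (L.map y) (ModuleCat.of S S)) (ys : List S) (hys : ∀ b ∈ ys, b ∈ pI 1 (L.map y)) :
    ∀ (N : ModuleCat.{0} C) (H : HS h N) (J : Ideal C) (hJ : ∀ v : N, ∃ k, ∀ r ∈ J^k, r • v = 0)
      (hx : ∀ i, ∃ m, h.x i ^ m ∈ J ⊔ pI 1 (ys.map (algebraMap S C))),
    (∀ i (e : EE S (S ⧸ pI 1 (L.map y)) (Rs S C N) (i + 1 + ys.length)), e = 0) ∧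
    Nonempty (EE S (S ⧸ pI 1 (L.map y)) (Rs S C N) ys.length ≃ₗ[S]
      EE S (S ⧸ pI 1 (L.map y)) (Rs S C (HL (ys.map (algebraMap S C)) N)) 0) := by
  induction ys using List.reverseRecOn with
  | nil =>
    intro N H J hJ hx
    refine ⟨?_, ⟨LinearEquiv.refl _ _⟩⟩
    refine ext_tors y hy L hL hnz N H ?_
    intro i v
    obtain ⟨k, hk⟩ := hJ v
    obtain ⟨m, hm⟩ := hx i
    rw [List.map_nil, show pI 1 ([] : List C) = ⊥ from le_bot_iff.1 (by rw [pI, Ideal.span_le]; rintro r ⟨b, hb, rfl⟩; simp at hb), sup_bot_eq] at hm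
    exact ⟨m * k, by rw [pow_mul]; exact hk _ (Ideal.pow_mem_pow hm k)⟩
  | append_singleton ys b ih =>
    intro N H J hJ hx
    set a := algebraMap S C b with ha
    have hb : ∀ z : S ⧸ pI 1 (L.map y), b • z = 0 := fun z => smul_quot_zero (hys b (by simp)) z
    have ih := ih (fun c hc => hys c (by simp [hc]))
    have hx' : ∀ i, ∃ m, h.x i ^ m ∈ (J ⊔ Ideal.span {a}) ⊔ pI 1 (ys.map (algebraMap S C)) := by
      intro i
      obtain ⟨m, hm⟩ := hx i
      refine ⟨m, ?_⟩
      have : pI 1 ((ys ++ [b]).map (algebraMap S C)) ≤ Ideal.span {a} ⊔ pI 1 (ys.map (algebraMap S C)) := by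
        rw [pI, Ideal.span_le]
        rintro r ⟨c, hc, rfl⟩
        rw [pow_one]
        rw [List.map_append, List.mem_append] at hc
        rcases hc with hc | hc
        · exact Ideal.mem_sup_right (by simpa using mem_pI (k := 1) hc)
        · rw [List.map_singleton, List.mem_singleton] at hc
          rw [hc]
          exact Ideal.mem_sup_left (Ideal.mem_span_singleton_self _)
      rw [sup_assoc]
      exact sup_le_sup_left this _ hm
    -- the kernel
    let Γ := LinearMap.ker (toLoc a N)
    have hΓ : ∀ α, ∀ v ∈ Γ, H.D α v ∈ Γ := by
      intro α v hv
      rw [LinearMap.mem_ker] at hv ⊢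
      rw [← H.loc_to, hv, map_zero]
    have ihΓ := (ih (ModuleCat.of C Γ) (H.sub Γ hΓ) (J ⊔ Ideal.span {a}) (by
      rintro ⟨v, hv⟩
      obtain ⟨k, hk⟩ := hJ v
      have hv' := hv
      rw [LinearMap.mem_ker, ← fr_zero, fr_eq_zero] at hv'
      obtain ⟨j, hj⟩ := hv'
      refine ⟨k + j, fun r hr => Subtype.ext ?_⟩
      exact tors_sup hk hj r hr) hx').1
    have ihH := ih (ModuleCat.of C (H1 a N)) (H.H1 a) (J ⊔ Ideal.span {a}) (H1_torsion hJ) hx'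
    have s1 : SES Γ.subtype (toLoc a N).rangeRestrict :=
      ⟨Γ.injective_subtype, fun v => by
        rw [← Subtype.coe_inj]
        simp [Γ], LinearMap.surjective_rangeRestrict _⟩
    have s2 : SES (LinearMap.range (toLoc a N)).subtype (qH1 a N) :=
      ⟨Submodule.injective_subtype _, fun v => by rw [qH1_eq_zero]; simp, qH1_surj a⟩
    have r1 := s1.rs (S := S)
    have r2 := s2.rs (S := S)
    have hl : ∀ i (e : EE S (S ⧸ pI 1 (L.map y)) (Rs S C (Loc a N)) i), e = 0 :=
      EE_eq_zero_of_bij b hb (by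
        have := loc_bij a N
        exact this)
    have e1 : ∀ i, Nonempty (EE S (S ⧸ pI 1 (L.map y)) (Rs S C N) (i+1+ys.length) ≃ₗ[S]
       EE S (S ⧸ pI 1 (L.map y)) (Rs S C (LinearMap.range (toLoc a N))) (i+1+ys.length)) := fun i => by
      refine ⟨LinearEquiv.ofBijective (EE.post (Rs.map S C (toLoc a N).rangeRestrict) _) ⟨?_, ?_⟩⟩
      · rw [injective_iff_map_eq_zero]
        intro e he
        obtain ⟨e', rfl⟩ := (EE.exR2 r1 _ e).1 he
        rw [ihΓ i e', map_zero]
      · intro e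
        apply (EE.exR3 r1 _ e).1
        have : ∀ k (hk : k = i + 1 + 1 + ys.length) (z : EE S (S ⧸ pI 1 (L.map y)) (Rs S C Γ) k), z = 0 := by
          rintro k rfl z; exact ihΓ (i+1) z
        exact this _ (by omega) _
    have e2 : ∀ i, Nonempty (EE S (S ⧸ pI 1 (L.map y)) (Rs S C (H1 a N)) i ≃ₗ[S]
       EE S (S ⧸ pI 1 (L.map y)) (Rs S C (LinearMap.range (toLoc a N))) (i+1)) := fun i => by
      refine ⟨LinearEquiv.ofBijective (EE.dR r2 i) ⟨?_, ?_⟩⟩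
      · rw [injective_iff_map_eq_zero]
        intro e he
        obtain ⟨e', rfl⟩ := (EE.exR3 r2 _ e).1 he
        rw [hl _ e', map_zero]
      · intro e
        apply (EE.exR1 r2 _ e).1
        exact hl _ _
    have e3 : ∀ i k, k = i + 1 + ys.length → Nonempty (EE S (S ⧸ pI 1 (L.map y)) (Rs S C N) k ≃ₗ[S]
       EE S (S ⧸ pI 1 (L.map y)) (Rs S C (H1 a N)) (i + ys.length)) := by
      rintro i k rfl
      obtain ⟨a1⟩ := e1 i
      obtain ⟨a2⟩ := e2 (i + ys.length)
      have : i + ys.length + 1 = i + 1 + ys.length := by omega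
      rw [this] at a2
      exact ⟨a1.trans a2.symm⟩
    constructor
    · intro i e
      obtain ⟨a3⟩ := e3 (i+1) (i + 1 + (ys ++ [b]).length) (by rw [List.length_append, List.length_singleton]; omega)
      apply a3.injective
      rw [map_zero]
      exact ihH.1 i (a3 e)
    · obtain ⟨a3⟩ := e3 0 (ys ++ [b]).length (by rw [List.length_append, List.length_singleton]; omega)
      rw [zero_add] at a3
      obtain ⟨a4⟩ := ihH.2
      rw [List.map_append, HL_append]
      exact ⟨a3.trans a4⟩

end ExtHS
end HL
end

section
namespace HL
section Kash
open Finset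
variable {n : ℕ} {C : Type} [CommRing C] {h : HSR n C} {N : Type} [AddCommGroup N] [Module C N] 
  {N' : Type} [AddCommGroup N'] [Module C N']

/-- The socle with respect to the coordinates. -/
def soc (h : HSR n C) (N : Type) [AddCommGroup N] [Module C N] : Submodule C N where
  carrier := {v | ∀ i, h.x i • v = 0}
  add_mem' := fun {u v} hu hv i => by rw [smul_add, hu i, hv i, add_zero]
  zero_mem' := fun i => smul_zero _
  smul_mem' := fun c v hv i => by rw [smul_comm, hv i, smul_zero]

lemma mem_soc {v : N} : v ∈ soc h N ↔ ∀ i, h.x i • v = 0 := Iff.rfl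

/-- torsion -/
def Tors (h : HSR n C) (N : Type) [AddCommGroup N] [Module C N] : Prop := ∀ i (v : N), ∃ m, h.x i ^ m • v = 0

lemma HS.span1 (H : HS h N) (l : List (Fin n)) (i : Fin n) (hi : i ∉ l) (m : ℕ) :
    ∀ v : N, (∀ j ∈ l, h.x j • v = 0) → h.x i ^ m • v = 0 →
    v ∈ AddSubgroup.closure {z | ∃ t u, (∀ j ∈ i :: l, h.x j • u = 0) ∧ z = H.D (Finsupp.single i t) u} := by
  induction m with
  | zero => intro v _ hv; rw [pow_zero, one_smul] at hv; rw [hv]; exact zero_mem _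
  | succ m ih =>
    intro v hl hv
    have h1 := ih (h.x i • v) (fun j hj => by rw [smul_comm, hl j hj, smul_zero]) (by rw [← mul_smul, ← pow_succ, hv])
    have h2 : ∀ z ∈ AddSubgroup.closure {z | ∃ t u, (∀ j ∈ i :: l, h.x j • u = 0) ∧ z = H.D (Finsupp.single i t) u},
      ∃ w ∈ AddSubgroup.closure {z | ∃ t u, (∀ j ∈ i :: l, h.x j • u = 0) ∧ z = H.D (Finsupp.single i t) u}, h.x i • w = z ∧
        ∀ j ∈ l, h.x j • w = 0 := by
      intro z hz
      induction hz using AddSubgroup.closure_induction with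
      | mem z hz =>
        obtain ⟨t, u, hu, rfl⟩ := hz
        refine ⟨- H.D (Finsupp.single i (t+1)) u, neg_mem (AddSubgroup.subset_closure ⟨_, u, hu, rfl⟩), ?_, ?_⟩
        · have := H.D_x (Finsupp.single i (t+1)) i u (by simp)
          rw [hu i (by simp), map_zero, ← Finsupp.single_tsub, Nat.add_sub_cancel] at this
          rw [smul_neg, ← sub_eq_zero, sub_eq_add_neg, ← neg_add, ← this, neg_zero]
        · intro j hj
          have hne : i ≠ j := fun e => hi (e ▸ hj)
          rw [smul_neg, ← H.D_x' _ _ _ (by simp [hne]), hu j (by simp [hj]), map_zero, neg_zero]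
      | zero => exact ⟨0, zero_mem _, by simp, by simp⟩
      | add a b _ _ ha hb =>
        obtain ⟨a', h1, h2, h3⟩ := ha
        obtain ⟨b', h4, h5, h6⟩ := hb
        exact ⟨a' + b', add_mem h1 h4, by rw [smul_add, h2, h5], fun j hj => by rw [smul_add, h3 j hj, h6 j hj, add_zero]⟩
      | neg a _ ha =>
        obtain ⟨a', h1, h2, h3⟩ := ha
        exact ⟨-a', neg_mem h1, by rw [smul_neg, h2], fun j hj => by rw [smul_neg, h3 j hj, neg_zero]⟩
    obtain ⟨w, hw, e, hwl⟩ := h2 _ h1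
    rw [← sub_add_cancel v w]
    refine add_mem (AddSubgroup.subset_closure ⟨0, v - w, ?_, ?_⟩) hw
    · intro j hj
      rcases List.mem_cons.1 hj with rfl | hj
      · rw [smul_sub, e, sub_self]
      · rw [smul_sub, hl j hj, hwl j hj, sub_zero]
    · rw [Finsupp.single_zero, H.D_zero]

lemma HS.span2 (H : HS h N) (ht : Tors h N) (l : List (Fin n)) (hl : l.Nodup) (v : N) :
    v ∈ AddSubgroup.closure {z | ∃ β u, (∀ j ∈ l, h.x j • u = 0) ∧ z = H.D β u} := by
  induction l generalizing v with
  | nil => exact AddSubgroup.subset_closure ⟨0, v, by simp, (H.D_zero v).symm⟩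
  | cons i l ih =>
    rw [List.nodup_cons] at hl
    have := ih hl.2 v
    refine (AddSubgroup.closure_le _).2 ?_ this
    rintro _ ⟨β, u, hu, rfl⟩
    obtain ⟨m, hm⟩ := ht i u
    have h1 := H.span1 l i hl.1 m u hu hm
    have h2 : AddSubgroup.closure {z | ∃ t u, (∀ j ∈ i :: l, h.x j • u = 0) ∧ z = H.D (Finsupp.single i t) u} ≤
        (AddSubgroup.closure {z | ∃ β u, (∀ j ∈ i :: l, h.x j • u = 0) ∧ z = H.D β u}).comap (H.D β) := by
      rw [AddSubgroup.closure_le]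
      rintro _ ⟨t, u, hu, rfl⟩
      rw [SetLike.mem_coe, AddSubgroup.mem_comap, H.D_D]
      refine nsmul_mem ?_ _
      exact AddSubgroup.subset_closure ⟨_, u, hu, rfl⟩
    exact h2 h1

lemma HS.span (H : HS h N) (ht : Tors h N) (v : N) :
    v ∈ AddSubgroup.closure {z | ∃ β u, u ∈ soc h N ∧ z = H.D β u} := by
  have := H.span2 ht (List.finRange n) (List.nodup_finRange n) v
  simpa [mem_soc] using this


/-- `v = Σ D_β u_β`. -/
noncomputable def HS.Phi (H : HS h N) : ((Fin n →₀ ℕ) →₀ soc h N) →+ N :=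
  Finsupp.liftAddHom (fun β => (H.D β).comp (soc h N).subtype.toAddMonoidHom)

lemma HS.Phi_single (H : HS h N) (β) (u : soc h N) : H.Phi (Finsupp.single β u) = H.D β u := by
  simp [HS.Phi]

lemma HS.dual (H : HS h N) (k : ℕ) : ∀ α : Fin n →₀ ℕ, α.degree = k → ∃ c : C, (∀ u ∈ soc h N, c • H.D α u = u) ∧
    ∀ u ∈ soc h N, ∀ β, β.degree ≤ k → β ≠ α → c • H.D β u = 0 := by
  induction k with
  | zero =>
    intro α hα
    rw [Finsupp.degree_eq_zero_iff] at hα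
    subst hα
    refine ⟨1, fun u hu => by rw [one_smul, H.D_zero], fun u hu β hβ hne => ?_⟩
    exfalso
    exact hne ((Finsupp.degree_eq_zero_iff _).1 (by omega))
  | succ k ih =>
    intro α hα
    have : ∃ i, α i ≠ 0 := by
      by_contra hcon
      push Not at hcon
      have : α = 0 := Finsupp.ext hcon
      rw [this] at hα; simp at hα
    obtain ⟨i, hi⟩ := this
    have key : ∀ β : Fin n →₀ ℕ, β i ≠ 0 → β = (β - Finsupp.single i 1) + Finsupp.single i 1 := fun β hβ =>
      (tsub_add_cancel_of_le (by rw [Finsupp.single_le_iff]; omega)).symm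
    have keyd : ∀ β : Fin n →₀ ℕ, β i ≠ 0 → β.degree = (β - Finsupp.single i 1).degree + 1 := fun β hβ => by
      conv_lhs => rw [key β hβ, map_add, Finsupp.degree_single]
    have keyx : ∀ β : Fin n →₀ ℕ, β i ≠ 0 → ∀ u ∈ soc h N, h.x i • H.D β u = - H.D (β - Finsupp.single i 1) u := fun β hβ u hu => by
      have := H.D_x β i u hβ
      rw [hu i, map_zero] at this
      exact eq_neg_of_add_eq_zero_left this.symm
    obtain ⟨c, h1, h2⟩ := ih (α - Finsupp.single i 1) (by have := keyd α hi; omega)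
    refine ⟨-(c * h.x i), fun u hu => ?_, fun u hu β hβ hne => ?_⟩
    · rw [neg_smul, mul_smul, keyx α hi u hu, smul_neg, neg_neg, h1 u hu]
    · by_cases hb : β i = 0
      · rw [neg_smul, mul_smul, ← H.D_x' _ _ _ hb, hu i, map_zero, smul_zero, neg_zero]
      · rw [neg_smul, mul_smul, keyx β hb u hu, smul_neg, neg_neg, h2 u hu]
        · have := keyd β hb; omega
        · intro e
          apply hne
          rw [key β hb, e, ← key α hi]

lemma HS.Phi_inj (H : HS h N) : Function.Injective H.Phi := by
  rw [injective_iff_map_eq_zero]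
  intro u hu
  by_contra hne
  have hs : u.support.Nonempty := Finsupp.support_nonempty_iff.2 hne
  obtain ⟨α, hα, hmax⟩ := Finset.exists_max_image u.support Finsupp.degree hs
  obtain ⟨c, h1, h2⟩ := H.dual α.degree α rfl
  have e : c • H.Phi u = u α := by
    rw [HS.Phi, Finsupp.liftAddHom_apply, Finsupp.sum, Finset.smul_sum, Finset.sum_eq_single α]
    · exact h1 _ (u α).2
    · intro β hβ hb
      exact h2 _ (u β).2 β (hmax β hβ) hb
    · intro hn; exact (hn hα).elim
  rw [hu, smul_zero] at e
  exact (Finsupp.mem_support_iff.1 hα) (Subtype.ext e.symm)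

lemma HS.Phi_surj (H : HS h N) (ht : Tors h N) : Function.Surjective H.Phi := by
  intro v
  have : AddSubgroup.closure {z | ∃ β u, u ∈ soc h N ∧ z = H.D β u} ≤ H.Phi.range := by
    rw [AddSubgroup.closure_le]
    rintro _ ⟨β, u, hu, rfl⟩
    exact ⟨Finsupp.single β ⟨u, hu⟩, H.Phi_single _ _⟩
  exact this (H.span ht v)

lemma HS.ext_soc (H : HS h N) (ht : Tors h N) (f g : N →+ N') (D' : (Fin n →₀ ℕ) → N' → N')
    (hf : ∀ β, ∀ u ∈ soc h N, f (H.D β u) = D' β (f u)) (hg : ∀ β, ∀ u ∈ soc h N, g (H.D β u) = D' β (g u))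
    (e : ∀ u ∈ soc h N, f u = g u) : f = g := by
  ext v
  have : AddSubgroup.closure {z | ∃ β u, u ∈ soc h N ∧ z = H.D β u} ≤ f.eqLocus g := by
    rw [AddSubgroup.closure_le]
    rintro _ ⟨β, u, hu, rfl⟩
    change f _ = g _
    rw [hf β u hu, hg β u hu, e u hu]
  exact this (H.span ht v)

/-- constants -/
def Cst (h : HSR n C) (c : C) : Prop := ∀ α, α ≠ 0 → h.d α c = 0

lemma HS.D_cst (H : HS h N) {c : C} (hc : Cst h c) (α) (v : N) : H.D α (c • v) = c • H.D α v := by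
  rw [H.D_smul, anti_split, h.d_zero, Finset.sum_eq_zero, add_zero]
  intro p hp
  rw [hc _ (anti_erase hp).1, zero_smul]

/-- Kashiwara extension. -/
theorem HS.extend (H : HS h N) (ht : Tors h N) (H' : HS h N') (hm : ∀ v : N, ∃ m, ∀ r ∈ (Ideal.span (Set.range h.x))^m, r • v = 0)
    (hC : ∀ c : C, ∃ k, Cst h k ∧ c - k ∈ Ideal.span (Set.range h.x))
    (θ : soc h N →+ N') (hθ : ∀ u i, h.x i • θ u = 0) (hk : ∀ k, Cst h k → ∀ u, θ (k • u) = k • θ u) :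
    ∃ f : N →ₗ[C] N', (∀ u : soc h N, f u = θ u) ∧ ∀ α v, f (H.D α v) = H'.D α (f v) := by
  let e : ((Fin n →₀ ℕ) →₀ soc h N) ≃+ N := AddEquiv.ofBijective H.Phi ⟨H.Phi_inj, H.Phi_surj ht⟩
  let g : ((Fin n →₀ ℕ) →₀ soc h N) →+ N' := Finsupp.liftAddHom (fun β => (H'.D β).comp θ)
  let f : N →+ N' := g.comp e.symm.toAddMonoidHom
  have f1 : ∀ β (u : soc h N), f (H.D β u) = H'.D β (θ u) := by
    intro β u
    have : e.symm (H.D β u) = Finsupp.single β u := by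
      rw [AddEquiv.symm_apply_eq]; exact (H.Phi_single _ _).symm
    change g (e.symm _) = _
    rw [this]
    simp [g]
  have f0 : ∀ u : soc h N, f u = θ u := by
    intro u
    have := f1 0 u
    rwa [H.D_zero, H'.D_zero] at this
  have ind : ∀ (P : AddSubgroup N), (∀ β, ∀ u : soc h N, H.D β u ∈ P) → ∀ v, v ∈ P := by
    intro P hP v
    have : AddSubgroup.closure {z | ∃ β u, u ∈ soc h N ∧ z = H.D β u} ≤ P := by
      rw [AddSubgroup.closure_le]
      rintro _ ⟨β, u, hu, rfl⟩
      exact hP β ⟨u, hu⟩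
    exact this (H.span ht v)
  have fD : ∀ α v, f (H.D α v) = H'.D α (f v) := by
    intro α
    refine ind ((f.comp (H.D α)).eqLocus ((H'.D α).comp f)) ?_
    intro β u
    change f (H.D α _) = H'.D α (f _)
    rw [f1, H.D_D, H'.D_D, map_nsmul, f1]
  have fx : ∀ i v, f (h.x i • v) = h.x i • f v := by
    intro i
    refine ind ((f.comp (DistribMulAction.toAddMonoidHom N (h.x i))).eqLocus ((DistribMulAction.toAddMonoidHom N' (h.x i)).comp f)) ?_
    intro β u
    change f (h.x i • _) = h.x i • f _
    rw [f1]
    by_cases hb : β i = 0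
    · rw [← H.D_x' _ _ _ hb, ← H'.D_x' _ _ _ hb, u.2 i, hθ, map_zero, map_zero, map_zero]
    · have h1 := H.D_x β i u.1 hb
      have h2 := H'.D_x β i (θ u) hb
      rw [u.2 i, map_zero] at h1
      rw [hθ, map_zero] at h2
      rw [eq_neg_of_add_eq_zero_left h1.symm, eq_neg_of_add_eq_zero_left h2.symm, map_neg, f1]
  have fk : ∀ k, Cst h k → ∀ v, f (k • v) = k • f v := by
    intro k hk'
    refine ind ((f.comp (DistribMulAction.toAddMonoidHom N k)).eqLocus ((DistribMulAction.toAddMonoidHom N' k).comp f)) ?_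
    intro β u
    change f (k • _) = k • f _
    rw [f1, ← H'.D_cst hk', ← H.D_cst hk', ← hk k hk']
    exact f1 β (k • u)
  have fc : ∀ m, ∀ v : N, (∀ r ∈ (Ideal.span (Set.range h.x))^m, r • v = 0) → ∀ c : C, f (c • v) = c • f v := by
    intro m
    induction m with
    | zero =>
      intro v hv c
      have : v = 0 := by have := hv 1 (by simp); rwa [one_smul] at this
      rw [this, smul_zero, map_zero, smul_zero]
    | succ m ih =>
      intro v hv c
      obtain ⟨k, hk', hck⟩ := hC c
      have : ∀ r ∈ Ideal.span (Set.range h.x), f (r • v) = r • f v := by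
        intro r hr
        induction hr using Submodule.span_induction with
        | mem r hr => obtain ⟨i, rfl⟩ := hr; exact fx i v
        | zero => rw [zero_smul, zero_smul, map_zero]
        | add a b _ _ ha hb => rw [add_smul, add_smul, map_add, ha, hb]
        | smul a b hb ihb =>
          rw [smul_eq_mul, mul_smul, mul_smul, ← ihb]
          exact ih (b • v) (fun r hr => by rw [← mul_smul]; exact hv _ (by rw [pow_succ]; exact Ideal.mul_mem_mul hr hb)) a
      rw [← sub_add_cancel c k, add_smul, add_smul, map_add, this _ hck, fk k hk']
  refine ⟨{ f with map_smul' := fun c v => ?_ }, f0, fD⟩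
  obtain ⟨m, hm⟩ := hm v
  exact fc m v hm c

end Kash
end HL
end

section
namespace HL
section Desc
open Finset
variable {n : ℕ} {C : Type} [CommRing C] {h : HSR n C} {N : Type} [AddCommGroup N] [Module C N] 
  {N' : Type} [AddCommGroup N'] [Module C N']

/-- the functor `H1` on maps, at localization level -/
noncomputable def locMap (y : C) (g : N →ₗ[C] N') : Loc y N →ₗ[C] Loc y N' :=
  LocalizedModule.lift (Submonoid.powers y) (toLoc y N' ∘ₗ g) (isUnit_of_bij (loc_bij y N'))

lemma locMap_to (y : C) (g : N →ₗ[C] N') (v : N) : locMap y g (toLoc y N v) = toLoc y N' (g v) :=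
  LinearMap.congr_fun (LocalizedModule.lift_comp (Submonoid.powers y) (toLoc y N' ∘ₗ g) (isUnit_of_bij (loc_bij y N'))) v

lemma loc_inj {y : C} (j : ℕ) {u v : Loc y N} (e : y^j • u = y^j • v) : u = v := (smul_loc_bij y N j).1 e

lemma pow_fr (y : C) (j : ℕ) (v : N) : y^j • fr y j v = toLoc y N v := by
  have := fr_add y j 0 v
  rw [fr_zero] at this
  exact this

lemma locMap_fr (y : C) (g : N →ₗ[C] N') (j : ℕ) (v : N) : locMap y g (fr y j v) = fr y j (g v) := by
  apply loc_inj j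
  rw [← map_smul, pow_fr, pow_fr, locMap_to]

noncomputable def H1map (y : C) (g : N →ₗ[C] N') : H1 y N →ₗ[C] H1 y N' :=
  Submodule.mapQ _ _ (locMap y g) (by
    rintro _ ⟨v, rfl⟩
    exact ⟨g v, (locMap_to y g v).symm⟩)

lemma H1map_q (y : C) (g : N →ₗ[C] N') (z : Loc y N) : H1map y g (qH1 y N z) = qH1 y N' (locMap y g z) := rfl

lemma H1map_ej (y : C) (g : N →ₗ[C] N') (j : ℕ) (v : N) : H1map y g (ej y j v) = ej y j (g v) := by
  change H1map y g (qH1 y N _) = qH1 y N' _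
  rw [H1map_q, locMap_fr]

/-- HS linear -/
def HSL (H : HS h N) (H' : HS h N') (g : N →ₗ[C] N') : Prop := ∀ α v, g (H.D α v) = H'.D α (g v)

lemma loc_comm (H : HS h N) (H' : HS h N') (y : C) (g : N →ₗ[C] N') (α : Fin n →₀ ℕ)
    (hq : ∀ q < α, ∀ z, locMap y g ((H.loc y).D q z) = (H'.loc y).D q (locMap y g z)) (j : ℕ) (v : N) :
    locMap y g ((H.loc y).D α (fr y j v)) - (H'.loc y).D α (locMap y g (fr y j v)) = fr y j (g (H.D α v) - H'.D α (g v)) := by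
  apply loc_inj j
  rw [pow_fr, map_sub, ← H'.loc_to, ← locMap_to, ← H.loc_to, ← locMap_to, ← pow_fr y j v, map_smul (locMap y g) (y^j) (fr y j v), (H.loc y).D_smul, (H'.loc y).D_smul,
    anti_split, anti_split, h.d_zero, map_add, map_smul (locMap y g) (y^j), map_sum, smul_sub, Finset.sum_congr rfl]
  · abel
  · intro p hp
    rw [map_smul, hq _ (anti_erase hp).2]

lemma HSL.loc_aux {H : HS h N} {H' : HS h N'} {g : N →ₗ[C] N'} (y : C) (α : Fin n →₀ ℕ) (hg : ∀ q < α, ∀ v, g (H.D q v) = H'.D q (g v)) :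
    ∀ q < α, ∀ z, locMap y g ((H.loc y).D q z) = (H'.loc y).D q (locMap y g z) := by
  intro q
  induction q using WellFoundedLT.induction with
  | ind q ih =>
    intro hqa z
    obtain ⟨j, v, rfl⟩ := fr_surj y z
    have := loc_comm H H' y g q (fun q' h' => ih q' h' (h'.trans hqa)) j v
    rw [hg q hqa, sub_self, map_zero, sub_eq_zero] at this
    exact this

lemma HSL.loc {H : HS h N} {H' : HS h N'} {g : N →ₗ[C] N'} (hg : HSL H H' g) (y : C) : HSL (H.loc y) (H'.loc y) (locMap y g) := by
  intro q
  induction q using WellFoundedLT.induction with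
  | ind q ih =>
    intro z
    obtain ⟨j, v, rfl⟩ := fr_surj y z
    have := loc_comm H H' y g q ih j v
    rw [hg q, sub_self, map_zero, sub_eq_zero] at this
    exact this

lemma HSL.H1 {H : HS h N} {H' : HS h N'} {g : N →ₗ[C] N'} (hg : HSL H H' g) (y : C) : HSL (H.H1 y) (H'.H1 y) (H1map y g) := by
  intro α v
  obtain ⟨v, rfl⟩ := qH1_surj y v
  rw [HS.H1_q, H1map_q, H1map_q, HS.H1_q, hg.loc y]

/-- cyclic torsion -/
def Cyc (bs : List C) (N' : Type) [AddCommGroup N'] [Module C N'] : Prop :=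
  Div N' bs ∧ ∀ k : ℕ, ∃ ε : N', ∀ v : N', (∀ b ∈ bs, b^k • v = 0) → ∃ c : C, v = c • ε

/-- completeness with respect to `y`-/
def Cpl (y : C) : Prop := ∀ a : ℕ → C, ∃ s : ℕ → C, ∀ j, s j = a j + y * s (j+1)

lemma Cyc.sep [IsNoetherianRing C] [IsLocalRing C] {bs : List C} (hN : Cyc bs N') (ht : ∀ v : N', ∃ k : ℕ, ∀ b ∈ bs, b^k • v = 0)
    {y : C} (hy : NZD y N') (hym : y ∈ maximalIdeal C)
    (v : N') (hv : ∀ j, ej y j v = 0) : v = 0 := by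
  obtain ⟨k, hk⟩ := ht v
  obtain ⟨ε, hε⟩ := hN.2 k
  have key : ∀ j, ∃ c : C, v = y^j • c • ε := by
    intro j
    obtain ⟨w, hw⟩ := (ej_eq_zero' hy).1 (hv j)
    obtain ⟨c, rfl⟩ := hε w (by
      intro b hb
      apply hy.pow j
      rw [smul_comm, ← hw, hk b hb])
    exact ⟨c, hw⟩
  let T := Submodule.span C {ε}
  have hT : ∀ c : C, c • ε ∈ T := fun c => Submodule.smul_mem _ _ (Submodule.subset_span rfl)
  obtain ⟨c, hc⟩ := key 0
  rw [pow_zero, one_smul] at hc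
  haveI : Module.Finite C T := Module.Finite.iff_fg.2 (Submodule.fg_span_singleton ε)
  have hbot := Ideal.iInf_pow_smul_eq_bot_of_isLocalRing (R := C) (M := T) (maximalIdeal C) (Ideal.IsPrime.ne_top')
  have : (⟨c • ε, hT c⟩ : T) ∈ (⨅ i : ℕ, (maximalIdeal C)^i • (⊤ : Submodule C T)) := by
    rw [Submodule.mem_iInf]
    intro j
    obtain ⟨c', hc'⟩ := key j
    have : (⟨c • ε, hT c⟩ : T) = y^j • ⟨c' • ε, hT c'⟩ := Subtype.ext (hc.symm.trans hc')
    rw [this]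
    exact Submodule.smul_mem_smul (Ideal.pow_mem_pow hym j) trivial
  rw [hbot, Submodule.mem_bot] at this
  rw [hc]; exact congrArg Subtype.val this

lemma Cyc.exists_lift {bs : List C} (hN : Cyc bs N') {y : C} (hy : NZD y N') (hc : Cpl y) 
    (t : ℕ → H1 y N') (h1 : ∀ j, y • t (j+1) = t j) (h0 : t 0 = 0) (k : ℕ) (hk : ∀ j, ∀ b ∈ bs, b^k • t j = 0) :
    ∃ u : N', ∀ j, ej y j u = t j := by
  have hyt : ∀ j, y^j • t j = 0 := by
    intro j
    induction j with
    | zero => rw [h0, smul_zero]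
    | succ j ih => rw [pow_succ, mul_smul, h1, ih]
  obtain ⟨ε, hε⟩ := hN.2 k
  have key : ∀ j, ∃ c : C, (∀ b ∈ bs, b^k • c • ε = 0) ∧ ej y j (c • ε) = t j := by
    intro j
    obtain ⟨w, hw⟩ := H1_tors hy j (t j) (hyt j)
    obtain ⟨w', h2, u, hu⟩ := hN.1.lift (hy.pow' j) k w (by
      intro b hb
      have := hk j b hb
      rwa [← hw, ← map_smul, ej_eq_zero' hy] at this)
    obtain ⟨c, rfl⟩ := hε w' h2
    refine ⟨c, h2, ?_⟩
    rw [← hw, ← sub_eq_zero, ← map_sub, ej_eq_zero' hy]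
    exact ⟨-u, by rw [smul_neg, ← hu, neg_sub]⟩
  choose c hcb hct using key
  have key2 : ∀ j, ∃ a : C, c (j+1) • ε = c j • ε + y^j • a • ε := by
    intro j
    have : ej y j (c (j+1) • ε - c j • ε) = 0 := by
      rw [map_sub, hct, ← ej_succ, hct, h1, sub_self]
    rw [ej_eq_zero' hy] at this
    obtain ⟨z, hz⟩ := this
    obtain ⟨a, rfl⟩ := hε z (by
      intro b hb
      apply hy.pow j
      rw [smul_comm, ← hz, smul_sub, hcb _ b hb, hcb _ b hb, sub_zero])
    exact ⟨a, by rw [← hz]; abel⟩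
  choose a ha using key2
  obtain ⟨s, hs⟩ := hc a
  have key3 : ∀ j, (c 0 + s 0) • ε = c j • ε + y^j • s j • ε := by
    intro j
    induction j with
    | zero => rw [add_smul, pow_zero, one_smul]
    | succ j ih => rw [ih, ha, hs j, add_smul, smul_add, ← add_assoc, pow_succ]; simp only [mul_smul]
  refine ⟨(c 0 + s 0) • ε, fun j => ?_⟩
  rw [key3 j, map_add, hct, map_smul, pow_smul_ej, add_zero]

/-- descent of HS-linear maps -/
theorem descent [IsNoetherianRing C] [IsLocalRing C] {bs : List C} (hN : Cyc bs N') (ht : ∀ v : N', ∃ k : ℕ, ∀ b ∈ bs, b^k • v = 0)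
    (htN : ∀ v : N, ∃ k : ℕ, ∀ b ∈ bs, b^k • v = 0)
    {y : C} (hy : NZD y N') (hym : y ∈ maximalIdeal C) (hc : Cpl y) {H : HS h N} {H' : HS h N'} 
    (θ : H1 y N →ₗ[C] H1 y N') (hθ : HSL (H.H1 y) (H'.H1 y) θ) : ∃ g : N →ₗ[C] N', HSL H H' g ∧ θ = H1map y g := by
  have ex : ∀ v : N, ∃ u : N', ∀ j, ej y j u = θ (ej y j v) := by
    intro v
    obtain ⟨k, hk⟩ := htN v
    refine hN.exists_lift hy hc (fun j => θ (ej y j v)) (fun j => ?_) ?_ k ?_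
    · rw [← map_smul, ej_succ]
    · simp only [ej_zero, map_zero]
    · intro j b hb
      rw [← map_smul, ← map_smul, hk b hb, map_zero, map_zero]
  choose g hg using ex
  have un : ∀ u u' : N', (∀ j, ej y j u = ej y j u') → u = u' := by
    intro u u' e
    rw [← sub_eq_zero]
    apply hN.sep ht hy hym
    intro j; rw [map_sub, e, sub_self]
  let G : N →ₗ[C] N' :=
    { toFun := g
      map_add' := fun u v => un _ _ fun j => by rw [map_add, hg, hg, hg, map_add, map_add]
      map_smul' := fun c v => un _ _ fun j => by rw [RingHom.id_apply, map_smul, hg, hg, map_smul, map_smul] }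
  have hG : ∀ j v, ej y j (G v) = θ (ej y j v) := fun j v => hg v j
  have hGθ : θ = H1map y G := by
    ext z
    obtain ⟨j, v, rfl⟩ := ej_surj y z
    rw [H1map_ej, hG]
  refine ⟨G, ?_, hGθ⟩
  intro α
  induction α using WellFoundedLT.induction with
  | ind α ih =>
    intro v
    apply un
    intro j
    have := congrArg (qH1 y N') (loc_comm H H' y G α (HSL.loc_aux y α ih) j v)
    rw [map_sub, ← H1map_q, ← HS.H1_q, ← HS.H1_q, ← H1map_q, ← hGθ, hθ, sub_self] at this
    rw [← sub_eq_zero, ← map_sub]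
    exact this.symm


/-- rigidity of a map -/
def Rig (H : HS h N) (H' : HS h N') (ι : N →ₗ[C] N') : Prop :=
  HSL H H' ι ∧ ι ≠ 0 ∧ ∀ g : N →ₗ[C] N', HSL H H' g → ∃ k, Cst h k ∧ g = k • ι

lemma H1map_smul (y : C) (k : C) (g : N →ₗ[C] N') : H1map y (k • g) = k • H1map y g := by
  ext z
  obtain ⟨j, v, rfl⟩ := ej_surj y z
  rw [H1map_ej, LinearMap.smul_apply, LinearMap.smul_apply, H1map_ej, map_smul]

theorem Rig.H1 [IsNoetherianRing C] [IsLocalRing C] {bs : List C} (hN : Cyc bs N') (ht : ∀ v : N', ∃ k : ℕ, ∀ b ∈ bs, b^k • v = 0)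
    (htN : ∀ v : N, ∃ k : ℕ, ∀ b ∈ bs, b^k • v = 0)
    {y : C} (hy : NZD y N') (hym : y ∈ maximalIdeal C) (hc : Cpl y) {H : HS h N} {H' : HS h N'} {ι : N →ₗ[C] N'}
    (hr : Rig H H' ι) : Rig (H.H1 y) (H'.H1 y) (H1map y ι) := by
  refine ⟨hr.1.H1 y, ?_, ?_⟩
  · intro e
    apply hr.2.1
    ext v
    apply hN.sep ht hy hym
    intro j
    rw [← H1map_ej, e, LinearMap.zero_apply]
  · intro θ hθ
    obtain ⟨g, hg, rfl⟩ := descent hN ht htN hy hym hc θ hθ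
    obtain ⟨k, hk, rfl⟩ := hr.2.2 g hg
    exact ⟨k, hk, H1map_smul y k ι⟩

noncomputable def HLmap {M M' : ModuleCat.{0} C} (ι : M →ₗ[C] M') : (l : List C) → HL l M →ₗ[C] HL l M'
  | [] => ι
  | b :: l => H1map (N := HL l M) (N' := HL l M') b (HLmap ι l)

lemma H1_tors_list {y : C} {bs : List C} (ht : ∀ v : N, ∃ k : ℕ, ∀ b ∈ bs, b^k • v = 0) (v : H1 y N) : 
    ∃ k : ℕ, ∀ b ∈ y :: bs, b^k • v = 0 := by
  obtain ⟨j, v, rfl⟩ := ej_surj y v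
  obtain ⟨k, hk⟩ := ht v
  refine ⟨k + j, fun b hb => ?_⟩
  rcases List.mem_cons.1 hb with rfl | hb
  · rw [pow_add, mul_smul, pow_smul_ej, smul_zero]
  · rw [pow_add, mul_comm, mul_smul, ← map_smul, hk b hb, map_zero, smul_zero]

lemma HL_tors_list (M : ModuleCat.{0} C) (f : List C) (ht : ∀ v : M, ∃ k : ℕ, ∀ b ∈ f, b^k • v = 0) (l : List C) :
    ∀ v : HL l M, ∃ k : ℕ, ∀ b ∈ l ++ f, b^k • v = 0 := by
  induction l with
  | nil => exact ht
  | cons b l ih => exact fun v => H1_tors_list (N := HL l M) ih v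

lemma Cyc_HL (bs : List C) (hb : NZL bs (ModuleCat.of C C)) : Cyc bs (HL bs (ModuleCat.of C C)) := by
  refine ⟨Div_HL _ bs hb, fun k => ⟨eps k (ModuleCat.of C C) bs (1 : C), fun v hv => ?_⟩⟩
  obtain ⟨b, rfl⟩ := eps_surj k _ bs hb v hv
  refine ⟨b, ?_⟩
  rw [← map_smul]
  congr 1
  exact (mul_one b).symm

theorem Rig.HL [IsNoetherianRing C] [IsLocalRing C] (f : List C) (ys : List C) (hnz : NZL (ys ++ f) (ModuleCat.of C C))
    (M : ModuleCat.{0} C) (hM : ∀ v : M, ∃ k : ℕ, ∀ b ∈ f, b^k • v = 0) (H : HS h M) (H' : HS h (HL f (ModuleCat.of C C)))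
    (hm : ∀ y ∈ ys, y ∈ maximalIdeal C) (hc : ∀ y ∈ ys, Cpl y) {ι : M →ₗ[C] HL f (ModuleCat.of C C)}
    (hr : Rig H H' ι) : Rig (H.HL ys) (H'.HL ys) (HLmap ι ys) := by
  induction ys with
  | nil => exact hr
  | cons y l ih =>
    have ih := ih hnz.2 (fun y hy => hm y (by simp [hy])) (fun y hy => hc y (by simp [hy]))
    have q : ∀ (X : ModuleCat.{0} C), X = HL.HL (l ++ f) (ModuleCat.of C C) → Cyc (l ++ f) X ∧ NZD y X := by
      rintro _ rfl; exact ⟨Cyc_HL _ hnz.2, hnz.1⟩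
    obtain ⟨q1, q2⟩ := q (HL.HL l (HL.HL f (ModuleCat.of C C))) (HL_append _ _ _).symm
    refine Rig.H1 q1 ?_ ?_ q2 (hm y (by simp)) (hc y (by simp)) ih
    · refine HL_tors_list (HL.HL f (ModuleCat.of C C)) f ?_ l
      have := HL_tors_list (ModuleCat.of C C) [] (by simp) f
      intro v
      obtain ⟨k, hk⟩ := this v
      exact ⟨k, fun b hb => hk b (by rw [List.append_nil]; exact hb)⟩
    · exact HL_tors_list M f hM l


/-- From rigidity, socle is one dimensional. -/
theorem Rig.soc {K : Type} [Field K] [Algebra K C] {H : HS h N} {H' : HS h N'} {ι : N →ₗ[C] N'} (hr : Rig H H' ι) (ht : Tors h N)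
    (hm : ∀ v : N, ∃ m, ∀ r ∈ (Ideal.span (Set.range h.x))^m, r • v = 0)
    (hK : ∀ k : K, Cst h (algebraMap K C k))
    (hC : ∀ c : C, ∃ k : K, c - algebraMap K C k ∈ Ideal.span (Set.range h.x)) :
    ∃ u ∈ soc h N, u ≠ 0 ∧ ∀ v ∈ soc h N, ∃ k : C, v = k • u := by
  have sx : ∀ (X : Type) [AddCommGroup X] [Module C X] (v : X) (hv : ∀ i, h.x i • v = 0) (r : C),
      r ∈ Ideal.span (Set.range h.x) → r • v = 0 := by
    intro X _ _ v hv r hr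
    have : Ideal.span (Set.range h.x) ≤ LinearMap.ker (LinearMap.toSpanSingleton C X v) := by
      rw [Ideal.span_le]
      rintro _ ⟨i, rfl⟩
      exact hv i
    exact this hr
  have h1 : ∃ u ∈ HL.soc h N, ι u ≠ 0 := by
    by_contra hcon
    push Not at hcon
    apply hr.2.1
    have := H.ext_soc ht ι.toAddMonoidHom 0 (fun β v => H'.D β v) (fun β u _ => hr.1 β u) (by simp) hcon
    ext v
    exact DFunLike.congr_fun this v
  obtain ⟨u, hu, hιu⟩ := h1
  have hιx : ∀ i, h.x i • ι u = 0 := fun i => by rw [← map_smul, hu i, map_zero]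
  refine ⟨u, hu, fun e => hιu (by rw [e, map_zero]), fun v hv => ?_⟩
  letI : Module K (HL.soc h N) := Module.compHom _ (algebraMap K C)
  have hsm : ∀ (k : K) (w : HL.soc h N), k • w = algebraMap K C k • w := fun k w => rfl
  by_contra hcon
  have hnot : (⟨v, hv⟩ : HL.soc h N) ∉ Submodule.span K {(⟨u, hu⟩ : HL.soc h N)} := by
    intro hmem
    obtain ⟨k, hk⟩ := Submodule.mem_span_singleton.1 hmem
    exact hcon ⟨algebraMap K C k, (congrArg Subtype.val hk).symm⟩
  obtain ⟨f, hf1, hf2⟩ := Submodule.exists_le_ker_of_notMem hnot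
  have hfu : f ⟨u, hu⟩ = 0 := hf2 (Submodule.subset_span rfl)
  let θ : HL.soc h N →+ N' :=
    { toFun := fun w => algebraMap K C (f w) • ι u
      map_zero' := by rw [map_zero, map_zero, zero_smul]
      map_add' := fun a b => by rw [map_add, map_add, add_smul] }
  obtain ⟨g, hg1, hg2⟩ := H.extend ht H' hm (fun c => by
      obtain ⟨k, hk⟩ := hC c
      exact ⟨_, hK k, hk⟩) θ (fun w i => by
      change h.x i • algebraMap K C (f w) • ι u = 0
      rw [smul_comm, hιx, smul_zero]) (fun c _ w => by
      obtain ⟨k, hk⟩ := hC c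
      have e1 : c • w = k • w := by
        rw [hsm, ← sub_eq_zero, ← sub_smul]
        exact Subtype.ext (sx _ w.1 w.2 _ hk)
      have e2 : c • ι u = algebraMap K C k • ι u := by
        rw [← sub_eq_zero, ← sub_smul]
        exact sx _ _ hιx _ hk
      change algebraMap K C (f (c • w)) • ι u = c • algebraMap K C (f w) • ι u
      rw [e1, map_smul, smul_comm c, e2, smul_eq_mul, map_mul, mul_comm, mul_smul])
  obtain ⟨c, -, rfl⟩ := hr.2.2 g hg2
  obtain ⟨k, hk⟩ := hC c
  have e2 : ∀ w, (∀ i, h.x i • w = 0) → c • ι w = algebraMap K C k • ι w := fun w hw => by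
    rw [← sub_eq_zero, ← sub_smul]
    exact sx _ _ (fun i => by rw [← map_smul, hw i, map_zero]) _ hk
  have e3 := hg1 ⟨u, hu⟩
  have e4 := hg1 ⟨v, hv⟩
  change c • ι u = algebraMap K C (f _) • ι u at e3
  change c • ι v = algebraMap K C (f _) • ι u at e4
  rw [hfu, map_zero, zero_smul, e2 u hu] at e3
  rw [e2 v hv] at e4
  have inv : ∀ (k : K) (hk : k ≠ 0) (w : N'), algebraMap K C k • w = 0 → w = 0 := by
    intro k hk w hw
    have := congrArg (algebraMap K C k⁻¹ • ·) hw
    simp only [smul_smul, ← map_mul, inv_mul_cancel₀ hk, map_one, one_smul, smul_zero] at this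
    exact this
  have hk0 : k = 0 := by
    by_contra hk0
    exact hιu (inv k hk0 _ e3)
  rw [hk0, map_zero, zero_smul] at e4
  exact hιu (inv _ hf1 _ e4.symm)

end Desc
end HL
end

section
namespace HL
open Finset MvPowerSeries

lemma ch_assoc {n : ℕ} (α β γ : Fin n →₀ ℕ) :
    ch (α+γ) α * ch (β+(α+γ)) β = ch (α+β) α * ch (α+β+γ) (α+β) := by
  simp only [ch, ← Finset.prod_mul_distrib]
  refine Finset.prod_congr rfl fun i _ => ?_
  simp only [Finsupp.add_apply]
  generalize α i = a; generalize β i = b; generalize γ i = c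
  have h1 := Nat.add_choose_mul_factorial_mul_factorial a c
  rw [← Nat.choose_symm_add] at h1
  have h2 := Nat.add_choose_mul_factorial_mul_factorial b (a+c)
  rw [← Nat.choose_symm_add] at h2
  have h3 := Nat.add_choose_mul_factorial_mul_factorial a b
  rw [← Nat.choose_symm_add] at h3
  have h4 := Nat.add_choose_mul_factorial_mul_factorial (a+b) c
  rw [← Nat.choose_symm_add] at h4
  have e1 : b + (a + c) = a + b + c := by ring
  rw [e1] at h2
  rw [e1]
  have hp : 0 < a.factorial * b.factorial * c.factorial * (a+c).factorial * (a+b).factorial := by positivity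
  apply Nat.eq_of_mul_eq_mul_right hp
  calc _ = ((a+c).choose a * a.factorial * c.factorial) * ((a+b+c).choose b * b.factorial * (a+c).factorial) * (a+b).factorial := by ring
    _ = ((a+b).choose a * a.factorial * b.factorial) * ((a+b+c).choose (a+b) * (a+b).factorial * c.factorial) * (a+c).factorial := by
        rw [h1, h2, h3, h4]; ring
    _ = _ := by ring

section PS
variable (n : ℕ) (K : Type) [Field K]

/-- Hasse derivative. -/
noncomputable def hasse (α : Fin n →₀ ℕ) : MvPowerSeries (Fin n) K →+ MvPowerSeries (Fin n) K where
  toFun c := fun β => ch (α+β) α • coeff (α+β) c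
  map_zero' := by
    funext β; change ch (α+β) α • coeff (α+β) (0 : MvPowerSeries (Fin n) K) = 0; rw [map_zero, smul_zero]
  map_add' a b := by
    funext β
    change ch (α+β) α • coeff (α+β) (a + b) = ch (α+β) α • coeff (α+β) a + ch (α+β) α • coeff (α+β) b
    rw [map_add, smul_add]

lemma coeff_hasse (α β c) : coeff β (hasse n K α c) = ch (α+β) α • coeff (α+β) c := rfl

/-- power series ring as a Hasse–Schmidt ring -/
noncomputable def psr : HSR n (MvPowerSeries (Fin n) K) where
  x i := X i
  d := hasse n K
  d_zero c := by
    ext β; rw [coeff_hasse, ch_zero, one_smul, zero_add]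
  d_one α hα := by
    classical
    ext β; rw [coeff_hasse, coeff_one, if_neg, smul_zero, map_zero]
    intro h; exact hα (add_eq_zero.1 h).1
  d_mul α b c := by
    classical
    ext β
    rw [coeff_hasse, map_sum, coeff_mul]
    simp only [coeff_mul, coeff_hasse]
    rw [← vsum α β (fun p => coeff p.1 b * coeff p.2 c)]
    refine Finset.sum_congr rfl fun a _ => Finset.sum_congr rfl fun b _ => ?_
    rw [smul_mul_smul_comm]
  d_d α β c := by
    ext γ
    rw [map_nsmul, coeff_hasse, coeff_hasse, coeff_hasse, smul_smul, smul_smul, ch_assoc]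
    congr 2
    rw [← add_assoc, add_comm β α]
  d_x i := by
    classical
    ext β
    rw [coeff_hasse, coeff_X, coeff_one]
    by_cases h : β = 0
    · subst h; rw [add_zero, if_pos rfl, if_pos rfl, ch_self, one_smul]
    · rw [if_neg h, if_neg, smul_zero]; simpa using h
  d_x' i α h0 h1 := by
    classical
    ext β
    rw [coeff_hasse, coeff_X, map_zero]
    split_ifs with h
    · exfalso
      have hle : α ≤ Finsupp.single i 1 := by rw [← h]; exact le_self_add
      have : α = Finsupp.single i (α i) := by
        ext j
        by_cases hj : j = i
        · subst hj; simp
        · have := hle j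
          rw [Finsupp.single_eq_of_ne hj] at this ⊢
          omega
      have h2 := hle i
      rw [Finsupp.single_eq_same] at h2
      interval_cases h3 : α i
      · exact h0 (by rw [this]; simp)
      · exact h1 this
    · rw [smul_zero]

lemma psr_x (i) : (psr n K).x i = X i := rfl
lemma psr_d (α c) : (psr n K).d α c = hasse n K α c := rfl

lemma psr_cst (k : K) : Cst (psr n K) (algebraMap K _ k) := by
  intro α hα
  classical
  ext β
  rw [psr_d, coeff_hasse, MvPowerSeries.algebraMap_apply, coeff_C, if_neg, smul_zero, map_zero]
  intro h; exact hα (add_eq_zero.1 h).1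

lemma cst_const (c : MvPowerSeries (Fin n) K) (h : Cst (psr n K) c) : ∃ k : K, c = algebraMap K _ k := by
  classical
  refine ⟨coeff 0 c, ?_⟩
  ext β
  rw [MvPowerSeries.algebraMap_apply, coeff_C]
  split_ifs with hb
  · rw [hb]; rfl
  · have := congrArg (coeff 0) (h β hb)
    rw [psr_d, coeff_hasse, add_zero, ch_self, one_smul] at this
    rw [this, map_zero]

end PS
end HL
end

section
namespace HL
open Finset MvPowerSeries

section PSB
variable {n : ℕ} {R : Type} [CommRing R]

lemma mem_spanX (c : MvPowerSeries (Fin n) R) :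
    c ∈ Ideal.span (Set.range (X : Fin n → MvPowerSeries (Fin n) R)) ↔ coeff 0 c = 0 := by
  classical
  constructor
  · intro h
    induction h using Submodule.span_induction with
    | mem x hx => obtain ⟨i, rfl⟩ := hx; exact coeff_zero_X i
    | zero => exact map_zero _
    | add x y _ _ hx hy => rw [map_add, hx, hy, add_zero]
    | smul a x _ hx =>
      rw [smul_eq_mul, coeff_mul]
      simp [hx]
  · intro h
    have hp : ∀ γ : Fin n →₀ ℕ, ∃ i : Option (Fin n), ∀ hγ : γ ≠ 0, ∃ j, i = some j ∧ γ j ≠ 0 := by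
      intro γ
      by_cases hγ : γ = 0
      · exact ⟨none, fun h => absurd hγ h⟩
      · obtain ⟨j, hj⟩ := Finsupp.ne_iff.1 hγ
        exact ⟨some j, fun _ => ⟨j, rfl, hj⟩⟩
    choose pk hpk using hp
    let cc : Fin n → MvPowerSeries (Fin n) R := fun i β =>
      if pk (β + Finsupp.single i 1) = some i then coeff (β + Finsupp.single i 1) c else 0
    have hcc : ∀ i β, coeff β (cc i) = if pk (β + Finsupp.single i 1) = some i then coeff (β + Finsupp.single i 1) c else 0 :=
      fun i β => rfl
    have : c = ∑ i, X i * cc i := by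
      ext γ
      rw [map_sum]
      have e : ∀ i, coeff γ (X i * cc i) = if (Finsupp.single i 1 ≤ γ ∧ pk γ = some i) then coeff γ c else 0 := by
        intro i
        rw [X, coeff_monomial_mul, one_mul, hcc]
        by_cases h1 : Finsupp.single i 1 ≤ γ
        · rw [if_pos h1, tsub_add_cancel_of_le h1]; simp [h1]
        · rw [if_neg h1, if_neg (fun h => h1 h.1)]
      simp only [e]
      by_cases hγ : γ = 0
      · subst hγ
        rw [h]; simp
      · obtain ⟨j, hj, hj'⟩ := hpk γ hγ
        rw [Finset.sum_eq_single j, if_pos]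
        · exact ⟨by rw [Finsupp.single_le_iff]; omega, hj⟩
        · intro b _ hb
          rw [if_neg]
          rintro ⟨_, h2⟩
          rw [hj] at h2
          exact hb (Option.some.inj h2).symm
        · simp
    rw [this]
    exact Ideal.sum_mem _ fun i _ => Ideal.mul_mem_right _ _ (Ideal.subset_span ⟨i, rfl⟩)

/-- order at least `N` -/
def Lo (N : ℕ) (c : MvPowerSeries (Fin n) R) : Prop := ∀ β : Fin n →₀ ℕ, β.degree < N → coeff β c = 0

lemma Lo.mul {M N : ℕ} {b c : MvPowerSeries (Fin n) R} (hb : Lo M b) (hc : Lo N c) : Lo (M+N) (b*c) := by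
  classical
  intro β h
  rw [coeff_mul]
  refine Finset.sum_eq_zero fun p hp => ?_
  rw [HasAntidiagonal.mem_antidiagonal] at hp
  by_cases h1 : p.1.degree < M
  · rw [hb _ h1, zero_mul]
  · rw [hc, mul_zero]
    rw [← hp, map_add] at h
    omega

lemma Lo.zero (b : MvPowerSeries (Fin n) R) : Lo 0 b := fun β h => absurd h (Nat.not_lt_zero _)

lemma Lo.one {b : MvPowerSeries (Fin n) R} (h : coeff 0 b = 0) : Lo 1 b := by
  intro β hb
  have : β.degree = 0 := by omega
  rw [Finsupp.degree_eq_zero_iff] at this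
  rw [this, h]

lemma Lo.pow {b : MvPowerSeries (Fin n) R} (h : coeff 0 b = 0) (k : ℕ) : Lo k (b^k) := by
  induction k with
  | zero => exact Lo.zero _
  | succ k ih => rw [pow_succ]; exact ih.mul (Lo.one h)

lemma Lo.of_mem {N : ℕ} {c : MvPowerSeries (Fin n) R}
    (h : c ∈ Ideal.span (Set.range (X : Fin n → MvPowerSeries (Fin n) R)) ^ N) : Lo N c := by
  induction N generalizing c with
  | zero => exact Lo.zero _
  | succ N ih =>
    rw [pow_succ] at h
    induction h using Submodule.mul_induction_on' with
    | mem_mul_mem a ha b hb => exact (ih ha).mul (Lo.one ((mem_spanX b).1 hb))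
    | add x _ y _ hx hy => intro β hb; rw [map_add, hx β hb, hy β hb, add_zero]

lemma Cpl_ps {y : MvPowerSeries (Fin n) R} (hy : coeff 0 y = 0) : Cpl y := by
  classical
  intro a
  let s : ℕ → MvPowerSeries (Fin n) R := fun j β => ∑ k ∈ range (β.degree + 1), coeff β (y^k * a (j+k))
  have hs : ∀ j β m, β.degree ≤ m → coeff β (s j) = ∑ k ∈ range (m+1), coeff β (y^k * a (j+k)) := by
    intro j β m hm
    change ∑ k ∈ range (β.degree + 1), coeff β (y^k * a (j+k)) = _
    refine Finset.sum_subset (fun x hx => ?_) fun k _ hk => ?_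
    · rw [Finset.mem_range] at hx ⊢; omega
    · rw [Finset.mem_range] at hk
      have := (Lo.pow hy k).mul (Lo.zero (a (j+k)))
      exact this β (by omega)
  refine ⟨s, fun j => ?_⟩
  ext β
  rw [map_add, hs j β β.degree le_rfl, coeff_mul, Finset.sum_range_succ', pow_zero, one_mul, add_zero, add_comm]
  congr 1
  have : ∀ p ∈ antidiagonal β, coeff p.1 y * coeff p.2 (s (j+1)) =
      ∑ k ∈ range (β.degree+1), coeff p.1 y * coeff p.2 (y^k * a (j+1+k)) := by
    intro p hp
    rw [hs (j+1) p.2 β.degree, Finset.mul_sum]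
    rw [HasAntidiagonal.mem_antidiagonal] at hp
    rw [← hp, map_add]; omega
  rw [Finset.sum_congr rfl this, Finset.sum_comm]
  simp only [← coeff_mul]
  rw [Finset.sum_range_succ]
  have h0 : coeff β (y * (y ^ β.degree * a (j+1+β.degree))) = 0 := by
    rw [← mul_assoc, ← pow_succ']
    exact ((Lo.pow hy (β.degree+1)).mul (Lo.zero (a (j+1+β.degree)))) β (by omega)
  rw [h0, add_zero]
  refine Finset.sum_congr rfl fun k _ => ?_
  rw [← mul_assoc, ← pow_succ']
  rw [add_assoc j 1 k, add_comm 1 k]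

lemma mem_map_C {J : Ideal R} (hJ : J.FG) (b : MvPowerSeries (Fin n) R) (hb : ∀ β, coeff β b ∈ J) :
    b ∈ J.map (MvPowerSeries.C (σ := Fin n) (R := R)) := by
  obtain ⟨m, g, hg⟩ := Submodule.fg_iff_exists_fin_generating_family.1 hJ
  have : ∀ β, ∃ a : Fin m → R, ∑ i, a i • g i = coeff β b := fun β =>
    (Submodule.mem_span_range_iff_exists_fun R).1 (hg ▸ hb β)
  choose a ha using this
  let aa : Fin m → MvPowerSeries (Fin n) R := fun i β => a β i
  have e : b = ∑ i, MvPowerSeries.C (g i) * aa i := by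
    ext β
    rw [map_sum, ← ha]
    refine Finset.sum_congr rfl fun i _ => ?_
    rw [coeff_C_mul, smul_eq_mul, mul_comm]; rfl
  rw [e]
  refine Ideal.sum_mem _ fun i _ => Ideal.mul_mem_right _ _ (Ideal.mem_map_of_mem _ ?_)
  rw [← hg]; exact Submodule.subset_span ⟨i, rfl⟩

end PSB

section PSF
variable (n : ℕ) (K : Type) [Field K]

lemma spanX_max : Ideal.span (Set.range (X : Fin n → MvPowerSeries (Fin n) K)) = maximalIdeal (MvPowerSeries (Fin n) K) := by
  ext c
  rw [mem_spanX, mem_maximalIdeal, mem_nonunits_iff, MvPowerSeries.isUnit_iff_constantCoeff, isUnit_iff_ne_zero, not_not]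
  rfl

lemma Cpl_max {y : MvPowerSeries (Fin n) K} (hy : y ∈ maximalIdeal _) : Cpl y := by
  rw [← spanX_max, mem_spanX] at hy
  exact Cpl_ps hy

lemma psr_split (c : MvPowerSeries (Fin n) K) :
    ∃ k : K, c - algebraMap K _ k ∈ Ideal.span (Set.range (psr n K).x) := by
  refine ⟨coeff 0 c, (mem_spanX _).2 ?_⟩
  rw [map_sub, MvPowerSeries.algebraMap_apply, sub_eq_zero]
  exact (coeff_zero_C _).symm

end PSF
end HL
end

section
namespace HL
open Finset MvPowerSeries

section krull
variable {R : Type} [CommRing R] [IsNoetherianRing R]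

lemma krull_sup [IsLocalRing R] (J : Ideal R) (z : R) (h : ∀ N, z ∈ J ⊔ maximalIdeal R ^ N) : z ∈ J := by
  have h1 := Ideal.iInf_pow_smul_eq_bot_of_isLocalRing (R := R) (M := R ⧸ J) (maximalIdeal R) (Ideal.IsPrime.ne_top')
  have h2 : (Ideal.Quotient.mk J z : R ⧸ J) ∈ (⨅ i : ℕ, maximalIdeal R ^ i • (⊤ : Submodule R (R ⧸ J))) := by
    rw [Submodule.mem_iInf]
    intro N
    obtain ⟨a, ha, b, hb, rfl⟩ := Submodule.mem_sup.1 (h N)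
    rw [map_add, Ideal.Quotient.eq_zero_iff_mem.2 ha, zero_add]
    have : (Ideal.Quotient.mk J b : R ⧸ J) = b • (1 : R ⧸ J) := by
      rw [Algebra.smul_def, mul_one]; rfl
    rw [this]
    exact Submodule.smul_mem_smul hb trivial
  rw [h1, Submodule.mem_bot, Ideal.Quotient.eq_zero_iff_mem] at h2
  exact h2

lemma krull_prime (𝔔 𝔞 J : Ideal R) [𝔔.IsPrime] (h𝔞 : 𝔞 ≤ 𝔔) (z : R)
    (h : ∀ N, ∃ t, t ∉ 𝔔 ∧ t * z ∈ J ⊔ 𝔞 ^ N) : ∃ s, s ∉ 𝔔 ∧ s * z ∈ J := by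
  let L := Localization.AtPrime 𝔔
  have : IsNoetherianRing L := IsLocalization.isNoetherianRing 𝔔.primeCompl _ inferInstance
  have key : algebraMap R L z ∈ J.map (algebraMap R L) := by
    apply krull_sup
    intro N
    obtain ⟨t, ht, htz⟩ := h N
    have hu : IsUnit (algebraMap R L t) := IsLocalization.map_units L (⟨t, ht⟩ : 𝔔.primeCompl)
    obtain ⟨a, ha, b, hb, hab⟩ := Submodule.mem_sup.1 htz
    have : algebraMap R L t * algebraMap R L z ∈ J.map (algebraMap R L) ⊔ maximalIdeal L ^ N := by
      rw [← map_mul, ← hab, map_add]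
      refine Submodule.add_mem_sup (Ideal.mem_map_of_mem _ ha) ?_
      have h1 : algebraMap R L b ∈ (𝔞 ^ N).map (algebraMap R L) := Ideal.mem_map_of_mem _ hb
      rw [Ideal.map_pow] at h1
      refine Ideal.pow_right_mono ?_ N h1
      rw [Ideal.map_le_iff_le_comap]
      intro x hx
      rw [Ideal.mem_comap, ← Localization.AtPrime.map_eq_maximalIdeal]
      exact Ideal.mem_map_of_mem _ (h𝔞 hx)
    exact (Ideal.unit_mul_mem_iff_mem _ hu).1 this
  obtain ⟨⟨j, s⟩, hjs⟩ := (IsLocalization.mem_map_algebraMap_iff 𝔔.primeCompl L).1 key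
  simp only [← map_mul] at hjs
  obtain ⟨c, hc⟩ := (IsLocalization.eq_iff_exists 𝔔.primeCompl L).1 hjs
  refine ⟨c * s, fun hm => ?_, ?_⟩
  · rcases (inferInstance : 𝔔.IsPrime).mem_or_mem hm with h1 | h1
    · exact c.2 h1
    · exact s.2 h1
  · have : (c * s : R) * z = c * j := by rw [← hc]; ring
    rw [this]
    exact J.mul_mem_left _ j.2

end krull

section tay
variable (n : ℕ) (K : Type) [Field K]

abbrev PC := MvPowerSeries (Fin n) K
abbrev PB := MvPowerSeries (Fin n) (PC n K)

noncomputable abbrev tau : PC n K →+* PB n K := MvPowerSeries.map (algebraMap K (PC n K))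

variable {n K}

noncomputable def muf (b : PB n K) : PC n K := fun δ => ∑ p ∈ antidiagonal δ, coeff p.2 (coeff p.1 b)

lemma coeff_muf (b : PB n K) (δ) : coeff δ (muf b) = ∑ p ∈ antidiagonal δ, coeff p.2 (coeff p.1 b) := rfl

lemma muf_C (c : PC n K) : muf (MvPowerSeries.C c) = c := by
  classical
  ext δ
  rw [coeff_muf, Finset.sum_eq_single (0, δ)]
  · rw [coeff_zero_C]
  · rintro ⟨p, q⟩ hp h
    rw [HasAntidiagonal.mem_antidiagonal] at hp
    dsimp only at hp ⊢
    rw [coeff_C, if_neg, map_zero]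
    rintro rfl
    rw [zero_add] at hp
    exact h (by rw [hp])
  · intro h
    exact absurd (HasAntidiagonal.mem_antidiagonal.2 (zero_add _)) h

lemma muf_mul (b b' : PB n K) : muf (b * b') = muf b * muf b' := by
  classical
  ext δ
  rw [coeff_muf, coeff_mul]
  simp only [coeff_mul, coeff_muf, map_sum, Finset.sum_mul_sum]
  rw [Finset.sum_sigma', Finset.sum_sigma', Finset.sum_sigma', Finset.sum_sigma']
  refine Finset.sum_bij' (fun x _ => ⟨⟨(x.1.2.1 + x.2.1, x.1.2.2 + x.2.2), (x.1.2.1, x.2.1)⟩, (x.1.2.2, x.2.2)⟩)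
    (fun x _ => ⟨⟨(x.1.2.1 + x.2.1, x.1.2.2 + x.2.2), (x.1.2.1, x.2.1)⟩, (x.1.2.2, x.2.2)⟩) ?_ ?_ ?_ ?_ ?_
  · rintro ⟨⟨⟨a1, a2⟩, ⟨b1, b2⟩⟩, ⟨c1, c2⟩⟩ hx
    simp only [mem_sigma, HasAntidiagonal.mem_antidiagonal] at hx ⊢
    obtain ⟨⟨rfl, rfl⟩, rfl⟩ := hx
    exact ⟨⟨add_add_add_comm _ _ _ _, trivial⟩, trivial⟩
  · rintro ⟨⟨⟨a1, a2⟩, ⟨b1, b2⟩⟩, ⟨c1, c2⟩⟩ hx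
    simp only [mem_sigma, HasAntidiagonal.mem_antidiagonal] at hx ⊢
    obtain ⟨⟨rfl, rfl⟩, rfl⟩ := hx
    exact ⟨⟨add_add_add_comm _ _ _ _, trivial⟩, trivial⟩
  · rintro ⟨⟨⟨a1, a2⟩, ⟨b1, b2⟩⟩, ⟨c1, c2⟩⟩ hx
    simp only [mem_sigma, HasAntidiagonal.mem_antidiagonal] at hx ⊢
    obtain ⟨⟨rfl, rfl⟩, rfl⟩ := hx
    rfl
  · rintro ⟨⟨⟨a1, a2⟩, ⟨b1, b2⟩⟩, ⟨c1, c2⟩⟩ hx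
    simp only [mem_sigma, HasAntidiagonal.mem_antidiagonal] at hx ⊢
    obtain ⟨⟨rfl, rfl⟩, rfl⟩ := hx
    rfl
  · rintro ⟨⟨⟨a1, a2⟩, ⟨b1, b2⟩⟩, ⟨c1, c2⟩⟩ hx
    rfl

noncomputable def mu : PB n K →+* PC n K where
  toFun := muf
  map_one' := by rw [← map_one MvPowerSeries.C, muf_C]
  map_mul' := muf_mul
  map_zero' := by rw [← map_zero MvPowerSeries.C, muf_C]
  map_add' a b := by
    ext δ
    simp only [coeff_muf, map_add, Finset.sum_add_distrib]

lemma mu_C (c : PC n K) : mu (MvPowerSeries.C c) = c := muf_C c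

lemma mu_tau (c : PC n K) : mu (tau n K c) = c := by
  classical
  ext δ
  change coeff δ (muf _) = _
  rw [coeff_muf, Finset.sum_eq_single (δ, 0)]
  · rw [coeff_map, MvPowerSeries.algebraMap_apply, coeff_zero_C]; rfl
  · rintro ⟨p, q⟩ hp h
    rw [HasAntidiagonal.mem_antidiagonal] at hp
    dsimp only at hp ⊢
    rw [coeff_map, MvPowerSeries.algebraMap_apply, coeff_C, if_neg]
    rintro rfl
    rw [add_zero] at hp
    exact h (by rw [hp])
  · intro h
    exact absurd (HasAntidiagonal.mem_antidiagonal.2 (add_zero _)) h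

lemma tau_X (i : Fin n) : tau n K (X i) = X i := by
  simp [tau]

noncomputable def YY (i : Fin n) : PB n K := X i - MvPowerSeries.C (X i)

variable (n K) in
noncomputable def aI : Ideal (PB n K) := Ideal.span (Set.range YY)

lemma mu_YY (i : Fin n) : mu (YY (K := K) i) = 0 := by
  rw [YY, map_sub, mu_C, ← tau_X, mu_tau, sub_self]

noncomputable def Ypow (α : Fin n →₀ ℕ) : PB n K := ∏ i, YY i ^ α i

variable (n) in
noncomputable def degLT (k : ℕ) : Finset (Fin n →₀ ℕ) := (Finsupp.finite_of_degree_le (σ := Fin n) k).toFinset.filter (fun α => α.degree < k)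

lemma mem_degLT {k : ℕ} {α : Fin n →₀ ℕ} : α ∈ degLT n k ↔ α.degree < k := by
  rw [degLT, Finset.mem_filter, Set.Finite.mem_toFinset]
  exact ⟨fun h => h.2, fun h => ⟨le_of_lt h, h⟩⟩

/-- Taylor remainder -/
noncomputable def Err (k : ℕ) (c : PC n K) : PB n K :=
  tau n K c - ∑ α ∈ degLT n k, MvPowerSeries.C ((psr n K).d α c) * Ypow α

lemma Err_add (k : ℕ) (b c : PC n K) : Err k (b + c) = Err k b + Err k c := by
  simp only [Err, map_add, add_mul, Finset.sum_add_distrib]; ring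

lemma Err_zero (c : PC n K) : Err 0 c = tau n K c := by
  rw [Err, Finset.sum_eq_zero, sub_zero]
  intro α hα
  rw [mem_degLT] at hα; omega

lemma Err_cst (k : ℕ) (a : K) : Err (n := n) (K := K) (k+1) (algebraMap K _ a) = 0 := by
  classical
  rw [Err, Finset.sum_eq_single 0, sub_eq_zero, HSR.d_zero]
  · have : Ypow (0 : Fin n →₀ ℕ) = (1 : PB n K) := by simp [Ypow]
    rw [this, mul_one]
    rw [MvPowerSeries.algebraMap_apply, Algebra.algebraMap_self_apply, MvPowerSeries.map_C, MvPowerSeries.algebraMap_apply, Algebra.algebraMap_self_apply]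
  · intro α _ hα
    rw [psr_cst n K a α hα, map_zero, zero_mul]
  · intro h
    exact absurd (mem_degLT.2 (by simp)) h

lemma Ypow_succ (α : Fin n →₀ ℕ) (i : Fin n) : Ypow (α + Finsupp.single i 1) = YY (K := K) i * Ypow α := by
  classical
  simp only [Ypow, Finsupp.add_apply, pow_add, Finset.prod_mul_distrib]
  rw [mul_comm, Finset.prod_eq_single i (f := fun x => YY x ^ (Finsupp.single i 1) x)]
  · simp
  · intro b _ hb
    rw [Finsupp.single_eq_of_ne hb, pow_zero]
  · simp

lemma Err_X (k : ℕ) (i : Fin n) (c : PC n K) :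
    Err (k+1) (X i * c) = MvPowerSeries.C (X i) * Err (k+1) c + YY i * Err k c := by
  classical
  have hd : ∀ α, (psr n K).d α (X i * c) = X i * (psr n K).d α c + if α i = 0 then 0 else (psr n K).d (α - Finsupp.single i 1) c := by
    intro α
    split_ifs with h
    · rw [add_zero]; exact (HS.self (psr n K)).D_x' α i c h
    · exact (HS.self (psr n K)).D_x α i c h
  have hs : ∑ α ∈ degLT n (k+1), MvPowerSeries.C (if α i = 0 then 0 else (psr n K).d (α - Finsupp.single i 1) c) * Ypow α
      = YY i * ∑ α ∈ degLT n k, MvPowerSeries.C ((psr n K).d α c) * Ypow α := by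
    rw [Finset.mul_sum]
    symm
    refine Finset.sum_of_injOn (fun α => α + Finsupp.single i 1) ?_ ?_ ?_ ?_
    · intro a _ b _ h; exact add_right_cancel h
    · intro a ha
      have := mem_degLT.1 ha
      refine mem_degLT.2 ?_
      rw [map_add, Finsupp.degree_single]; omega
    · intro α hα hn
      rw [if_pos, map_zero, zero_mul]
      by_contra h0
      have hle : Finsupp.single i 1 ≤ α := by rw [Finsupp.single_le_iff]; omega
      refine hn ⟨α - Finsupp.single i 1, ?_, tsub_add_cancel_of_le hle⟩
      refine mem_degLT.2 ?_
      have h1 := mem_degLT.1 hα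
      have h2 := congrArg Finsupp.degree (tsub_add_cancel_of_le hle)
      rw [map_add, Finsupp.degree_single] at h2
      omega
    · intro α _
      rw [Ypow_succ, if_neg, add_tsub_cancel_right]
      · ring
      · simp
  rw [Err, Err, Err]
  simp only [hd, map_add, add_mul, Finset.sum_add_distrib, hs]
  rw [map_mul, tau_X]
  simp only [map_mul, mul_assoc, ← Finset.mul_sum]
  rw [YY]
  ring

lemma Err_mem (k : ℕ) (c : PC n K) : Err k c ∈ aI n K ^ k := by
  have hXm : ∀ i : Fin n, (MvPowerSeries.C (X i : PC n K) : PB n K) ∈ maximalIdeal (PB n K) := by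
    intro i
    rw [mem_maximalIdeal, mem_nonunits_iff]
    intro hu
    have := (hu.map mu)
    rw [mu_C] at this
    have h2 : (X i : PC n K) ∈ maximalIdeal (PC n K) := by
      rw [← spanX_max]; exact Ideal.subset_span ⟨i, rfl⟩
    exact h2 this
  have hYm : ∀ i : Fin n, YY (K := K) i ∈ maximalIdeal (PB n K) := by
    intro i
    rw [mem_maximalIdeal, mem_nonunits_iff]
    intro hu
    have := (hu.map mu)
    rw [mu_YY] at this
    exact not_isUnit_zero this
  have key : ∀ M c k, Err (K := K) (n := n) k c ∈ aI n K ^ k ⊔ maximalIdeal (PB n K) ^ M := by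
    intro M
    induction M with
    | zero => intro c k; rw [pow_zero, Ideal.one_eq_top]; simp
    | succ M ih =>
      intro c k
      cases k with
      | zero => rw [pow_zero, Ideal.one_eq_top]; simp
      | succ k =>
      obtain ⟨a, ha⟩ := psr_split n K c
      have hc : c = (c - algebraMap K _ a) + algebraMap K _ a := by ring
      rw [hc, Err_add, Err_cst, add_zero]
      revert ha
      generalize c - algebraMap K _ a = c'
      intro ha
      clear hc
      have hz : ∀ k, Err (n := n) (K := K) k 0 = 0 := by
        intro k; simp [Err]
      obtain ⟨w, rfl⟩ := (Submodule.mem_span_range_iff_exists_fun _).1 ha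
      have hsum : ∀ s : Finset (Fin n), Err (k+1) (∑ i ∈ s, w i • (psr n K).x i) ∈ aI n K ^ (k+1) ⊔ maximalIdeal (PB n K) ^ (M+1) := by
        intro s
        classical
        induction s using Finset.induction_on with
        | empty => rw [Finset.sum_empty, hz]; exact zero_mem _
        | insert i s hi ih' =>
          rw [Finset.sum_insert hi, Err_add]
          refine add_mem ?_ ih'
          rw [smul_eq_mul, mul_comm, psr_x, Err_X]
          refine add_mem ?_ ?_
          · obtain ⟨u, hu, v, hv, huv⟩ := Submodule.mem_sup.1 (ih (w i) (k+1))
            rw [← huv, mul_add]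
            refine Submodule.add_mem_sup (Ideal.mul_mem_left _ _ hu) ?_
            rw [pow_succ']
            exact Ideal.mul_mem_mul (hXm i) hv
          · obtain ⟨u, hu, v, hv, huv⟩ := Submodule.mem_sup.1 (ih (w i) k)
            rw [← huv, mul_add]
            refine Submodule.add_mem_sup ?_ ?_
            · rw [pow_succ']
              exact Ideal.mul_mem_mul (Ideal.subset_span ⟨i, rfl⟩) hu
            · rw [pow_succ']
              exact Ideal.mul_mem_mul (hYm i) hv
      exact hsum _
  exact krull_sup _ _ fun M => key M c k

end tay
end HL
end

section
namespace HL
open Finset MvPowerSeries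

section slice
variable {n : ℕ} {K : Type} [Field K]

/-- coefficientwise application of a functional -/
noncomputable def slc (l : PC n K →ₗ[K] K) (b : PB n K) : PC n K := fun β => l (coeff β b)

lemma coeff_slc (l : PC n K →ₗ[K] K) (b : PB n K) (β) : coeff β (slc l b) = l (coeff β b) := rfl

lemma slc_add (l : PC n K →ₗ[K] K) (b c : PB n K) : slc l (b + c) = slc l b + slc l c := by
  ext β; simp only [coeff_slc, map_add]

lemma slc_zero (l : PC n K →ₗ[K] K) : slc l (0 : PB n K) = 0 := by
  ext β; simp only [coeff_slc, map_zero]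

lemma slc_tau (l : PC n K →ₗ[K] K) (c : PC n K) (b : PB n K) : slc l (tau n K c * b) = c * slc l b := by
  classical
  ext β
  rw [coeff_slc, coeff_mul, coeff_mul, map_sum]
  refine Finset.sum_congr rfl fun p _ => ?_
  rw [coeff_map, coeff_slc, ← Algebra.smul_def, map_smul, smul_eq_mul]

lemma slc_P (l : PC n K →ₗ[K] K) (P : Ideal (PC n K)) (hl : ∀ c ∈ P, l c = 0) (b : PB n K)
    (hb : b ∈ P.map (MvPowerSeries.C (σ := Fin n))) : slc l b = 0 := by
  classical
  have : ∀ β, coeff β b ∈ P := by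
    intro β
    induction hb using Submodule.span_induction generalizing β with
    | mem x hx =>
      obtain ⟨c, hc, rfl⟩ := hx
      rw [coeff_C]
      split_ifs
      · exact hc
      · exact zero_mem _
    | zero => rw [map_zero]; exact zero_mem _
    | add x y _ _ hx hy => rw [map_add]; exact add_mem (hx β) (hy β)
    | smul a x _ hx =>
      rw [smul_eq_mul, coeff_mul]
      exact Ideal.sum_mem _ fun p _ => Ideal.mul_mem_left _ _ (hx _)
  ext β
  rw [coeff_slc, hl _ (this β), map_zero]

lemma slc_Q (l : PC n K →ₗ[K] K) (Q : Ideal (PC n K)) (b : PB n K)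
    (hb : b ∈ Q.map (tau n K)) : slc l b ∈ Q := by
  have : ∀ a, slc l (a * b) ∈ Q := by
    induction hb using Submodule.span_induction with
    | mem x hx =>
      intro a
      obtain ⟨c, hc, rfl⟩ := hx
      rw [mul_comm, slc_tau]
      exact Ideal.mul_mem_right _ _ hc
    | zero => intro a; rw [mul_zero, slc_zero]; exact zero_mem _
    | add x y _ _ hx hy => intro a; rw [mul_add, slc_add]; exact add_mem (hx a) (hy a)
    | smul b x _ hx =>
      intro a
      rw [smul_eq_mul, ← mul_assoc]
      exact hx _
  have h1 := this 1
  rwa [one_mul] at h1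

lemma fin_codim (N : ℕ) : ∃ V : Submodule K (PC n K), V.FG ∧
    ∀ c : PC n K, ∃ v ∈ V, c - v ∈ maximalIdeal (PC n K) ^ N := by
  induction N with
  | zero => exact ⟨⊥, Submodule.fg_bot, fun c => ⟨0, zero_mem _, by simp⟩⟩
  | succ N ih =>
    obtain ⟨V, hV, h⟩ := ih
    refine ⟨Submodule.span K {1} ⊔ ⨆ i : Fin n, V.map (LinearMap.mulLeft K (X i : PC n K)), ?_, ?_⟩
    · exact (Submodule.fg_span_singleton _).sup (Submodule.fg_iSup _ fun i => hV.map _)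
    · intro c
      obtain ⟨a, ha⟩ := psr_split n K c
      obtain ⟨w, hw⟩ := (Submodule.mem_span_range_iff_exists_fun _).1 ha
      choose v hv hv' using h
      refine ⟨algebraMap K _ a + ∑ i, X i * v (w i), add_mem ?_ ?_, ?_⟩
      · refine Submodule.mem_sup_left ?_
        rw [Algebra.algebraMap_eq_smul_one]
        exact Submodule.smul_mem _ _ (Submodule.subset_span rfl)
      · refine Submodule.mem_sup_right (Submodule.sum_mem _ fun i _ => ?_)
        exact (le_iSup (fun i : Fin n => V.map (LinearMap.mulLeft K (X i : PC n K))) i) ⟨v (w i), hv _, rfl⟩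
      · rw [← sub_sub, ← hw, ← Finset.sum_sub_distrib]
        refine Ideal.sum_mem _ fun i _ => ?_
        rw [smul_eq_mul, psr_x, mul_comm, ← mul_sub, pow_succ']
        refine Ideal.mul_mem_mul ?_ (hv' _)
        rw [← spanX_max]; exact Ideal.subset_span ⟨i, rfl⟩

lemma coords (P : Ideal (PC n K)) (N : ℕ) : ∃ (m : ℕ) (l : Fin m → (PC n K →ₗ[K] K)) (e : Fin m → PC n K),
    (∀ j, ∀ c ∈ P, l j c = 0) ∧ ∀ c, c - ∑ j, l j c • e j ∈ P ⊔ maximalIdeal (PC n K) ^ N := by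
  obtain ⟨V, hV, h⟩ := fin_codim (n := n) (K := K) N
  let J := P ⊔ maximalIdeal (PC n K) ^ N
  have : Module.Finite K (PC n K ⧸ J) := by
    refine ⟨?_⟩
    have : (⊤ : Submodule K (PC n K ⧸ J)) = V.map (Ideal.Quotient.mkₐ K J).toLinearMap := by
      refine le_antisymm ?_ le_top
      intro x _
      obtain ⟨c, rfl⟩ := Ideal.Quotient.mk_surjective x
      obtain ⟨v, hv, hv'⟩ := h c
      refine ⟨v, hv, ?_⟩
      symm
      exact Ideal.Quotient.eq.2 (Submodule.mem_sup_right hv')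
    rw [this]
    exact hV.map _
  let b := Module.finBasis K (PC n K ⧸ J)
  choose e he using fun j => Ideal.Quotient.mk_surjective (b j)
  refine ⟨_, fun j => (b.coord j).comp (Ideal.Quotient.mkₐ K J).toLinearMap, e, ?_, ?_⟩
  · intro j c hc
    change b.coord j (Ideal.Quotient.mk J c) = 0
    rw [Ideal.Quotient.eq_zero_iff_mem.2 (Submodule.mem_sup_left hc), map_zero]
  · intro c
    rw [← Ideal.Quotient.eq_zero_iff_mem, map_sub, sub_eq_zero, map_sum]
    rw [← b.sum_repr (Ideal.Quotient.mk _ c)]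
    refine Finset.sum_congr rfl fun j _ => ?_
    rw [← he j]
    rfl

lemma flat_slice (P Q : Ideal (PC n K)) (γ : PC n K) (h : PB n K) (hh : mu h ∉ P)
    (hm : h * tau n K γ ∈ Q.map (tau n K) ⊔ P.map (MvPowerSeries.C (σ := Fin n))) : ∃ s, s ∉ P ∧ s * γ ∈ Q := by
  by_contra hc
  push Not at hc
  refine hh (krull_sup _ _ fun N => ?_)
  obtain ⟨m, l, e, hl, he⟩ := coords P N
  have h1 : ∀ j, slc (l j) h ∈ P := by
    intro j
    by_contra hj
    refine hc _ hj ?_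
    obtain ⟨a, ha, b, hb, hab⟩ := Submodule.mem_sup.1 hm
    rw [mul_comm, ← slc_tau, mul_comm, ← hab, slc_add, slc_P _ P (hl j) b hb, add_zero]
    exact slc_Q _ _ _ ha
  have h2 : h - ∑ j, MvPowerSeries.C (e j) * tau n K (slc (l j) h) ∈
      (P ⊔ maximalIdeal (PC n K) ^ N).map (MvPowerSeries.C (σ := Fin n)) := by
    refine mem_map_C (IsNoetherian.noetherian _) _ fun β => ?_
    rw [map_sub, map_sum]
    convert he (coeff β h) using 2
    refine Finset.sum_congr rfl fun j _ => ?_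
    rw [coeff_C_mul, coeff_map, coeff_slc, mul_comm, Algebra.smul_def]
  have h3 := Ideal.mem_map_of_mem (mu (n := n) (K := K)) h2
  rw [Ideal.map_map] at h3
  have h4 : (mu (n := n) (K := K)).comp (MvPowerSeries.C) = RingHom.id _ := by
    ext1 c; exact mu_C c
  rw [h4, Ideal.map_id, map_sub, map_sum] at h3
  simp only [map_mul, mu_C, mu_tau] at h3
  refine (Submodule.sub_mem_iff_left _ ?_).1 h3
  exact Ideal.sum_mem _ fun j _ => Ideal.mul_mem_left _ _ (Submodule.mem_sup_left (h1 j))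

theorem tay_pure (P Q : Ideal (PC n K)) [P.IsPrime] (γ : PC n K)
    (h : ∀ N, ∃ t r γ', t ∉ P ∧ t * γ - r * γ' ∈ Q ∧ ∀ α : Fin n →₀ ℕ, α.degree ≤ N → (psr n K).d α γ' ∈ P) :
    ∃ s, s ∉ P ∧ s * γ ∈ Q := by
  have : (P.comap (mu (n := n) (K := K))).IsPrime := inferInstance
  have k1 : aI n K ≤ P.comap (mu (n := n) (K := K)) := by
    rw [aI, Ideal.span_le]
    rintro _ ⟨i, rfl⟩
    change mu _ ∈ P
    rw [mu_YY]; exact zero_mem _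
  have k2 : ∀ N, ∃ t, t ∉ P.comap (mu (n := n) (K := K)) ∧ t * tau n K γ ∈
      (Q.map (tau n K) ⊔ P.map (MvPowerSeries.C (σ := Fin n))) ⊔ aI n K ^ N := by
    intro N
    obtain ⟨t, r, γ', ht, hQ, hd⟩ := h N
    refine ⟨tau n K t, ?_, ?_⟩
    · rw [Ideal.mem_comap, mu_tau]; exact ht
    have e : tau n K t * tau n K γ = (tau n K (t * γ - r * γ') + tau n K r * ∑ α ∈ degLT n N, MvPowerSeries.C ((psr n K).d α γ') * Ypow α)
        + tau n K r * Err N γ' := by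
      rw [Err, map_sub, map_mul, map_mul]; ring
    rw [e]
    refine Submodule.add_mem_sup (Submodule.add_mem_sup (Ideal.mem_map_of_mem _ hQ) ?_) (Ideal.mul_mem_left _ _ (Err_mem _ _))
    refine Ideal.mul_mem_left _ _ (Ideal.sum_mem _ fun α hα => Ideal.mul_mem_right _ _ (Ideal.mem_map_of_mem _ (hd α ?_)))
    exact le_of_lt (mem_degLT.1 hα)
  obtain ⟨h', h1, h2⟩ := krull_prime _ _ _ k1 (tau n K γ) k2
  exact flat_slice P Q γ h' h1 h2

end slice
end HL
end

section
namespace HL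
open Finset MvPowerSeries

section G
variable {n : ℕ} {K : Type} [Field K]

lemma Gam_D {C : Type} [CommRing C] {h : HSR n C} {N : Type} [AddCommGroup N] [Module C N] (H : HS h N) (I : Ideal C) (α) (v : N) (hv : v ∈ Gam I N) :
    H.D α v ∈ Gam I N := by
  obtain ⟨k, hk⟩ := hv
  exact ⟨k + α.degree, H.pow_D I k v hk α _ le_rfl⟩

lemma tor_Gam {C : Type} [CommRing C] {N : Type} [AddCommGroup N] [Module C N] (I : Ideal C) (k : ℕ) : tor (I^k) N ≤ Gam I N :=
  fun v hv => ⟨k, hv⟩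

lemma tor_Gam1 {C : Type} [CommRing C] {N : Type} [AddCommGroup N] [Module C N] (I : Ideal C) : tor I N ≤ Gam I N :=
  fun v hv => ⟨1, by rw [pow_one]; exact hv⟩

/-- comparison of Taylor coefficients -/
lemma tay_cmp {C : Type} [CommRing C] {h : HSR n C} {N : Type} [AddCommGroup N] [Module C N] (H : HS h N) (v v' : N) (M : ℕ) (s c : C)
    (h0 : ∀ β : Fin n →₀ ℕ, β.degree ≤ M → c • H.D β v = s • H.D β v') (α : Fin n →₀ ℕ) :
    ∀ β : Fin n →₀ ℕ, α.degree + β.degree ≤ M → h.d α c • H.D β v = h.d α s • H.D β v' := by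
  classical
  induction α using WellFoundedLT.induction with
  | ind α ih =>
    intro β hb
    have h1 := congrArg (H.D α) (h0 β (by omega))
    rw [H.D_smul, H.D_smul] at h1
    have hmem : (α, (0 : Fin n →₀ ℕ)) ∈ antidiagonal α := HasAntidiagonal.mem_antidiagonal.2 (add_zero _)
    rw [← Finset.add_sum_erase _ _ hmem, ← Finset.add_sum_erase _ _ hmem] at h1
    have h2 : ∑ x ∈ (antidiagonal α).erase (α, 0), h.d x.1 c • H.D x.2 (H.D β v) =
        ∑ x ∈ (antidiagonal α).erase (α, 0), h.d x.1 s • H.D x.2 (H.D β v') := by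
      refine Finset.sum_congr rfl fun x hx => ?_
      obtain ⟨hx1, hx2⟩ := Finset.mem_erase.1 hx
      rw [HasAntidiagonal.mem_antidiagonal] at hx2
      have hle : x.1 ≤ α := by rw [← hx2]; exact le_self_add
      have hlt : x.1 < α := lt_of_le_of_ne hle fun h => hx1 (by
        rw [h] at hx2
        exact Prod.ext h (by simpa using hx2))
      rw [H.D_D, H.D_D, smul_comm _ (ch _ _), smul_comm _ (ch _ _)]
      congr 1
      refine ih x.1 hlt _ ?_
      have := congrArg Finsupp.degree hx2
      rw [map_add] at this ⊢
      omega
    rw [h2] at h1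
    have h3 := add_right_cancel h1
    rwa [H.D_zero, H.D_zero] at h3

lemma G_core {N : Type} [AddCommGroup N] [Module (PC n K) N] (H : HS (psr n K) N) (I : Ideal (PC n K))
    (g : Gam I N →ₗ[PC n K] N) (hg : HSL (H.sub (Gam I N) (Gam_D H I)) H g)
    (a : PC n K) (ha : ∀ v (hv : v ∈ tor I N), g ⟨v, tor_Gam1 I hv⟩ = a • v)
    (p P : Ideal (PC n K)) (hp : p.IsPrime) (w : Gam I N) (hw : ∀ r : PC n K, r • g w = 0 ↔ r ∈ p)
    (hP : P.IsPrime) (hpP : p ≤ P) (haP : a ∈ P)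
    (gen : ∀ k, ∃ s, s ∉ P ∧ ∃ c : PC n K, ∀ v (hv : v ∈ tor (I^k) N), s • g ⟨v, tor_Gam I k hv⟩ = c • v) : False := by
  obtain ⟨k, hk⟩ := w.2
  have hIp : I ≤ p := by
    apply hp.le_of_pow_le (n := k)
    intro r hr
    rw [← hw, ← map_smul]
    have : r • w = 0 := Subtype.ext (hk r hr)
    rw [this, map_zero]
  have hv : g w ∈ tor I N := fun r hr => (hw r).2 (hIp hr)
  choose s hs c hc using gen
  have hder : ∀ M, ∀ α : Fin n →₀ ℕ, α.degree ≤ M → (psr n K).d α (c (1+M)) ∈ P := by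
    intro M α hα
    have h0 : ∀ β : Fin n →₀ ℕ, β.degree ≤ M → c (1+M) • H.D β (g w) = s (1+M) • H.D β (a • g w) := by
      intro β hb
      have hm : H.D β (g w) ∈ tor (I^(1+M)) N :=
        H.pow_D I 1 (g w) (by rw [pow_one]; exact hv) β M hb
      rw [← hc (1+M) _ hm]
      congr 1
      have := hg β ⟨g w, tor_Gam1 I hv⟩
      rw [ha _ hv] at this
      rw [← this]
      rfl
    have h1 := tay_cmp H (g w) (a • g w) M _ _ h0 α 0 (by simpa using hα)
    rw [H.D_zero, H.D_zero, smul_smul, ← sub_eq_zero, ← sub_smul, hw] at h1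
    have h2 := add_mem (hpP h1) (P.mul_mem_left ((psr n K).d α (s (1+M))) haP)
    rwa [sub_add_cancel] at h2
  let Q : Ideal (PC n K) := Module.annihilator (PC n K) (tor (I^k) N)
  have hQ : ∀ r, r ∈ Q ↔ ∀ v ∈ tor (I^k) N, r • v = 0 := by
    intro r
    rw [Module.mem_annihilator]
    exact ⟨fun h v hv => congrArg Subtype.val (h ⟨v, hv⟩), fun h v => Subtype.ext (h v v.2)⟩
  obtain ⟨t, ht, htQ⟩ := tay_pure P Q (c k) (fun M => by
    refine ⟨s (1 + (M + k)), s k, c (1 + (M + k)), hs _, ?_, fun α hα => hder (M+k) α (by omega)⟩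
    rw [hQ]
    intro v hv
    have hv' : v ∈ tor (I^(1+(M+k))) N := tor_mono (Ideal.pow_le_pow_right (by omega)) N hv
    rw [sub_smul, mul_smul, mul_smul, ← hc _ v hv, ← hc _ v hv', smul_comm, sub_self])
  have h1 := (hQ _).1 htQ w hk
  rw [mul_smul, ← hc k w hk, smul_smul, hw] at h1
  rcases hP.mem_or_mem (hpP h1) with h2 | h2
  · exact ht h2
  · exact hs k h2

theorem G_rig {xs f : List (PC n K)} (R : Rg xs) (hf : NZL f (ModuleCat.of (PC n K) (PC n K))) (I : Ideal (PC n K))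
    (hfI : ∀ b ∈ f, b ∈ I) (hF : ∀ φ : tor I (HA f) →ₗ[PC n K] HA f, ∃ r : PC n K, ∀ v, φ v = r • (v : HA f))
    (hne : ∃ v ∈ Gam I (HA f), v ≠ 0) (H : HS (psr n K) (HA f)) :
    Rig (H.sub (Gam I (HA f)) (Gam_D H I)) H (Gam I (HA f)).subtype := by
  refine ⟨fun α v => rfl, ?_, ?_⟩
  · obtain ⟨v, hv, hv0⟩ := hne
    intro h0
    exact hv0 (LinearMap.congr_fun h0 ⟨v, hv⟩ : _)
  intro g hg
  obtain ⟨a, ha⟩ := hF (g.comp (Submodule.inclusion (tor_Gam1 I)))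
  obtain ⟨k, hk⟩ := psr_split n K a
  have hkc := psr_cst n K k
  revert hk hkc
  generalize algebraMap K (PC n K) k = k'
  intro hk hkc
  refine ⟨k', hkc, ?_⟩
  rw [← sub_eq_zero]
  set g' := g - k' • (Gam I (HA f)).subtype with hg'
  have hgl : HSL (H.sub (Gam I (HA f)) (Gam_D H I)) H g' := by
    intro α v
    rw [hg', LinearMap.sub_apply, LinearMap.sub_apply, LinearMap.smul_apply, LinearMap.smul_apply, map_sub, hg α v, H.D_cst hkc]
    rfl
  have ha' : ∀ v (hv : v ∈ tor I (HA f)), g' ⟨v, tor_Gam1 I hv⟩ = (a - k') • v := by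
    intro v hv
    rw [hg', LinearMap.sub_apply, LinearMap.smul_apply, sub_smul, ← ha ⟨v, hv⟩]
    rfl
  clear_value g'
  have ham : a - k' ∈ maximalIdeal (PC n K) := by
    rw [← spanX_max]; exact hk
  revert ha' ham
  generalize a - k' = a'
  intro ha' ham
  by_contra hne
  obtain ⟨w0, hw0⟩ : ∃ w, g' w ≠ 0 := by
    by_contra hc; push Not at hc; exact hne (LinearMap.ext hc)
  obtain ⟨p, c, hp, hpc⟩ := exists_ann (A := PC n K) (g' w0) hw0
  rw [← map_smul] at hpc
  have hGr := Gr_of_ann hp hf _ hpc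
  obtain ⟨P, q, hq, hql, hpP, haP⟩ : ∃ (P : Ideal (PC n K)) (q : List (PC n K)), Gr q P ∧ q.length ≤ f.length + 1 ∧ p ≤ P ∧ a' ∈ P := by
    by_cases hap : a' ∈ p
    · exact ⟨p, f, hGr, by omega, le_rfl, hap⟩
    · have hle : p ⊔ Ideal.span {a'} ≤ maximalIdeal (PC n K) := by
        refine sup_le (IsLocalRing.le_maximalIdeal hp.ne_top) ?_
        rw [Ideal.span_singleton_le_iff_mem]; exact ham
      obtain ⟨P, hP, _⟩ := Ideal.exists_minimalPrimes_le hle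
      obtain ⟨q, hq⟩ := exists_Gr R P hP.1.1
      have h1 : p ≤ P := le_sup_left.trans hP.1.2
      have h2 : a' ∈ P := hP.1.2 (Submodule.mem_sup_right (Ideal.mem_span_singleton_self _))
      refine ⟨P, q, hq, hGr.cover R hq h1 a' h2 hap ?_, h1, h2⟩
      intro Q hQ hpQ haQ hQP
      refine le_antisymm hQP (hP.2 ⟨hQ, sup_le hpQ ?_⟩ hQP)
      rw [Ideal.span_singleton_le_iff_mem]; exact haQ
  refine G_core H I g' hgl a' ha' p P hp (c • w0) hpc hq.pr hpP haP fun k => ?_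
  have hpk : pI k f ≤ I^k := by
    rw [pI, Ideal.span_le]
    rintro _ ⟨b, hb, rfl⟩
    exact Ideal.pow_mem_pow (hfI b hb) k
  obtain ⟨s, hs, b, hb⟩ := gen_lem R hf k (I^k) hpk hq (fun b hb => hpP (hGr.mem b hb)) hql (g'.comp (Submodule.inclusion (tor_Gam I k)))
  exact ⟨s, hs, b, fun v hv => hb ⟨v, hv⟩⟩

end G
end HL
end

section
namespace HL
section Bc
open TensorProduct
variable {S : Type} [CommRing S] {G N : Type} [AddCommGroup G] [Module S G] [AddCommGroup N] [Module S N]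

/-- the map `g ⊗ -` -/
noncomputable abbrev tm (G N : Type) [AddCommGroup G] [Module S G] [AddCommGroup N] [Module S N] (g : G) : N →ₗ[S] G ⊗[S] N :=
  TensorProduct.mk S G N g

noncomputable def pw {m r : ℕ} (z : Fin r → Fin m → S) (N : Type) [AddCommGroup N] [Module S N] : (Fin m → N) →ₗ[S] (Fin r → N) :=
  LinearMap.pi fun j => ∑ i, z j i • LinearMap.proj i

lemma pw_apply {m r : ℕ} (z : Fin r → Fin m → S) (v : Fin m → N) (j : Fin r) : pw z N v j = ∑ i, z j i • v i := by
  simp [pw]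

lemma pw_tens {m r : ℕ} (z : Fin r → Fin m → S) (t : G ⊗[S] (Fin m → N)) (j : Fin r) :
    TensorProduct.piRight S S G (fun _ => N) ((pw z N).lTensor G t) j
      = ∑ i, z j i • TensorProduct.piRight S S G (fun _ => N) t i := by
  induction t using TensorProduct.induction_on with
  | zero => simp
  | add a b ha hb => simp only [map_add, Pi.add_apply, ha, hb, smul_add, Finset.sum_add_distrib]
  | tmul g v =>
    rw [LinearMap.lTensor_tmul, TensorProduct.piRight_apply, TensorProduct.piRight_apply,
      TensorProduct.piRightHom_tmul, TensorProduct.piRightHom_tmul]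
    beta_reduce
    rw [pw_apply, TensorProduct.tmul_sum]
    simp only [TensorProduct.tmul_smul]

lemma flatHom [IsNoetherianRing S] [Module.Flat S G] {X : Type} [AddCommGroup X] [Module S X] [Module.Finite S X]
    (φ : X →ₗ[S] G ⊗[S] N) : φ ∈ Submodule.span S {ψ : X →ₗ[S] G ⊗[S] N | ∃ g ψ', ψ = tm G N g ∘ₗ ψ'} := by
  classical
  obtain ⟨m, π, hπ⟩ := Module.Finite.exists_fin' S X
  obtain ⟨r, z, hz⟩ := Submodule.fg_iff_exists_fin_generating_family.1 (IsNoetherian.noetherian (LinearMap.ker π))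
  have hzk : ∀ j, π (z j) = 0 := fun j => by
    have : z j ∈ LinearMap.ker π := hz ▸ Submodule.subset_span ⟨j, rfl⟩
    exact this
  have hsum : ∀ (M : Type) [AddCommGroup M] [Module S M] (L : (Fin m → S) →ₗ[S] M) (w : Fin m → S), 
     L w = ∑ i, w i • L (Pi.single i 1) := fun M _ _ L w => by
    conv_lhs => rw [pi_eq_sum_univ' w]
    rw [map_sum]
    refine Finset.sum_congr rfl fun i _ => ?_
    rw [map_smul]
  let θ := TensorProduct.piRight S S G (fun _ : Fin m => N)
  obtain ⟨t, ht⟩ := θ.surjective (fun i => φ (π (Pi.single i 1)))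
  have h0 : (pw z N).lTensor G t = 0 := by
    apply (TensorProduct.piRight S S G (fun _ : Fin r => N)).injective
    ext j
    rw [pw_tens, map_zero]
    change ∑ i, z j i • (θ t) i = 0
    rw [ht]
    have := hsum _ (φ ∘ₗ π) (z j)
    simp only [LinearMap.comp_apply, hzk, map_zero] at this
    exact this.symm
  have hex := Module.Flat.lTensor_exact G (LinearMap.exact_subtype_ker_map (pw z N))
  obtain ⟨t', ht'⟩ := (hex t).1 h0
  -- lift
  have hlift : ∀ v ∈ LinearMap.ker (pw z N), ∃ ψ : X →ₗ[S] N, ∀ i, ψ (π (Pi.single i 1)) = v i := by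
    intro v hv
    let ℓ : (Fin m → S) →ₗ[S] N := ∑ i, (LinearMap.toSpanSingleton S N (v i)) ∘ₗ LinearMap.proj i
    have hℓ : ∀ w, ℓ w = ∑ i, w i • v i := fun w => by simp [ℓ]
    have hk : LinearMap.ker π ≤ LinearMap.ker ℓ := by
      rw [← hz, Submodule.span_le]
      rintro _ ⟨j, rfl⟩
      change ℓ (z j) = 0
      rw [hℓ, ← pw_apply, LinearMap.mem_ker.1 hv]; rfl
    refine ⟨(LinearMap.ker π).liftQ ℓ hk ∘ₗ (π.quotKerEquivOfSurjective hπ).symm.toLinearMap, fun i => ?_⟩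
    have : (π.quotKerEquivOfSurjective hπ).symm (π (Pi.single i 1)) = (LinearMap.ker π).mkQ (Pi.single i 1) := by
      rw [LinearEquiv.symm_apply_eq]; rfl
    change (LinearMap.ker π).liftQ ℓ hk ((π.quotKerEquivOfSurjective hπ).symm (π (Pi.single i 1))) = _
    rw [this, Submodule.mkQ_apply, Submodule.liftQ_apply, hℓ]
    simp [Pi.single_apply]
  have key : ∀ t' : G ⊗[S] (LinearMap.ker (pw z N)), ∃ ψ ∈ Submodule.span S {ψ : X →ₗ[S] G ⊗[S] N | ∃ g ψ', ψ = tm G N g ∘ₗ ψ'},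
      ∀ i, ψ (π (Pi.single i 1)) = θ ((LinearMap.ker (pw z N)).subtype.lTensor G t') i := by
    intro t'
    induction t' using TensorProduct.induction_on with
    | zero => exact ⟨0, zero_mem _, by simp⟩
    | add a b ha hb =>
      obtain ⟨p, hp, hp'⟩ := ha
      obtain ⟨q, hq, hq'⟩ := hb
      exact ⟨p + q, add_mem hp hq, fun i => by simp [hp', hq']⟩
    | tmul g v =>
      obtain ⟨ψ, hψ⟩ := hlift v v.2
      refine ⟨tm G N g ∘ₗ ψ, Submodule.subset_span ⟨g, ψ, rfl⟩, fun i => ?_⟩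
      rw [LinearMap.lTensor_tmul, TensorProduct.piRight_apply, TensorProduct.piRightHom_tmul, LinearMap.comp_apply, hψ]
      rfl
  obtain ⟨ψ, hψ, e⟩ := key t'
  rw [ht', ht] at e
  have : ψ = φ := by
    ext x
    obtain ⟨w, rfl⟩ := hπ x
    have h1 := hsum _ (ψ ∘ₗ π) w
    have h2 := hsum _ (φ ∘ₗ π) w
    simp only [LinearMap.comp_apply] at h1 h2
    rw [h1, h2]
    exact Finset.sum_congr rfl fun i _ => by rw [e i]
  exact this ▸ hψ

/-- Lemma L -/
lemma flatExt [IsNoetherianRing S] [Module.Flat S G] (i : ℕ) : ∀ {X : Type} [AddCommGroup X] [Module S X] [Module.Finite S X]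
    (e : EE S X (G ⊗[S] N) i), e ∈ Submodule.span S {ψ : EE S X (G ⊗[S] N) i | ∃ g ψ', ψ = EE.post (tm G N g) i ψ'} := by
  induction i with
  | zero =>
    intro X _ _ _ e
    have := flatHom (EE.hom0 e)
    have h2 := Submodule.mem_map_of_mem (f := EE.hom0.symm.toLinearMap) this
    rw [LinearEquiv.coe_coe, LinearEquiv.symm_apply_apply, Submodule.map_span] at h2
    refine Submodule.span_mono ?_ h2
    rintro _ ⟨_, ⟨g, ψ, rfl⟩, rfl⟩
    refine ⟨g, EE.hom0.symm ψ, ?_⟩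
    rw [LinearEquiv.coe_coe, LinearEquiv.symm_apply_eq, EE.hom0_post, LinearEquiv.apply_symm_apply]
  | succ i ih =>
    intro X _ _ _ e
    obtain ⟨m, π, hπ⟩ := Module.Finite.exists_fin' S X
    have h : SES (LinearMap.ker π).subtype π := ⟨Submodule.subtype_injective _, LinearMap.exact_subtype_ker_map π, hπ⟩
    obtain ⟨e1, rfl⟩ := (EE.exL3 h i e).1 (EE.proj i _)
    have := ih e1
    have h2 := Submodule.mem_map_of_mem (f := EE.dL h i) this
    rw [Submodule.map_span] at h2
    refine Submodule.span_mono ?_ h2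
    rintro _ ⟨_, ⟨g, ψ, rfl⟩, rfl⟩
    exact ⟨g, EE.dL h i ψ, by rw [EE.post_dL]⟩

/-- vanishing -/
lemma flatExt_zero [IsNoetherianRing S] [Module.Flat S G] (m : Ideal S) (hm : ∀ g : G, g ∈ m • (⊤ : Submodule S G)) (i : ℕ)
    (e : EE S (S ⧸ m) (G ⊗[S] N) i) : e = 0 := by
  have h := flatExt i e
  have hz : Submodule.span S {ψ : EE S (S ⧸ m) (G ⊗[S] N) i | ∃ g ψ', ψ = EE.post (tm G N g) i ψ'} ≤ ⊥ := by
    rw [Submodule.span_le]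
    rintro _ ⟨g, ψ, rfl⟩
    have := hm g
    change _ = _
    induction this using Submodule.smul_induction_on' with
    | smul r hr g' _ =>
      have : tm G N (r • g') = (tm G N g') ∘ₗ (r • (LinearMap.id : N →ₗ[S] N)) := by
        ext v; simp [TensorProduct.smul_tmul']
      rw [this, ← EE.post_post, ← EE.smul_post r, EE.smul_eq_zero_left r (smul_quot_zero hr), map_zero]
    | add g1 _ g2 _ h1 h2 =>
      have : tm (S := S) G N (g1 + g2) = tm (S := S) G N g1 + tm (S := S) G N g2 := by ext v; simp [TensorProduct.add_tmul]
      rw [this, EE.post_add, h1, h2, add_zero]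
  exact hz h

end Bc
end HL
end

section
namespace HL
section Bd
open TensorProduct
variable {S C : Type} [CommRing S] [CommRing C] [Algebra S C] {N N' : Type} [AddCommGroup N] [Module S N] [AddCommGroup N'] [Module C N']

/-- `j` exhibits `N'` as the base change of `N` -/
def BC (j : N →ₗ[S] Rs S C N') : Prop := Function.Bijective (j.liftBaseChange C)

lemma lb_tm (j : N →ₗ[S] Rs S C N') (c : C) (v : N) : j.liftBaseChange C (c ⊗ₜ[S] v) = c • j v := LinearMap.liftBaseChange_tmul ..

noncomputable def BC.eqv {j : N →ₗ[S] Rs S C N'} (h : BC j) : (C ⊗[S] N) ≃ₗ[S] Rs S C N' :=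
  LinearEquiv.ofBijective ((j.liftBaseChange C).restrictScalars S) h

lemma BC.eqv_tm {j : N →ₗ[S] Rs S C N'} (h : BC j) (c : C) (v : N) : h.eqv (c ⊗ₜ[S] v) = c • j v := lb_tm j c v

lemma BC.inj [Module.FaithfullyFlat S C] {j : N →ₗ[S] Rs S C N'} (h : BC j) : Function.Injective j := by
  have : j = h.eqv.toLinearMap ∘ₗ tm C N 1 := by
    ext v
    exact ((h.eqv_tm 1 v).trans (one_smul C _)).symm
  rw [this]
  exact h.eqv.injective.comp (Module.FaithfullyFlat.tensorProduct_mk_injective N)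

noncomputable def bcSelf (S C : Type) [CommRing S] [CommRing C] [Algebra S C] : S →ₗ[S] Rs S C C where
  toFun := algebraMap S C
  map_add' := map_add _
  map_smul' r s := by
    change algebraMap S C (r * s) = algebraMap S C r * algebraMap S C s
    rw [map_mul]

lemma BC.self : BC (bcSelf S C) := by
  have : (LinearMap.liftBaseChange C (bcSelf S C) : C ⊗[S] S →ₗ[C] Rs S C C) = (show C ⊗[S] S →ₗ[C] Rs S C C from (AlgebraTensorModule.rid S C C).toLinearMap) := by
    apply TensorProduct.AlgebraTensorModule.curry_injective
    ext
    change LinearMap.liftBaseChange C (bcSelf S C) (1 ⊗ₜ 1) = AlgebraTensorModule.rid S C C (1 ⊗ₜ 1)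
    rw [AlgebraTensorModule.rid_tmul, lb_tm, one_smul, one_smul]
    exact map_one (algebraMap S C)
  rw [BC, this]; exact (AlgebraTensorModule.rid S C C).bijective

lemma BC.nzd [Module.Flat S C] {j : N →ₗ[S] Rs S C N'} (h : BC j) {a : S} (ha : NZD a N) : NZD (algebraMap S C a) N' := by
  intro v hv
  obtain ⟨t, rfl⟩ := h.eqv.surjective (show Rs S C N' from v)
  have h1 : h.eqv (a • t) = 0 := by rw [map_smul]; exact hv
  have h2 : a • t = 0 := by rwa [LinearEquiv.map_eq_zero_iff] at h1
  have hi : Function.Injective ((a • LinearMap.id : N →ₗ[S] N).lTensor C) :=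
    Module.Flat.lTensor_preserves_injective_linearMap _ (by
      rw [injective_iff_map_eq_zero]; exact fun v hv => ha v hv)
  have h3 : t = 0 := by
    rw [injective_iff_map_eq_zero] at hi
    apply hi
    rw [LinearMap.lTensor_smul, LinearMap.lTensor_id]; exact h2
  rw [h3]; exact map_zero h.eqv

lemma BC.nzd' [Module.FaithfullyFlat S C] {j : N →ₗ[S] Rs S C N'} (h : BC j) {a : S} (ha : NZD (algebraMap S C a) N') : NZD a N := by
  intro v hv
  apply (injective_iff_map_eq_zero j).1 h.inj
  apply ha
  change a • j v = 0
  rw [← map_smul, hv, map_zero]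

/-- base change of localization -/
noncomputable def bcLoc (a : S) (j : N →ₗ[S] Rs S C N') : Loc a N →ₗ[S] Rs S C (Loc (algebraMap S C a) N') :=
  LocalizedModule.lift (Submonoid.powers a) (Rs.map S C (toLoc (algebraMap S C a) N') ∘ₗ j)
    (isUnit_of_bij (show Function.Bijective (fun v : Rs S C (Loc (algebraMap S C a) N') => a • v) from loc_bij _ _))

lemma bcLoc_to (a : S) (j : N →ₗ[S] Rs S C N') (v : N) : bcLoc a j (toLoc a N v) = toLoc (algebraMap S C a) N' (j v) :=
  LinearMap.congr_fun (LocalizedModule.lift_comp (Submonoid.powers a) (Rs.map S C (toLoc (algebraMap S C a) N') ∘ₗ j)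
    (isUnit_of_bij (show Function.Bijective (fun v : Rs S C (Loc (algebraMap S C a) N') => a • v) from loc_bij _ _))) v

lemma bcLoc_fr (a : S) (j : N →ₗ[S] Rs S C N') (k : ℕ) (v : N) : bcLoc a j (fr a k v) = fr (algebraMap S C a) k (j v) := by
  apply loc_inj (y := algebraMap S C a) (N := N') k
  refine Eq.trans ?_ (pow_fr (algebraMap S C a) (N := N') k (j v)).symm
  refine Eq.trans ?_ (bcLoc_to a j v)
  rw [← pow_fr a k v, map_smul (bcLoc a j) (a^k) (fr a k v), ← map_pow]
  rfl

noncomputable def bcH1 (a : S) (j : N →ₗ[S] Rs S C N') : H1 a N →ₗ[S] Rs S C (H1 (algebraMap S C a) N') :=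
  (LinearMap.range (toLoc a N)).liftQ (Rs.map S C (qH1 (algebraMap S C a) N') ∘ₗ bcLoc a j) (by
    rintro _ ⟨v, rfl⟩
    change qH1 _ _ (bcLoc a j (toLoc a N v)) = 0
    rw [bcLoc_to]
    exact (qH1_eq_zero _).2 ⟨_, rfl⟩)

lemma bcH1_ej (a : S) (j : N →ₗ[S] Rs S C N') (k : ℕ) (v : N) : bcH1 a j (ej a k v) = ej (algebraMap S C a) k (j v) := by
  change qH1 _ _ (bcLoc a j (fr a k v)) = qH1 _ _ _
  rw [bcLoc_fr]

lemma bcH1_ej_t (a : S) (j : N →ₗ[S] Rs S C N') (k : ℕ) (u : C ⊗[S] N) :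
    (bcH1 a j).liftBaseChange C ((ej a k).lTensor C u) = (ej (algebraMap S C a) k (show N' from j.liftBaseChange C u) : H1 (algebraMap S C a) N') := by
  induction u using TensorProduct.induction_on with
  | zero => 
    rw [map_zero, map_zero, map_zero]; exact (map_zero (ej (algebraMap S C a) (N := N') k)).symm
  | add x y hx hy => 
    rw [map_add, map_add, map_add, hx, hy]; exact (map_add (ej (algebraMap S C a) (N := N') k) _ _).symm
  | tmul c v =>
    rw [LinearMap.lTensor_tmul, lb_tm, lb_tm, bcH1_ej]
    exact (map_smul (ej (algebraMap S C a) (N := N') k) c _).symm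

lemma ejt_pow (a : S) (m k : ℕ) (u : C ⊗[S] N) : (ej a (m+k)).lTensor C (a^m • u) = (ej a k).lTensor C u := by
  induction u using TensorProduct.induction_on with
  | zero => rw [smul_zero, map_zero, map_zero]
  | add x y hx hy => rw [smul_add, map_add, map_add, hx, hy]
  | tmul c v => rw [← TensorProduct.tmul_smul, LinearMap.lTensor_tmul, LinearMap.lTensor_tmul, ej_pow]

lemma ejt_surj (a : S) (t : C ⊗[S] (H1 a N)) : ∃ k u, t = (ej a k).lTensor C u := by
  induction t using TensorProduct.induction_on with
  | zero => exact ⟨0, 0, by rw [map_zero]⟩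
  | add x y hx hy =>
    obtain ⟨k, u, rfl⟩ := hx
    obtain ⟨l, w, rfl⟩ := hy
    refine ⟨k + l, a^l • u + a^k • w, ?_⟩
    rw [map_add, ejt_pow, add_comm k l, ejt_pow]
  | tmul c x =>
    obtain ⟨k, v, rfl⟩ := ej_surj a x
    exact ⟨k, c ⊗ₜ v, by rw [LinearMap.lTensor_tmul]⟩

lemma ejt_zero (a : S) (k : ℕ) (w : C ⊗[S] N) : (ej a k).lTensor C (a^k • w) = 0 := by
  have := ejt_pow a k 0 w
  rw [add_zero] at this
  rw [this]
  have : (ej a 0 : N →ₗ[S] H1 a N) = 0 := LinearMap.ext fun v => ej_zero a v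
  rw [this, LinearMap.lTensor_zero, LinearMap.zero_apply]

lemma BC.h1 {j : N →ₗ[S] Rs S C N'} (h : BC j) (a : S) : BC (bcH1 a j) := by
  constructor
  · rw [injective_iff_map_eq_zero]
    intro t ht
    obtain ⟨k, u, rfl⟩ := ejt_surj a t
    rw [bcH1_ej_t] at ht
    obtain ⟨m, w', e⟩ := (ej_eq_zero (algebraMap S C a)).1 ht
    obtain ⟨w, rfl⟩ := h.eqv.surjective (show Rs S C N' from w')
    have : a^m • u = a^(m+k) • w := by
      apply h.eqv.injective
      rw [map_smul, map_smul]
      rw [← map_pow, ← map_pow] at e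
      exact e
    rw [← ejt_pow a m k, this, ejt_zero]
  · intro x
    obtain ⟨k, v, rfl⟩ := ej_surj (algebraMap S C a) (show H1 (algebraMap S C a) N' from x)
    obtain ⟨u, rfl⟩ := h.2 (show Rs S C N' from v)
    exact ⟨_, bcH1_ej_t a j k u⟩

lemma BC.hl [Module.Flat S C] (f : List S) : ∀ {N : ModuleCat.{0} S} {N' : ModuleCat.{0} C} {j : N →ₗ[S] Rs S C N'} (h : BC j),
    ∃ j' : HL f N →ₗ[S] Rs S C (HL (f.map (algebraMap S C)) N'), BC j' := by
  induction f with
  | nil => intro N N' j h; exact ⟨j, h⟩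
  | cons a f ih =>
    intro N N' j h
    obtain ⟨j', h'⟩ := ih h
    exact ⟨bcH1 a j', h'.h1 a⟩

lemma BC.nzl [Module.Flat S C] (f : List S) : ∀ {N : ModuleCat.{0} S} {N' : ModuleCat.{0} C} {j : N →ₗ[S] Rs S C N'} (h : BC j),
    NZL f N → NZL (f.map (algebraMap S C)) N' := by
  induction f with
  | nil => intro N N' j h _; trivial
  | cons a f ih =>
    intro N N' j h hn
    obtain ⟨j', h'⟩ := BC.hl f h
    exact ⟨h'.nzd hn.1, ih h hn.2⟩

lemma BC.nzl' [Module.FaithfullyFlat S C] (f : List S) : ∀ {N : ModuleCat.{0} S} {N' : ModuleCat.{0} C} {j : N →ₗ[S] Rs S C N'} (h : BC j),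
    NZL (f.map (algebraMap S C)) N' → NZL f N := by
  induction f with
  | nil => intro N N' j h _; trivial
  | cons a f ih =>
    intro N N' j h hn
    obtain ⟨j', h'⟩ := BC.hl f h
    exact ⟨h'.nzd' hn.1, ih h hn.2⟩

lemma nzl_iff [Module.FaithfullyFlat S C] (f : List S) : 
    NZL (f.map (algebraMap S C)) (ModuleCat.of C C) ↔ NZL f (ModuleCat.of S S) :=
  ⟨BC.nzl' f (N := ModuleCat.of S S) (N' := ModuleCat.of C C) BC.self, BC.nzl f (N := ModuleCat.of S S) (N' := ModuleCat.of C C) BC.self⟩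

end Bd
end HL
end

section
namespace HL
section Be
open TensorProduct
variable {S C : Type} [CommRing S] [CommRing C] [Algebra S C] {N N' : Type} [AddCommGroup N] [Module S N] [AddCommGroup N'] [Module C N']

abbrev CQ (S C : Type) [CommRing S] [CommRing C] [Algebra S C] : Type := C ⧸ LinearMap.range (Algebra.linearMap S C)

lemma ses_bc [Module.FaithfullyFlat S C] (N : Type) [AddCommGroup N] [Module S N] :
    SES (tm (S := S) C N 1) ((LinearMap.range (Algebra.linearMap S C)).mkQ.rTensor N) := by
  refine ⟨Module.FaithfullyFlat.tensorProduct_mk_injective N, ?_, LinearMap.rTensor_surjective N (Submodule.mkQ_surjective _)⟩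
  have h := rTensor_exact N (f := Algebra.linearMap S C) (g := (LinearMap.range (Algebra.linearMap S C)).mkQ)
    (fun x => by rw [← LinearMap.mem_ker, Submodule.ker_mkQ]; rfl) (Submodule.mkQ_surjective _)
  intro t
  rw [h t]
  constructor
  · rintro ⟨u, rfl⟩
    refine ⟨TensorProduct.lid S N u, ?_⟩
    induction u using TensorProduct.induction_on with
    | zero => simp
    | add x y hx hy => rw [map_add, map_add, map_add, hx, hy]
    | tmul s v => simp [Algebra.algebraMap_eq_smul_one, TensorProduct.smul_tmul']
  · rintro ⟨v, rfl⟩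
    exact ⟨1 ⊗ₜ v, by simp⟩

lemma flat_CQ [Module.FaithfullyFlat S C] : Module.Flat S (CQ S C) := by
  rw [Module.Flat.iff_lTensor_preserves_injective_linearMap]
  intro A B _ _ _ _ f hf
  rw [injective_iff_map_eq_zero]
  intro x hx
  obtain ⟨t, rfl⟩ := (ses_bc (S := S) (C := C) A).surj x
  have e1 : (LinearMap.range (Algebra.linearMap S C)).mkQ.rTensor B (f.lTensor C t) = 0 := by
    rw [← hx, ← LinearMap.comp_apply, ← LinearMap.comp_apply, LinearMap.lTensor_comp_rTensor, LinearMap.rTensor_comp_lTensor]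
  obtain ⟨b, hb⟩ := ((ses_bc (S := S) (C := C) B).ex _).1 e1
  have e2 : tm (S := S) C (B ⧸ LinearMap.range f) 1 ((LinearMap.range f).mkQ b) = 0 := by
    have : tm (S := S) C (B ⧸ LinearMap.range f) 1 ((LinearMap.range f).mkQ b) = (LinearMap.range f).mkQ.lTensor C (tm (S := S) C B 1 b) := rfl
    rw [this, hb, ← LinearMap.comp_apply, ← LinearMap.lTensor_comp, LinearMap.range_mkQ_comp, LinearMap.lTensor_zero]; rfl
  have e3 := (injective_iff_map_eq_zero _).1 (ses_bc (S := S) (C := C) (B ⧸ LinearMap.range f)).inj _ e2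
  obtain ⟨a, rfl⟩ : b ∈ LinearMap.range f := by
    rwa [Submodule.mkQ_apply, Submodule.Quotient.mk_eq_zero] at e3
  have e4 : t = tm (S := S) C A 1 a := by
    apply Module.Flat.lTensor_preserves_injective_linearMap (M := C) f hf
    rw [← hb]; rfl
  exact ((ses_bc (S := S) (C := C) A).ex _).2 ⟨a, e4.symm⟩

lemma BC.ext [IsNoetherianRing S] [Module.FaithfullyFlat S C] {j : N →ₗ[S] Rs S C N'} (h : BC j) (m : Ideal S)
    (hC : ∀ c : C, ∃ s : S, c - algebraMap S C s ∈ m.map (algebraMap S C)) (i : ℕ) :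
    Nonempty (EE S (S ⧸ m) N i ≃ₗ[S] EE S (S ⧸ m) (Rs S C N') i) := by
  haveI := flat_CQ (S := S) (C := C)
  have hm : ∀ g : CQ S C, g ∈ m • (⊤ : Submodule S (CQ S C)) := by
    intro g
    obtain ⟨c, rfl⟩ := Submodule.mkQ_surjective _ g
    obtain ⟨s, hs⟩ := hC c
    have h1 : (LinearMap.range (Algebra.linearMap S C)).mkQ c = (LinearMap.range (Algebra.linearMap S C)).mkQ (c - algebraMap S C s) := by
      rw [map_sub, eq_comm, sub_eq_self, Submodule.mkQ_apply, Submodule.Quotient.mk_eq_zero]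
      exact ⟨s, rfl⟩
    rw [h1]
    have h2 : c - algebraMap S C s ∈ m • (⊤ : Submodule S C) := by
      rw [Ideal.smul_top_eq_map]; exact hs
    have h3 := Submodule.mem_map_of_mem (f := (LinearMap.range (Algebra.linearMap S C)).mkQ) h2
    rw [Submodule.map_smul''] at h3
    exact Submodule.smul_mono le_rfl le_top h3
  have hz := fun i => flatExt_zero (S := S) (G := CQ S C) (N := N) m hm i
  have hs := ses_bc (S := S) (C := C) N
  have hb : Function.Bijective (EE.post (X := S ⧸ m) (tm (S := S) C N 1) i) := by
    constructor
    · rw [injective_iff_map_eq_zero]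
      cases i with
      | zero => exact (injective_iff_map_eq_zero _).1 (EE.post_inj0 _ hs.inj)
      | succ i =>
        intro e he
        obtain ⟨e', rfl⟩ := (EE.exR1 hs i e).1 he
        rw [hz i e', map_zero]
    · intro e
      exact (EE.exR2 hs i e).1 (hz i _)
  exact ⟨(LinearEquiv.ofBijective _ hb).trans (EE.postE h.eqv i)⟩

lemma BC.tor_mem {j : N →ₗ[S] Rs S C N'} (J : Ideal S) {v : N} (hv : v ∈ tor J N) : (j v : N') ∈ tor (J.map (algebraMap S C)) N' := by
  intro c hc
  change c • j v = 0
  induction hc using Submodule.span_induction with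
  | zero => exact zero_smul C _
  | add x y _ _ hx hy => rw [add_smul, hx, hy, add_zero]
  | smul a x _ hx => rw [smul_eq_mul, mul_smul, hx, smul_zero]
  | mem x hx => 
    obtain ⟨r, hr, rfl⟩ := hx
    change r • j v = 0
    rw [← map_smul j, hv r hr, map_zero]

lemma BC.tor_span [IsNoetherianRing S] [Module.Flat S C] {j : N →ₗ[S] Rs S C N'} (h : BC j) (J : Ideal S) (v : Rs S C N')
    (hv : (show N' from v) ∈ tor (J.map (algebraMap S C)) N') : v ∈ Submodule.span C (Set.image j (tor J N)) := by
  let φ : (S ⧸ J) →ₗ[S] Rs S C N' := J.liftQ (LinearMap.toSpanSingleton S _ v) (fun r hr => by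
    rw [LinearMap.mem_ker, LinearMap.toSpanSingleton_apply]
    exact hv _ (Ideal.mem_map_of_mem _ hr))
  have hφ : φ ((Submodule.mkQ J) 1) = v := by
    rw [Submodule.mkQ_apply, Submodule.liftQ_apply, LinearMap.toSpanSingleton_apply, one_smul]
  have key : ∀ ψ ∈ Submodule.span S {ψ : (S ⧸ J) →ₗ[S] C ⊗[S] N | ∃ g ψ', ψ = tm C N g ∘ₗ ψ'},
     h.eqv (ψ (Submodule.mkQ J 1)) ∈ Submodule.span C (Set.image j (tor J N)) := by
    intro ψ hψ
    induction hψ using Submodule.span_induction with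
    | zero => rw [LinearMap.zero_apply, map_zero]; exact zero_mem _
    | add x y _ _ hx hy => rw [LinearMap.add_apply, map_add]; exact add_mem hx hy
    | smul a x _ hx => 
      rw [LinearMap.smul_apply, map_smul]
      exact Submodule.smul_mem _ (algebraMap S C a) hx
    | mem x hx =>
      obtain ⟨c, ψ', rfl⟩ := hx
      rw [LinearMap.comp_apply]
      change h.eqv (c ⊗ₜ _) ∈ _
      rw [h.eqv_tm]
      refine Submodule.smul_mem _ c (Submodule.subset_span ⟨_, ?_, rfl⟩)
      intro r hr
      rw [← map_smul, smul_quot_zero hr, map_zero]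
  have := key _ (flatHom (h.eqv.symm.toLinearMap ∘ₗ φ))
  rw [LinearMap.comp_apply, hφ] at this
  simpa using this

/-- base change of sections with support -/
noncomputable def bcGam (j : N →ₗ[S] Rs S C N') (I : Ideal S) : Gam I N →ₗ[S] Rs S C (Gam (I.map (algebraMap S C)) N') where
  toFun v := ⟨j v, by
    obtain ⟨k, hk⟩ := v.2
    refine ⟨k, ?_⟩
    rw [← Ideal.map_pow]
    exact BC.tor_mem (I^k) hk⟩
  map_add' u v := Subtype.ext (map_add j u.1 v.1)
  map_smul' r v := Subtype.ext (map_smul j r v.1)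

lemma bcGam_t (j : N →ₗ[S] Rs S C N') (I : Ideal S) (t : C ⊗[S] (Gam I N)) :
    (show Gam (I.map (algebraMap S C)) N' from (bcGam j I).liftBaseChange C t).1 = j.liftBaseChange C ((Gam I N).subtype.lTensor C t) := by
  induction t using TensorProduct.induction_on with
  | zero => rw [map_zero, map_zero, map_zero]; rfl
  | add x y hx hy => 
    rw [map_add, map_add, map_add, ← hx, ← hy]; rfl
  | tmul c v =>
    rw [LinearMap.lTensor_tmul, lb_tm, lb_tm]; rfl

lemma BC.gam [IsNoetherianRing S] [Module.Flat S C] {j : N →ₗ[S] Rs S C N'} (h : BC j) (I : Ideal S) : BC (bcGam j I) := by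
  constructor
  · rw [injective_iff_map_eq_zero]
    intro t ht
    have h1 := bcGam_t j I t
    rw [ht] at h1
    have h2 : (Gam I N).subtype.lTensor C t = 0 := (injective_iff_map_eq_zero _).1 h.1 _ h1.symm
    exact (injective_iff_map_eq_zero _).1 (Module.Flat.lTensor_preserves_injective_linearMap _ (Submodule.subtype_injective _)) _ h2
  · rintro ⟨w, k, hk⟩
    rw [← Ideal.map_pow] at hk
    have hw := h.tor_span (I^k) w hk
    have key : ∀ w ∈ Submodule.span C (Set.image j (tor (I^k) N)), ∃ t : C ⊗[S] (Gam I N), j.liftBaseChange C ((Gam I N).subtype.lTensor C t) = w := by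
      intro w hw
      induction hw using Submodule.span_induction with
      | zero => exact ⟨0, by rw [map_zero, map_zero]⟩
      | add x y _ _ hx hy =>
        obtain ⟨s, rfl⟩ := hx
        obtain ⟨t, rfl⟩ := hy
        exact ⟨s + t, by rw [map_add, map_add]⟩
      | smul a x _ hx =>
        obtain ⟨t, rfl⟩ := hx
        refine ⟨a • t, ?_⟩
        rw [← map_smul]
        congr 1
        rename_i hx
        clear hx
        induction t using TensorProduct.induction_on with
        | zero => rw [smul_zero, map_zero, smul_zero]
        | add x y hx hy => rw [smul_add, map_add, map_add, hx, hy, smul_add]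
        | tmul c v => rw [TensorProduct.smul_tmul', LinearMap.lTensor_tmul, LinearMap.lTensor_tmul, TensorProduct.smul_tmul']
      | mem x hx =>
        obtain ⟨v, hv, rfl⟩ := hx
        refine ⟨1 ⊗ₜ ⟨v, k, hv⟩, ?_⟩
        rw [LinearMap.lTensor_tmul, lb_tm, one_smul]; rfl
    obtain ⟨t, ht⟩ := key w hw
    exact ⟨t, Subtype.ext ((bcGam_t j I t).trans ht)⟩

lemma BC.endo [IsNoetherianRing S] [Module.Flat S C] {j : N →ₗ[S] Rs S C N'} (h : BC j) (I : Ideal S) [Module.Finite S (tor I N)]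
    (hF : ∀ φ : tor I N →ₗ[S] N, ∃ r : S, ∀ v, φ v = r • (v : N))
    (φ : tor (I.map (algebraMap S C)) N' →ₗ[C] N') : ∃ r : C, ∀ v, φ v = r • (v : N') := by
  let j0 : tor I N →ₗ[S] Rs S C (tor (I.map (algebraMap S C)) N') :=
    { toFun := fun v => ⟨j v, BC.tor_mem I v.2⟩
      map_add' := fun u v => Subtype.ext (map_add j u.1 v.1)
      map_smul' := fun r v => Subtype.ext (map_smul j r v.1) }
  have key : ∀ ψ ∈ Submodule.span S {ψ : (tor I N) →ₗ[S] C ⊗[S] N | ∃ g ψ', ψ = tm C N g ∘ₗ ψ'},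
     ∃ r : C, ∀ v : tor I N, h.eqv (ψ v) = r • j v := by
    intro ψ hψ
    induction hψ using Submodule.span_induction with
    | zero => exact ⟨0, fun v => by rw [LinearMap.zero_apply, map_zero, zero_smul]⟩
    | add x y _ _ hx hy => 
      obtain ⟨r, hr⟩ := hx
      obtain ⟨s, hs⟩ := hy
      exact ⟨r + s, fun v => by rw [LinearMap.add_apply, map_add, hr, hs, add_smul]⟩
    | smul a x _ hx => 
      obtain ⟨r, hr⟩ := hx
      refine ⟨a • r, fun v => ?_⟩
      rw [LinearMap.smul_apply, map_smul, hr, smul_assoc]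
    | mem x hx =>
      obtain ⟨c, ψ', rfl⟩ := hx
      obtain ⟨r, hr⟩ := hF ψ'
      refine ⟨c * algebraMap S C r, fun v => ?_⟩
      rw [LinearMap.comp_apply]
      change h.eqv (c ⊗ₜ _) = _
      rw [h.eqv_tm, hr, map_smul, mul_smul]; rfl
  obtain ⟨r, hr⟩ := key _ (flatHom (h.eqv.symm.toLinearMap ∘ₗ Rs.map S C φ ∘ₗ j0))
  refine ⟨r, ?_⟩
  have hr' : ∀ v : tor I N, φ (show tor (I.map (algebraMap S C)) N' from j0 v) = r • (show N' from j v) := fun v => by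
    have := hr v
    rw [LinearMap.comp_apply, LinearEquiv.coe_coe, LinearEquiv.apply_symm_apply] at this
    exact this
  have hall : ∀ w ∈ Submodule.span C (Set.image j (tor I N)), ∃ hw : (show N' from w) ∈ tor (I.map (algebraMap S C)) N', φ ⟨w, hw⟩ = r • (show N' from w) := by
    intro w hw
    induction hw using Submodule.span_induction with
    | zero => exact ⟨zero_mem _, (map_zero φ).trans (smul_zero r).symm⟩
    | add x y _ _ hx hy =>
      obtain ⟨h1, e1⟩ := hx
      obtain ⟨h2, e2⟩ := hy
      refine ⟨add_mem h1 h2, ?_⟩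
      refine (map_add φ ⟨x, h1⟩ ⟨y, h2⟩).trans ?_
      rw [e1, e2]; exact (smul_add r _ _).symm
    | smul a x _ hx =>
      obtain ⟨h1, e1⟩ := hx
      refine ⟨Submodule.smul_mem _ a h1, ?_⟩
      refine (map_smul φ a ⟨x, h1⟩).trans ?_
      rw [e1]; exact smul_comm a r (show N' from x)
    | mem x hx =>
      obtain ⟨v, hv, rfl⟩ := hx
      exact ⟨BC.tor_mem I hv, hr' ⟨v, hv⟩⟩
  intro v
  obtain ⟨_, e⟩ := hall v.1 (h.tor_span I v.1 v.2)
  exact e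
end Be
end HL
end

section
namespace HL
open MvPolynomial TensorProduct in
/-- Jacobian criterion for vanishing of the first cotangent homology. -/
theorem h1_crit (R A : Type) [CommRing R] [CommRing A] [Algebra R A] :
    Subsingleton (Algebra.H1Cotangent R A) ↔
      ∀ f : MvPolynomial A R, aeval (id : A → A) f = 0 →
        (∀ i, aeval (id : A → A) (pderiv i f) = 0) →
        f ∈ (RingHom.ker (aeval (id : A → A) : MvPolynomial A R →ₐ[R] A)) ^ 2 := by
  letI : Algebra (MvPolynomial A R) A := (aeval (id : A → A) : MvPolynomial A R →ₐ[R] A).toRingHom.toAlgebra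
  haveI : IsScalarTower R (MvPolynomial A R) A :=
    IsScalarTower.of_algebraMap_eq (fun r => ((aeval (id : A → A) : MvPolynomial A R →ₐ[R] A).commutes r).symm)
  have hs : Function.Surjective (algebraMap (MvPolynomial A R) A) := fun a =>
    ⟨X a, by change aeval (id : A → A) (X a) = a; simp⟩
  rw [← Algebra.FormallySmooth.kerCotangentToTensor_injective_iff (R := R) (P := MvPolynomial A R) hs,
    injective_iff_map_eq_zero]
  have key : ∀ f : MvPolynomial A R, ((1 : A) ⊗ₜ[MvPolynomial A R] KaehlerDifferential.D R (MvPolynomial A R) f = 0 ↔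
      ∀ i, aeval (id : A → A) (pderiv i f) = 0) := by
    intro f
    have hb := ((KaehlerDifferential.mvPolynomialBasis R A).baseChange A).ext_elem_iff
      (x := (1 : A) ⊗ₜ[MvPolynomial A R] KaehlerDifferential.D R (MvPolynomial A R) f) (y := 0)
    rw [hb]
    refine forall_congr' fun i => ?_
    rw [Module.Basis.baseChange_repr_tmul, KaehlerDifferential.mvPolynomialBasis_repr_apply, map_zero,
      Finsupp.zero_apply, Algebra.smul_def, mul_one]
    rfl
  constructor
  · intro h f hf hd
    have := h (Ideal.toCotangent _ ⟨f, hf⟩) (by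
      rw [KaehlerDifferential.kerCotangentToTensor_toCotangent]
      exact (key f).2 hd)
    exact (Ideal.toCotangent_eq_zero _ _).1 this
  · intro h x hx
    obtain ⟨⟨f, hf⟩, rfl⟩ := Ideal.toCotangent_surjective _ x
    rw [KaehlerDifferential.kerCotangentToTensor_toCotangent] at hx
    exact (Ideal.toCotangent_eq_zero _ _).2 (h f hf ((key f).1 hx))

open MvPolynomial in
/-- Every field extension of a perfect field is formally smooth. -/
theorem fs_perfect (F K : Type) [Field F] [Field K] [Algebra F K] [PerfectField F] :
    Algebra.FormallySmooth F K := by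
  refine ⟨inferInstance, (h1_crit F K).2 fun f hf hd => ?_⟩
  let L := IntermediateField.adjoin F (f.vars : Set K)
  haveI : Algebra.EssFiniteType F L := by
    rw [IntermediateField.essFiniteType_iff]
    exact ⟨f.vars, rfl⟩
  haveI : Algebra.FormallySmooth F L := inferInstance
  have hL := (h1_crit F L).1 inferInstance
  obtain ⟨g, hgf⟩ := exists_rename_eq_of_vars_subset_range (τ := L) f (fun x : L => (x : K))
    Subtype.val_injective (fun x hx => ⟨⟨x, IntermediateField.subset_adjoin F _ hx⟩, rfl⟩)
  clear_value L
  subst hgf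
  have hcomm : ∀ q : MvPolynomial L F, aeval (id : K → K) (rename (fun x : L => (x : K)) q) =
      ((aeval (id : L → L) q : L) : K) := by
    intro q
    rw [aeval_rename]
    have : (L.val.comp (aeval (id : L → L))) = (aeval ((id : K → K) ∘ fun x : L => (x : K))) := by
      ext i; simp
    rw [← this]; rfl
  have hg : g ∈ (RingHom.ker (aeval (id : L → L) : MvPolynomial L F →ₐ[F] L)) ^ 2 := by
    refine hL g ?_ fun i => ?_
    · rw [hcomm] at hf; exact_mod_cast hf
    · have := hd i
      rw [pderiv_rename Subtype.val_injective, hcomm] at this; exact_mod_cast this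
  have hle : (RingHom.ker (aeval (id : L → L) : MvPolynomial L F →ₐ[F] L)).map
      (rename (fun x : L => (x : K)) : _ →ₐ[F] _) ≤
      RingHom.ker (aeval (id : K → K) : MvPolynomial K F →ₐ[F] K) := by
    rw [Ideal.map_le_iff_le_comap]
    intro q hq
    have hq' : aeval (id : L → L) q = 0 := hq
    change aeval (id : K → K) (rename (fun x : L => (x : K)) q) = 0
    rw [hcomm, hq']; rfl
  refine Ideal.pow_right_mono hle 2 ?_
  rw [← Ideal.map_pow]
  exact Ideal.mem_map_of_mem _ hg

/-- A ring containing a field contains a perfect field. -/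
theorem exists_perfect (F S : Type) [Field F] [CommRing S] [Algebra F S] :
    ∃ (F0 : Type) (_ : Field F0) (_ : PerfectField F0), Nonempty (F0 →+* S) := by
  obtain ⟨p, hp⟩ := CharP.exists F
  rcases CharP.char_is_prime_or_zero F p with h | h
  · haveI : Fact p.Prime := ⟨h⟩
    exact ⟨ZMod p, inferInstance, inferInstance, ⟨(algebraMap F S).comp (ZMod.castHom dvd_rfl F)⟩⟩
  · subst h
    haveI : CharZero F := CharP.charP_to_charZero F
    exact ⟨ℚ, inferInstance, inferInstance, ⟨(algebraMap F S).comp (Rat.castHom F)⟩⟩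

/-- Coefficient fields of completions. -/
theorem exists_coef (F S : Type) [Field F] [CommRing S] [IsLocalRing S] [Algebra F S] :
    ∃ σ : (S ⧸ maximalIdeal S) →+* AdicCompletion (maximalIdeal S) S,
      ∀ x, AdicCompletion.evalOneₐ (maximalIdeal S) (σ x) = x := by
  obtain ⟨F0, _, _, ⟨ψ⟩⟩ := exists_perfect F S
  letI : Algebra F0 S := ψ.toAlgebra
  letI : Field (S ⧸ maximalIdeal S) := Ideal.Quotient.field _
  haveI : Algebra.FormallySmooth F0 (S ⧸ maximalIdeal S) := fs_perfect _ _
  obtain ⟨g, hg⟩ := Algebra.FormallySmooth.exists_adicCompletionEvalOneₐ_comp_eq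
    (R := F0) (I := maximalIdeal S) (AlgHom.id F0 (S ⧸ maximalIdeal S))
  exact ⟨g, fun x => DFunLike.congr_fun hg x⟩

end HL
end

section
namespace HL
open MvPowerSeries

theorem haus_mk {A : Type} [CommRing A] (M : Ideal A) [IsHausdorff M A] {x y : A}
    (h : ∀ k, Ideal.Quotient.mk (M ^ k) x = Ideal.Quotient.mk (M ^ k) y) : x = y := by
  rw [IsHausdorff.eq_iff_smodEq (I := M)]
  intro k
  rw [SModEq.sub_mem, smul_eq_mul, Ideal.mul_top]
  exact Ideal.Quotient.eq.1 (h k)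

theorem exists_ps_eval (n : ℕ) (K : Type) [Field K] {A : Type} [CommRing A] (M : Ideal A)
    [IsAdicComplete M A] (σ : K →+* A) (y : Fin n → A) (hy : ∀ i, y i ∈ M) :
    ∃ Φ : MvPowerSeries (Fin n) K →+* A, (∀ i, Φ (X i) = y i) ∧ ∀ a, Φ (C a) = σ a := by
  let J := MvPolynomial.idealOfVars (Fin n) K
  let g : MvPolynomial (Fin n) K →+* A := MvPolynomial.eval₂Hom σ y
  have hJ : J ≤ M.comap g := by
    refine Ideal.span_le.2 ?_
    rintro _ ⟨i, rfl⟩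
    change g (MvPolynomial.X i) ∈ M
    simpa [g] using hy i
  have hJk : ∀ k, J ^ k ≤ (M ^ k).comap g := fun k =>
    (Ideal.pow_right_mono hJ k).trans (Ideal.le_comap_pow g k)
  let f : ∀ k : ℕ, MvPowerSeries (Fin n) K →+* A ⧸ M ^ k := fun k =>
    (Ideal.quotientMap (M ^ k) g (hJk k)).comp (truncTotalAlgHom (Fin n) K k).toRingHom
  have hf0 : ∀ k x, f k x = Ideal.Quotient.mk (M ^ k) (g (truncTotal k x)) := fun k x => rfl
  have hf : ∀ {a b : ℕ} (hle : a ≤ b), (Ideal.Quotient.factorPow M hle).comp (f b) = f a := by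
    intro a b hle
    ext x
    rw [RingHom.comp_apply, hf0, hf0]
    change Ideal.Quotient.mk (M ^ a) _ = _
    rw [Ideal.Quotient.eq, ← map_sub]
    exact hJk a (truncTotal_sub_truncTotal_mem_pow_idealOfVars hle le_rfl x)
  have hp : ∀ p : MvPolynomial (Fin n) K, IsAdicComplete.liftRingHom M f hf p = g p := by
    intro p
    apply haus_mk M
    intro k
    rw [IsAdicComplete.mk_liftRingHom, hf0, Ideal.Quotient.eq, ← map_sub]
    refine hJk k ?_
    exact (MvPolynomial.mem_pow_idealOfVars_iff' ..).mpr fun x hx ↦ by simp [coeff_truncTotal _ hx]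
  refine ⟨IsAdicComplete.liftRingHom M f hf, fun i => ?_, fun a => ?_⟩
  · have := hp (MvPolynomial.X i)
    rw [MvPolynomial.coe_X] at this
    rw [this]; simp [g]
  · have := hp (MvPolynomial.C a)
    rw [MvPolynomial.coe_C] at this
    rw [this]; simp [g]

end HL
end

section
namespace HL
open MvPowerSeries

theorem dim_le_flat (S A : Type) [CommRing S] [CommRing A] [Algebra S A] [Module.FaithfullyFlat S A] :
    ringKrullDim S ≤ ringKrullDim A := by
  refine iSup_le fun l => ?_
  obtain ⟨Q, hQ⟩ := PrimeSpectrum.comap_surjective_of_faithfullyFlat (A := S) (B := A) l.last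
  haveI : Q.asIdeal.LiesOver l.last.asIdeal := ⟨by rw [← hQ]; rfl⟩
  obtain ⟨L, hL, -⟩ := Ideal.exists_ltSeries_of_hasGoingDown l Q.asIdeal
  rw [← hL]
  exact le_iSup (fun L : LTSeries (PrimeSpectrum A) => (L.length : WithBot ℕ∞)) L

theorem dim_ps_le (n : ℕ) (K : Type) [Field K] : ringKrullDim (PC n K) ≤ n := by
  refine (ringKrullDim_le_spanFinrank_maximalIdeal (R := PC n K)).trans ?_
  rw [← spanX_max]
  have h1 := Submodule.spanFinrank_span_le_ncard_of_finite (R := PC n K)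
    (Set.finite_range (X : Fin n → PC n K))
  have h2 : (Set.range (X : Fin n → PC n K)).ncard ≤ n := by
    rw [← Set.image_univ]
    refine (Set.ncard_image_le Set.finite_univ).trans ?_
    simp [Set.ncard_univ]
  exact_mod_cast h1.trans h2

theorem exists_ps (F S : Type) [Field F] [CommRing S] [IsNoetherianRing S] [IsLocalRing S] [Algebra F S]
    (n : ℕ) (hdim : ringKrullDim S = n) (y : Fin n → S) (hy : Ideal.span (Set.range y) = maximalIdeal S) :
    ∃ α : S →+* PC n (ResidueField S), α.FaithfullyFlat ∧ (∀ i, α (y i) = X i) ∧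
      ∀ c, ∃ s, c - α s ∈ (maximalIdeal S).map α := by
  let A := AdicCompletion (maximalIdeal S) S
  haveI : Module.FaithfullyFlat S A := Module.FaithfullyFlat.of_flat_of_isLocalHom
  obtain ⟨σ, hσ⟩ := exists_coef F S
  have hker := AdicCompletion.ker_evalOneₐ_eq_map (I := maximalIdeal S) (IsNoetherian.noetherian _)
  have hM : maximalIdeal A = (maximalIdeal S).map (algebraMap S A) := AdicCompletion.maximalIdeal_eq_map
  obtain ⟨Φ, hΦX, hΦC⟩ := exists_ps_eval n (ResidueField S) (maximalIdeal A) σ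
    (fun i => algebraMap S A (y i)) (fun i => by
      rw [hM]; exact Ideal.mem_map_of_mem _ (hy ▸ Ideal.subset_span ⟨i, rfl⟩))
  have hmap : (Ideal.span (Set.range (X : Fin n → PC n (ResidueField S)))).map Φ = maximalIdeal A := by
    have hmy := congrArg (Ideal.map (algebraMap S A)) hy
    rw [hM, ← hmy, Ideal.map_span, Ideal.map_span, ← Set.range_comp, ← Set.range_comp]
    congr 2
    funext i
    exact hΦX i
  have hsplit : ∀ a : A, ∃ k : ResidueField S, a - σ k ∈ maximalIdeal A := by
    intro a
    refine ⟨AdicCompletion.evalOneₐ (maximalIdeal S) a, ?_⟩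
    rw [hM, ← hker]
    change AdicCompletion.evalOneₐ (maximalIdeal S) _ = 0
    rw [map_sub, hσ, sub_self]
  have hsurj : Function.Surjective Φ := by
    haveI : IsHausdorff ((Ideal.span (Set.range (X : Fin n → PC n (ResidueField S)))).map Φ) A := by
      rw [hmap]; infer_instance
    refine surjective_of_mk_map_comp_surjective (I := Ideal.span (Set.range (X : Fin n → PC n (ResidueField S)))) Φ ?_
    intro b
    obtain ⟨a, rfl⟩ := Ideal.Quotient.mk_surjective b
    obtain ⟨k, hk⟩ := hsplit a
    refine ⟨C (R := ResidueField S) k, ?_⟩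
    refine (Ideal.Quotient.eq.2 ?_).symm
    have := hΦC k
    rw [hmap, this]; exact hk
  have hinj : Function.Injective Φ := by
    rw [injective_iff_map_eq_zero]
    intro r hr
    by_contra hne
    have h1 := ringKrullDim_succ_le_of_surjective Φ hsurj (mem_nonZeroDivisors_of_ne_zero hne) hr
    have h2 := dim_le_flat S A
    rw [hdim] at h2
    have h3 := (add_le_add_left h2 1).trans (h1.trans (dim_ps_le n (ResidueField S)))
    have h4 : n + 1 ≤ n := by exact_mod_cast h3
    omega
  let e : PC n (ResidueField S) ≃+* A := RingEquiv.ofBijective Φ ⟨hinj, hsurj⟩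
  refine ⟨(e.symm : A →+* PC n (ResidueField S)).comp (algebraMap S A), ?_, fun i => ?_, fun c => ?_⟩
  · refine RingHom.FaithfullyFlat.stableUnderComposition (algebraMap S A) _ ?_ (RingHom.FaithfullyFlat.of_bijective e.symm.bijective)
    exact RingHom.faithfullyFlat_algebraMap_iff.2 inferInstance
  · rw [RingHom.comp_apply]
    exact e.symm_apply_eq.2 (hΦX i).symm
  · obtain ⟨s, hs⟩ := Ideal.Quotient.mk_surjective (AdicCompletion.evalOneₐ (maximalIdeal S) (Φ c))
    refine ⟨s, ?_⟩
    have h1 : Φ c - algebraMap S A s ∈ (maximalIdeal S).map (algebraMap S A) := by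
      rw [← hker]
      change AdicCompletion.evalOneₐ (maximalIdeal S) _ = 0
      rw [map_sub, ← hs, sub_eq_zero]
      exact ((AdicCompletion.evalOneₐ (maximalIdeal S)).commutes s).symm
    have h2 := Ideal.mem_map_of_mem (e.symm : A →+* PC n (ResidueField S)) h1
    rw [Ideal.map_map] at h2
    have h3 : e.symm (Φ c - algebraMap S A s) = c - e.symm (algebraMap S A s) := by
      rw [map_sub]; congr 1; exact e.symm_apply_apply c
    exact h3 ▸ h2

end HL
end

section
namespace HL
open MvPowerSeries

theorem mem_pI_X (n : ℕ) (K : Type) [Field K] (k : ℕ) (l : List (Fin n)) (c : PC n K) :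
    c ∈ pI k (l.map (X : Fin n → PC n K)) ↔ ∀ β : Fin n →₀ ℕ, (∀ j ∈ l, β j < k) → coeff β c = 0 := by
  constructor
  · intro h
    refine Submodule.span_induction ?_ ?_ ?_ ?_ h
    · rintro _ ⟨b, hb, rfl⟩ β hβ
      obtain ⟨j, hj, rfl⟩ := List.mem_map.1 hb
      exact X_pow_dvd_iff.1 dvd_rfl β (hβ j hj)
    · intro β _; simp
    · intro x y _ _ hx hy β hβ
      rw [map_add, hx β hβ, hy β hβ, add_zero]
    · intro a x _ hx β hβ
      rw [smul_eq_mul, coeff_mul]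
      refine Finset.sum_eq_zero fun p hp => ?_
      rw [Finset.HasAntidiagonal.mem_antidiagonal] at hp
      rw [hx p.2 (fun j hj => ?_), mul_zero]
      have := hβ j hj
      rw [← hp, Finsupp.add_apply] at this
      omega
  · induction l generalizing c with
    | nil =>
      intro h
      have : c = 0 := by
        ext β
        rw [h β (by simp), map_zero]
      rw [this]; exact Ideal.zero_mem _
    | cons j l ih =>
      intro h
      let c1 : PC n K := fun β => if β j < k then 0 else coeff β c
      have hc1 : ∀ β, coeff β c1 = if β j < k then 0 else coeff β c := fun β => rfl
      have h1 : c1 ∈ pI k ((j :: l).map (X : Fin n → PC n K)) := by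
        obtain ⟨q, hq⟩ : (X j : PC n K) ^ k ∣ c1 := X_pow_dvd_iff.2 fun β hβ => by rw [hc1, if_pos hβ]
        rw [hq]
        exact Ideal.mul_mem_right _ _ (mem_pI (by simp))
      have h2 : c - c1 ∈ pI k (l.map (X : Fin n → PC n K)) := by
        refine ih _ fun β hβ => ?_
        rw [map_sub, hc1]
        split_ifs with hj
        · rw [h β (by simpa using ⟨hj, hβ⟩), sub_zero]
        · rw [sub_self]
      have h3 : pI k (l.map (X : Fin n → PC n K)) ≤ pI k ((j :: l).map (X : Fin n → PC n K)) := by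
        refine Ideal.span_mono ?_
        rintro r ⟨b, hb, rfl⟩
        exact ⟨b, List.mem_cons_of_mem _ hb, rfl⟩
      have := Ideal.add_mem _ (h3 h2) h1
      rwa [sub_add_cancel] at this

theorem nzl_X (n : ℕ) (K : Type) [Field K] (l : List (Fin n)) (hl : l.Nodup) :
    NZL (l.map (X : Fin n → PC n K)) (ModuleCat.of (PC n K) (PC n K)) := by
  induction l with
  | nil => trivial
  | cons j l ih =>
    obtain ⟨hj, hl'⟩ := List.nodup_cons.1 hl
    have hN := ih hl'
    refine ⟨?_, hN⟩
    intro v hv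
    have ht : ∃ k : ℕ, ∀ b ∈ l.map (X : Fin n → PC n K), b ^ k • v = 0 := by
      have h0 : ∀ b ∈ l.map (X : Fin n → PC n K), ∃ k : ℕ, b ^ k • v = 0 := fun b hb => HL_tors _ _ b hb v
      generalize l.map (X : Fin n → PC n K) = bs at *
      have : ∀ bs' : List (PC n K), (∀ b ∈ bs', ∃ k : ℕ, b ^ k • v = 0) → ∃ k : ℕ, ∀ b ∈ bs', b ^ k • v = 0 := by
        intro bs'
        induction bs' with
        | nil => intro _; exact ⟨0, by simp⟩
        | cons b bs' ih' =>
          intro h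
          obtain ⟨k1, h1⟩ := h b (by simp)
          obtain ⟨k2, h2⟩ := ih' (fun b' hb' => h b' (by simp [hb']))
          refine ⟨k1 + k2, fun b' hb' => ?_⟩
          rcases List.mem_cons.1 hb' with rfl | hb'
          · rw [add_comm, pow_add, mul_smul (b' ^ k2) (b' ^ k1) v, h1, smul_zero]
          · rw [pow_add, mul_smul (b' ^ k1) (b' ^ k2) v, h2 b' hb', smul_zero]
      exact this bs h0
    obtain ⟨k, hk⟩ := ht
    obtain ⟨c, rfl⟩ := eps_surj k _ _ hN v hk
    have h1 : eps k (ModuleCat.of (PC n K) (PC n K)) (l.map (X : Fin n → PC n K)) ((X j : PC n K) • c) = 0 :=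
      (map_smul (eps k (ModuleCat.of (PC n K) (PC n K)) (l.map (X : Fin n → PC n K))) (X j : PC n K) c).trans hv
    refine (eps_ker k _ hN c).2 ?_
    have h2 := (eps_ker k _ hN _).1 h1
    rw [mem_pI_X] at h2 ⊢
    intro β hβ
    have h3 := h2 (Finsupp.single j 1 + β) (fun i hi => by
      have : i ≠ j := fun e => hj (e ▸ hi)
      simpa [Finsupp.single_apply, this.symm] using hβ i hi)
    have h4 : coeff (Finsupp.single j 1 + β) ((X j : PC n K) * c) = coeff β c := by
      rw [X_def, coeff_add_monomial_mul, one_mul]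
    exact h4.symm.trans h3

theorem rg_X (n : ℕ) (K : Type) [Field K] : Rg ((List.finRange n).map (X : Fin n → PC n K)) := by
  refine ⟨nzl_X n K _ (List.nodup_finRange n), ?_⟩
  rw [← spanX_max, pI]
  congr 1
  ext r
  constructor
  · rintro ⟨b, hb, rfl⟩
    obtain ⟨j, -, rfl⟩ := List.mem_map.1 hb
    exact ⟨j, (pow_one _).symm⟩
  · rintro ⟨j, rfl⟩
    exact ⟨X j, List.mem_map.2 ⟨j, List.mem_finRange j, rfl⟩, (pow_one _).symm⟩

end HL
end

section
namespace HL
open MvPowerSeries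

theorem hom_soc {S C : Type} [CommRing S] [IsLocalRing S] [CommRing C] [Algebra S C] {n : ℕ} {h : HSR n C}
    (y : Fin n → S) (hy : ∀ i, algebraMap S C (y i) = h.x i) (hsp : Ideal.span (Set.range y) = maximalIdeal S)
    (hC : ∀ c : C, ∃ s, c - algebraMap S C s ∈ (maximalIdeal S).map (algebraMap S C))
    (N : Type) [AddCommGroup N] [Module C N]
    (hu : ∃ u ∈ soc h N, u ≠ 0 ∧ ∀ v ∈ soc h N, ∃ k : C, v = k • u) :
    Nonempty (((S ⧸ maximalIdeal S) →ₗ[S] Rs S C N) ≃ₗ[S] (S ⧸ maximalIdeal S)) := by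
  obtain ⟨u, hus, hu0, huv⟩ := hu
  have hkC : ∀ c ∈ (maximalIdeal S).map (algebraMap S C), c • u = 0 := by
    have : (maximalIdeal S).map (algebraMap S C) ≤ LinearMap.ker (LinearMap.toSpanSingleton C N u) := by
      rw [← hsp, Ideal.map_span, Ideal.span_le]
      rintro _ ⟨_, ⟨i, rfl⟩, rfl⟩
      rw [hy]
      exact hus i
    intro c hc
    exact this hc
  have hkS : ∀ s ∈ maximalIdeal S, algebraMap S C s • u = 0 := fun s hs => hkC _ (Ideal.mem_map_of_mem _ hs)
  let u' : Rs S C N := u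
  let g : (S ⧸ maximalIdeal S) →ₗ[S] Rs S C N :=
    Submodule.liftQ (maximalIdeal S) (LinearMap.toSpanSingleton S (Rs S C N) u') (fun s hs => hkS s hs)
  have hg1 : g (Ideal.Quotient.mk _ 1) = u' := one_smul S u'
  let Φ : S →ₗ[S] ((S ⧸ maximalIdeal S) →ₗ[S] Rs S C N) := LinearMap.toSpanSingleton S _ g
  have hΦ : ∀ s, Φ s = s • g := fun s => rfl
  have hsurj : Function.Surjective Φ := by
    intro φ
    have hv : (show N from φ (Ideal.Quotient.mk _ 1)) ∈ soc h N := by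
      intro i
      rw [← hy]
      change y i • φ (Ideal.Quotient.mk _ 1) = 0
      rw [← map_smul]
      have : y i • (Ideal.Quotient.mk (maximalIdeal S) 1) = 0 := by
        have h1 : y i ∈ maximalIdeal S := hsp ▸ Ideal.subset_span ⟨i, rfl⟩
        have : Ideal.Quotient.mk (maximalIdeal S) (y i * 1) = 0 := by
          rw [mul_one]; exact Ideal.Quotient.eq_zero_iff_mem.2 h1
        exact this
      rw [this, map_zero]
    obtain ⟨k, hk⟩ := huv _ hv
    obtain ⟨s, hs⟩ := hC k
    refine ⟨s, ?_⟩
    refine LinearMap.ext fun q => ?_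
    obtain ⟨r, rfl⟩ := Ideal.Quotient.mk_surjective q
    have e : φ (Ideal.Quotient.mk _ 1) = s • u' := by
      have h2 := hkC _ hs
      rw [sub_smul, sub_eq_zero] at h2
      exact hk.trans h2
    have e2 : Ideal.Quotient.mk (maximalIdeal S) r = r • Ideal.Quotient.mk (maximalIdeal S) 1 := by
      have : Ideal.Quotient.mk (maximalIdeal S) (r * 1) = r • Ideal.Quotient.mk (maximalIdeal S) 1 := rfl
      rw [mul_one] at this; exact this
    rw [e2, map_smul, map_smul, e, hΦ, LinearMap.smul_apply, hg1]
  have hker : LinearMap.ker Φ = maximalIdeal S := by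
    refine le_antisymm ?_ ?_
    · refine IsLocalRing.le_maximalIdeal ?_
      intro ht
      have : (1 : S) ∈ LinearMap.ker Φ := by rw [ht]; trivial
      rw [LinearMap.mem_ker, hΦ, one_smul] at this
      apply hu0
      have h3 := hg1
      rw [this] at h3
      exact h3.symm
    · intro s hs
      rw [LinearMap.mem_ker, hΦ]
      refine LinearMap.ext fun q => ?_
      obtain ⟨r, rfl⟩ := Ideal.Quotient.mk_surjective q
      rw [LinearMap.smul_apply, ← map_smul]
      have : s • (Ideal.Quotient.mk (maximalIdeal S) r) = 0 := by
        have : Ideal.Quotient.mk (maximalIdeal S) (s * r) = 0 := 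
          Ideal.Quotient.eq_zero_iff_mem.2 (Ideal.mul_mem_right _ _ hs)
        exact this
      rw [this, map_zero, LinearMap.zero_apply]
  refine ⟨?_⟩
  exact ((Submodule.quotEquivOfEq _ _ hker.symm).trans (Φ.quotKerEquivOfSurjective hsurj)).symm

theorem soc_C (n : ℕ) (K : Type) [Field K] (f ys : List (PC n K)) (hnz : NZL (ys ++ f) (ModuleCat.of (PC n K) (PC n K)))
    (hf : NZL f (ModuleCat.of (PC n K) (PC n K)))
    (I : Ideal (PC n K)) (hfI : ∀ b ∈ f, b ∈ I) (hfm : ∀ b ∈ f, b ∈ maximalIdeal (PC n K))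
    (hym : ∀ b ∈ ys, b ∈ maximalIdeal (PC n K)) (hl : (ys ++ f).length = n)
    (hF : ∀ φ : tor I (HA f) →ₗ[PC n K] HA f, ∃ r : PC n K, ∀ v, φ v = r • (v : HA f))
    (hne : ∃ v ∈ Gam I (HA f), v ≠ 0) :
    (∃ u ∈ soc (psr n K) (HL ys (ModuleCat.of (PC n K) (Gam I (HA f)))), u ≠ 0 ∧
      ∀ v ∈ soc (psr n K) (HL ys (ModuleCat.of (PC n K) (Gam I (HA f)))), ∃ k : PC n K, v = k • u) ∧
    Nonempty (HS (psr n K) (Gam I (HA f))) ∧ 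
    (∀ i, ∃ m, (psr n K).x i ^ m ∈ pI 1 f ⊔ pI 1 ys) := by
  have hrad : ∀ k (i : Fin n), ∃ m, (psr n K).x i ^ m ∈ pI k (ys ++ f) := by
    intro k i
    rw [← Ideal.mem_radical_iff, Ideal.radical_eq_sInf, Submodule.mem_sInf]
    rintro Q ⟨hQ, hQp⟩
    have : Q = maximalIdeal (PC n K) := by
      refine primary_of_len (rg_X n K) (ys ++ f) hnz ?_ ?_ Q hQp ?_
      · rw [hl]; simp
      · intro b hb
        rcases List.mem_append.1 hb with h | h
        · exact hym b h
        · exact hfm b h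
      · intro b hb
        exact hQp.mem_of_pow_mem _ (hQ (mem_pI hb))
    rw [this, psr_x, ← spanX_max]
    exact Ideal.subset_span ⟨i, rfl⟩
  let H' : HS (psr n K) (HA f) := (HS.self (psr n K)).HL (M := ModuleCat.of (PC n K) (PC n K)) f
  let H := H'.sub (Gam I (HA f)) (Gam_D H' I)
  have hr : Rig H H' (Gam I (HA f)).subtype := G_rig (rg_X n K) hf I hfI hF hne H'
  have hM : ∀ v : Gam I (HA f), ∃ k : ℕ, ∀ b ∈ f, b^k • v = 0 := by
    rintro ⟨v, k, hk⟩
    exact ⟨k, fun b hb => Subtype.ext (hk _ (Ideal.pow_mem_pow (hfI b hb) k))⟩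
  have hR := Rig.HL f ys hnz (ModuleCat.of (PC n K) (Gam I (HA f))) hM H H' hym (fun b hb => Cpl_max n K (hym b hb)) hr
  have hT := HL_tors_list (ModuleCat.of (PC n K) (Gam I (HA f))) f hM ys
  have hT2 : ∀ v : HL ys (ModuleCat.of (PC n K) (Gam I (HA f))), ∃ k, ∀ r ∈ pI k (ys ++ f), r • v = 0 := by
    intro v
    obtain ⟨k, hk⟩ := hT v
    refine ⟨k, fun r hr => ?_⟩
    have : pI k (ys ++ f) ≤ LinearMap.ker (LinearMap.toSpanSingleton (PC n K) _ v) := by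
      refine Ideal.span_le.2 ?_
      rintro _ ⟨b, hb, rfl⟩
      exact hk b hb
    exact this hr
  have hTors : Tors (psr n K) (HL ys (ModuleCat.of (PC n K) (Gam I (HA f)))) := by
    intro i v
    obtain ⟨k, hk⟩ := hT2 v
    obtain ⟨m, hm⟩ := hrad k i
    exact ⟨m, hk _ hm⟩
  refine ⟨Rig.soc hR hTors ?_ (psr_cst n K) (psr_split n K), ⟨H⟩, ?_⟩
  · intro v
    obtain ⟨k, hk⟩ := hT2 v
    have h1 : Ideal.span (Set.range (psr n K).x) ≤ (pI k (ys ++ f)).radical := by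
      rw [Ideal.span_le]
      rintro _ ⟨i, rfl⟩
      exact hrad k i
    obtain ⟨m, hm⟩ := Ideal.exists_pow_le_of_le_radical_of_fg h1 (IsNoetherian.noetherian _)
    exact ⟨m, fun r hr => hk r (hm hr)⟩
  · intro i
    obtain ⟨m, hm⟩ := hrad 1 i
    refine ⟨m, ?_⟩
    have : pI 1 (ys ++ f) ≤ pI 1 f ⊔ pI 1 ys := by
      refine Ideal.span_le.2 ?_
      rintro _ ⟨b, hb, rfl⟩
      rcases List.mem_append.1 hb with h | h
      · exact Ideal.mem_sup_right (mem_pI h)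
      · exact Ideal.mem_sup_left (mem_pI h)
    exact this hm
end HL
end

section
namespace HL
open MvPowerSeries

theorem main_S {S : Type} [CommRing S] [IsNoetherianRing S] [IsLocalRing S] (n : ℕ) (K : Type) [Field K]
    [Algebra S (PC n K)] [Module.FaithfullyFlat S (PC n K)] (y : Fin n → S)
    (hsp : Ideal.span (Set.range y) = maximalIdeal S)
    (hy : ∀ i, algebraMap S (PC n K) (y i) = X i)
    (hC : ∀ c : PC n K, ∃ s, c - algebraMap S (PC n K) s ∈ (maximalIdeal S).map (algebraMap S (PC n K)))
    (I : Ideal S) (d : ℕ) (hdn : d ≤ n) (hd : ringKrullDim (S ⧸ I) = d) (hS2 : S2 (S ⧸ I)) :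
    Nonempty ((((Ext S (ModuleCat S) d).obj (op (ModuleCat.of S (ResidueField S)))).obj
        ((localCohomology I (n - d)).obj (ModuleCat.of S S))) ≃ₗ[S] ResidueField S) := by
  have hy' : ∀ i, algebraMap S (PC n K) (y i) = (psr n K).x i := fun i => (hy i).trans (psr_x n K i).symm
  have hmap : ((List.finRange n).map y).map (algebraMap S (PC n K)) = (List.finRange n).map (X : Fin n → PC n K) := by
    rw [List.map_map]
    exact List.map_congr_left fun i _ => hy i
  have hmx : pI 1 ((List.finRange n).map y) = maximalIdeal S := by
    rw [← hsp]
    refine le_antisymm (Ideal.span_le.2 ?_) (Ideal.span_le.2 ?_)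
    · rintro _ ⟨b, hb, rfl⟩
      obtain ⟨i, _, rfl⟩ := List.mem_map.1 hb
      rw [pow_one]; exact Ideal.subset_span ⟨i, rfl⟩
    · rintro _ ⟨i, rfl⟩
      exact Ideal.subset_span ⟨y i, List.mem_map.2 ⟨i, List.mem_finRange i, rfl⟩, (pow_one _).symm⟩
  have H : Rg ((List.finRange n).map y) := by
    refine ⟨?_, hmx⟩
    rw [← nzl_iff (C := PC n K), hmap]
    exact nzl_X n K _ (List.nodup_finRange n)
  have hlen : ((List.finRange n).map y).length = n := by simp
  have hIm : I ≤ maximalIdeal S := by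
    refine IsLocalRing.le_maximalIdeal ?_
    rintro rfl
    have : Subsingleton (S ⧸ (⊤ : Ideal S)) := Ideal.Quotient.subsingleton_iff.2 rfl
    rw [ringKrullDim_eq_bot_of_subsingleton] at hd
    exact absurd hd (WithBot.bot_ne_coe)
  obtain ⟨f, hfl, hf, hfI⟩ := exists_f H I d (n - d) (DL_dim I d hd) (by rw [hlen]; omega)
  have hfm : ∀ b ∈ f, b ∈ maximalIdeal S := fun b hb => hIm (hfI b hb)
  obtain ⟨ys, hyl, hnz, hym⟩ := exists_y H f hf hfm d (by rw [hlen]; omega)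
  obtain ⟨p, g, hg, hgl, hIp⟩ := exists_p H I d hd f hf hfI (by rw [hlen]; omega)
  have hGr : Gr f p := hg.swap H hf (fun b hb => hIp (hfI b hb)) hgl.le
  obtain ⟨v, hv⟩ := hGr.vec
  have hvG : v ∈ Gam I (HA f) := tor_Gam1 I (fun r hr => (hv r).2 (hIp hr))
  have hv0 : v ≠ 0 := by
    rintro rfl
    exact hGr.pr.ne_top ((Ideal.eq_top_iff_one _).2 ((hv 1).1 (smul_zero _)))
  obtain ⟨j, hj⟩ := (BC.self (S := S) (C := PC n K)).hl f (N := ModuleCat.of S S) (N' := ModuleCat.of (PC n K) (PC n K))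
  have hjG := hj.gam I
  haveI : Module.Finite S (tor I (HA f)) := tor_finite 1 f hf I (pI_le I hfI)
  have hF := hj.endo I (endo_scalar H hf I hfI (S2.d0 I hS2) (S2.d1 I hS2))
  have hmm : ∀ b ∈ maximalIdeal S, algebraMap S (PC n K) b ∈ maximalIdeal (PC n K) := by
    have : (maximalIdeal S).map (algebraMap S (PC n K)) ≤ maximalIdeal (PC n K) := by
      rw [← hsp, Ideal.map_span, Ideal.span_le]
      rintro _ ⟨_, ⟨i, rfl⟩, rfl⟩
      rw [hy, ← spanX_max]
      exact Ideal.subset_span ⟨i, rfl⟩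
    exact fun b hb => this (Ideal.mem_map_of_mem _ hb)
  have hfI' : ∀ b ∈ f.map (algebraMap S (PC n K)), b ∈ I.map (algebraMap S (PC n K)) := by
    intro b hb
    obtain ⟨b, hb', rfl⟩ := List.mem_map.1 hb
    exact Ideal.mem_map_of_mem _ (hfI b hb')
  obtain ⟨hsoc, ⟨HG⟩, hx⟩ := soc_C n K (f.map (algebraMap S (PC n K))) (ys.map (algebraMap S (PC n K)))
    (by rw [← List.map_append, nzl_iff]; exact hnz) ((nzl_iff f).2 hf) (I.map (algebraMap S (PC n K)))
    hfI'
    (by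
      intro b hb
      obtain ⟨b, hb', rfl⟩ := List.mem_map.1 hb
      exact hmm _ (hfm b hb'))
    (by
      intro b hb
      obtain ⟨b, hb', rfl⟩ := List.mem_map.1 hb
      exact hmm _ (hym b hb'))
    (by rw [List.length_append, List.length_map, List.length_map]; omega)
    hF
    (by
      refine ⟨_, (show Gam (I.map (algebraMap S (PC n K))) (HA (f.map (algebraMap S (PC n K)))) from bcGam j I ⟨v, hvG⟩).2, ?_⟩
      intro h0
      apply hv0
      have h1 : bcGam j I ⟨v, hvG⟩ = 0 := Subtype.ext h0
      have h2 := hjG.inj (h1.trans (map_zero _).symm)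
      exact congrArg Subtype.val h2)
  obtain ⟨e1⟩ := lc_HL I (ModuleCat.of S S) f hf hfI
  rw [hfl] at e1
  obtain ⟨e3⟩ := hjG.ext (maximalIdeal S) hC d
  obtain ⟨-, ⟨e4⟩⟩ := extHS (h := psr n K) y hy' (List.finRange n) (List.nodup_finRange n) H.nz ys
    (by rw [hmx]; exact hym) (ModuleCat.of (PC n K) (Gam (I.map (algebraMap S (PC n K))) (HA (f.map (algebraMap S (PC n K))))))
    HG (I.map (algebraMap S (PC n K))) (by
      rintro ⟨w, k, hk⟩
      exact ⟨k, fun r hr => Subtype.ext (hk r hr)⟩) (by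
      intro i
      obtain ⟨m, hm⟩ := hx i
      exact ⟨m, sup_le_sup_right (pI_le _ hfI') _ hm⟩)
  rw [hmx, hyl] at e4
  obtain ⟨e6⟩ := hom_soc y hy' hsp hC _ hsoc
  have e2 : (((Ext S (ModuleCat S) d).obj (op (ModuleCat.of S (ResidueField S)))).obj
        ((localCohomology I (n - d)).obj (ModuleCat.of S S))) ≃ₗ[S] EE S (S ⧸ maximalIdeal S) (Gam I (HA f)) d :=
    (EE.old (X := S ⧸ maximalIdeal S) (N := (localCohomology I (n - d)).obj (ModuleCat.of S S)) d).trans (EE.postE e1 d)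
  exact ⟨e2.trans (e3.trans (e4.trans (EE.hom0.trans e6)))⟩

end HL
end

theorem highest_lyubeznik_number_of_S2
    {S : Type} [CommRing S] [IsNoetherianRing S] [IsLocalRing S]
    (F : Type) [Field F] [Algebra F S]
    (n : ℕ) (hdim : ringKrullDim S = n)
    (hreg : ∃ s : Finset S, s.card = n ∧ Ideal.span (s : Set S) = maximalIdeal S)
    (I : Ideal S) (d : ℕ) (hd : ringKrullDim (S ⧸ I) = d)
    (hS2 : ∀ (P : Ideal (S ⧸ I)) (hP : P.IsPrime) (i : ℕ),
      (i : ℕ∞) < min 2 (Order.height (⟨P, hP⟩ : PrimeSpectrum (S ⧸ I))) →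
      Subsingleton ((((Ext (Localization.AtPrime P) (ModuleCat (Localization.AtPrime P)) i).obj
          (op (ModuleCat.of (Localization.AtPrime P)
            (ResidueField (Localization.AtPrime P))))).obj
        (ModuleCat.of (Localization.AtPrime P) (Localization.AtPrime P))) : Type)) :
    Nonempty ((((Ext S (ModuleCat S) d).obj (op (ModuleCat.of S (ResidueField S)))).obj
        ((localCohomology I (n - d)).obj (ModuleCat.of S S))) ≃ₗ[S] ResidueField S) := by
  obtain ⟨s, hs, hsp⟩ := hreg
  have hy : Ideal.span (Set.range (fun i : Fin n => ((s.equivFinOfCardEq hs).symm i : S))) = maximalIdeal S := by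
    rw [← hsp]
    congr 1
    ext a
    constructor
    · rintro ⟨i, rfl⟩
      exact ((s.equivFinOfCardEq hs).symm i).2
    · intro ha
      exact ⟨s.equivFinOfCardEq hs ⟨a, ha⟩, by simp⟩
  obtain ⟨α, hα, hαy, hαC⟩ := HL.exists_ps F S n hdim _ hy
  have hdn : d ≤ n := by
    have := ringKrullDim_quotient_le I
    rw [hd, hdim] at this
    exact_mod_cast this
  exact @HL.main_S S _ _ _ n (ResidueField S) _ α.toAlgebra hα _ hy hαy hαC I d hdn hd hS2
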